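/- Let Λ_Φ be an arbitrary self-affine sponge. Then sup{δ(r) : r a good cycle} ≤ HD(Λ_Φ) ≤ sup{δ(r) : r ∈ R}, and sup{δ(p) : p ∈ P good} ≤ DynD(Φ) ≤ sup{δ(p) : p ∈ P}. -/

import Mathlib

open MeasureTheory Filter Set Metric
open scoped Classical Topology ENNReal NNReal

namespace SelfAffineSponge

/-- A diagonal IFS on `[0,1]^d`: for each coordinate `i ∈ D = Fin d` a finite alphabet
`A i` indexing affine maps `x ↦ slope i a * x + off i a` of `[0,1]`, together with a
set `E ⊆ ∏ i, A i` of allowed tuples of symbols. -/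
structure DiagIFS (d : ℕ) (A : Fin d → Type) [∀ i, Fintype (A i)] where
  slope : ∀ i : Fin d, A i → ℝ
  off : ∀ i : Fin d, A i → ℝ
  E : Finset (∀ i, A i)

variable {d : ℕ} {A : Fin d → Type} [∀ i, Fintype (A i)]

namespace DiagIFS

/-- the base similarity `φ_{i,a}` in coordinate `i` -/
def base (Φ : DiagIFS d A) (i : Fin d) (a : A i) (x : ℝ) : ℝ :=
  Φ.slope i a * x + Φ.off i a

/-- the data defines an honest diagonal IFS: `E` is nonempty and each base map is a
contracting similarity of `[0,1]` -/
def Valid (Φ : DiagIFS d A) : Prop :=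
  Φ.E.Nonempty ∧ (∀ i a, Φ.slope i a ≠ 0) ∧ (∀ i a, |Φ.slope i a| < 1) ∧
    ∀ i a, ∀ x ∈ Set.Icc (0:ℝ) 1, Φ.base i a x ∈ Set.Icc (0:ℝ) 1

/-- the alphabet `E` of the IFS, as a type -/
abbrev Symb (Φ : DiagIFS d A) : Type _ := {a : ∀ i, A i // a ∈ Φ.E}

instance (Φ : DiagIFS d A) : MeasurableSpace Φ.Symb := ⊤
instance (Φ : DiagIFS d A) : TopologicalSpace Φ.Symb := ⊥

/-- the affine contraction `φ_a` of `[0,1]^d` associated to a tuple of symbols -/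
def affMap (Φ : DiagIFS d A) (a : ∀ i, A i) (x : Fin d → ℝ) : Fin d → ℝ :=
  fun i => Φ.base i (a i) (x i)

/-- the coding map `π(ω) = lim_n φ_{ω_0}∘⋯∘φ_{ω_{n-1}}(0)`, written in closed form -/
noncomputable def coding (Φ : DiagIFS d A) (ω : ℕ → Φ.Symb) : Fin d → ℝ :=
  fun i => ∑' n : ℕ, (∏ k ∈ Finset.range n, Φ.slope i ((ω k).1 i)) * Φ.off i ((ω n).1 i)

/-- the limit set `Λ_Φ = π(E^ℕ)` (the self-affine sponge) -/
def limitSet (Φ : DiagIFS d A) : Set (Fin d → ℝ) :=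
  Set.range Φ.coding

theorem coding_mem (Φ : DiagIFS d A) (ω : ℕ → Φ.Symb) : Φ.coding ω ∈ Φ.limitSet :=
  ⟨ω, rfl⟩

/-- the `i`-th Lyapunov exponent `χ_i(p) = -∫ log|φ'_{a,i}| dp(a)` of a finite measure
`p` on `E` (given by its density) -/
noncomputable def chi (Φ : DiagIFS d A) (i : Fin d) (p : Φ.Symb → ℝ) : ℝ :=
  -∑ a : Φ.Symb, p a * Real.log |Φ.slope i (a.1 i)|

/-- the mass `p([a]_I)` of the cylinder `[a]_I = {b ∈ E : b_i = a_i ∀ i ∈ I}` -/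
noncomputable def cylMass (Φ : DiagIFS d A) (I : Finset (Fin d)) (p : Φ.Symb → ℝ)
    (a : Φ.Symb) : ℝ :=
  ∑ b : Φ.Symb, if ∀ i ∈ I, b.1 i = a.1 i then p b else 0

/-- the entropy `h(I; p) = -∫ log p([a]_I) dp(a)` -/
noncomputable def entropy (Φ : DiagIFS d A) (I : Finset (Fin d)) (p : Φ.Symb → ℝ) : ℝ :=
  -∑ a : Φ.Symb, p a * Real.log (Φ.cylMass I p a)

/-- the conditional entropy `h(I' | I; p) = h(I';p) - h(I;p)` -/
noncomputable def condEntropy (Φ : DiagIFS d A) (I I' : Finset (Fin d))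
    (p : Φ.Symb → ℝ) : ℝ :=
  Φ.entropy I' p - Φ.entropy I p

/-- a coordinate set `I ⊆ D` is good if the projected IFS `Φ_I` satisfies the open set
condition: the boxes `φ_{I,a}((0,1)^I)`, indexed by distinct projections of elements of
`E`, are pairwise disjoint (equivalently, some coordinate has disjoint intervals). -/
def GoodIdx (Φ : DiagIFS d A) (I : Finset (Fin d)) : Prop :=
  ∀ a ∈ Φ.E, ∀ b ∈ Φ.E, (∃ i ∈ I, a i ≠ b i) →
    ∃ i ∈ I, Disjoint (Φ.base i (a i) '' Set.Ioo (0:ℝ) 1)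
      (Φ.base i (b i) '' Set.Ioo (0:ℝ) 1)

/-- Barański condition: each base IFS satisfies the open set condition w.r.t. `(0,1)` -/
def Baranski (Φ : DiagIFS d A) : Prop :=
  ∀ i : Fin d, ∀ a b : A i, a ≠ b →
    Disjoint (Φ.base i a '' Set.Ioo (0:ℝ) 1) (Φ.base i b '' Set.Ioo (0:ℝ) 1)

/-- strong Barański condition: each base IFS satisfies the strong separation condition
w.r.t. `[0,1]` -/
def StronglyBaranski (Φ : DiagIFS d A) : Prop :=
  ∀ i : Fin d, ∀ a b : A i, a ≠ b →
    Disjoint (Φ.base i a '' Set.Icc (0:ℝ) 1) (Φ.base i b '' Set.Icc (0:ℝ) 1)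

/-- coordinate ordering condition: some permutation `σ` of the coordinates has
`|φ'_{a,σ(1)}| > ⋯ > |φ'_{a,σ(d)}|` for all `a ∈ E` -/
def CoordOrdering (Φ : DiagIFS d A) : Prop :=
  ∃ σ : Equiv.Perm (Fin d), ∀ a ∈ Φ.E, ∀ i j : Fin d, i < j →
    |Φ.slope (σ j) (a (σ j))| < |Φ.slope (σ i) (a (σ i))|

end DiagIFS

/-- a probability vector (probability measure on a finite set, via its density) -/
def IsProbVec {α : Type*} [Fintype α] (p : α → ℝ) : Prop :=
  (∀ a, 0 ≤ p a) ∧ ∑ a, p a = 1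

/-- a measure `p` on `E` is good if `I(p,x) = {i : χ_i(p) ≤ x}` is good for all `x > 0` -/
def DiagIFS.GoodVec (Φ : DiagIFS d A) (p : Φ.Symb → ℝ) : Prop :=
  ∀ x > 0, Φ.GoodIdx (Finset.univ.filter fun i => Φ.chi i p ≤ x)

/-- a cycle on `E`: a continuous exponentially `λ`-periodic map `(0,∞) → P`,
where `λ = 1` means constant -/
structure Cycle (Φ : DiagIFS d A) where
  lam : ℝ
  one_le_lam : 1 ≤ lam
  r : ℝ → Φ.Symb → ℝ
  prob : ∀ b > 0, IsProbVec (r b)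
  cont : ContinuousOn r (Set.Ioi 0)
  periodic : ∀ b > 0, r (lam * b) = r b
  const_of_lam_eq_one : lam = 1 → ∀ b > 0, ∀ b' > 0, r b = r b'

/-- the number `B_i`, determined by `B = ∫_0^{B_i} χ_i(r_b) db` (written via `sInf`;
for a cycle the function `x ↦ ∫_0^x χ_i(r_b) db` is continuous and strictly
increasing, so the infimum is the unique solution) -/
noncomputable def Bcoord (Φ : DiagIFS d A) (r : ℝ → Φ.Symb → ℝ) (B : ℝ) (i : Fin d) : ℝ :=
  sInf {x : ℝ | 0 ≤ x ∧ B ≤ ∫ b in Set.Ioc (0:ℝ) x, Φ.chi i (r b)}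

/-- `δ(r, B) = B⁻¹ ∫_0^∞ h({i : b ≤ B_i}; r_b) db` -/
noncomputable def deltaRB (Φ : DiagIFS d A) (r : ℝ → Φ.Symb → ℝ) (B : ℝ) : ℝ :=
  B⁻¹ * ∫ b in Set.Ioi (0:ℝ),
    Φ.entropy (Finset.univ.filter fun i => b ≤ Bcoord Φ r B i) (r b)

/-- `δ(r) = inf_{B ∈ [1,λ]} δ(r,B)` -/
noncomputable def Cycle.delta {Φ : DiagIFS d A} (c : Cycle Φ) : ℝ :=
  sInf (deltaRB Φ c.r '' Set.Icc 1 c.lam)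

/-- `δ(p) = ∫_0^∞ h({i : b ≤ 1/χ_i(p)}; p) db` -/
noncomputable def deltaP (Φ : DiagIFS d A) (p : Φ.Symb → ℝ) : ℝ :=
  ∫ b in Set.Ioi (0:ℝ),
    Φ.entropy (Finset.univ.filter fun i => b ≤ (Φ.chi i p)⁻¹) p

/-- the normalized average `R̂_B = B⁻¹ ∫_0^B r_b db` of a cycle -/
noncomputable def cycleAvg {Φ : DiagIFS d A} (c : Cycle Φ) (B : ℝ) : Φ.Symb → ℝ :=
  fun a => B⁻¹ * ∫ b in Set.Ioc (0:ℝ) B, c.r b a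

/-- a cycle is good if all its normalized averages `R̂_B` are good -/
def Cycle.Good {Φ : DiagIFS d A} (c : Cycle Φ) : Prop :=
  ∀ B > 0, Φ.GoodVec (cycleAvg c B)

/-- a cycle is nondegenerate if `{b > 0 : r_b(a) > 0 ∀ a ∈ E_r}` is dense in `(0,∞)` -/
def Cycle.Nondeg {Φ : DiagIFS d A} (c : Cycle Φ) : Prop :=
  Set.Ioi (0:ℝ) ⊆
    closure {b : ℝ | 0 < b ∧ ∀ a : Φ.Symb, (∃ b' > 0, 0 < c.r b' a) → 0 < c.r b a}

/-- the lower pointwise dimension `d̲(x,μ) = liminf_{ρ→0} log μ(B(x,ρ))/log ρ` -/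
noncomputable def lowerPtDim {X : Type*} [PseudoMetricSpace X] [MeasurableSpace X]
    (μ : Measure X) (x : X) : ℝ≥0∞ :=
  Filter.liminf
    (fun ρ : ℝ => ENNReal.ofReal (Real.log (μ (Metric.ball x ρ)).toReal / Real.log ρ))
    (𝓝[>] (0:ℝ))

/-- the Hausdorff dimension of a measure: the essential supremum of its lower
pointwise dimension -/
noncomputable def measDim {X : Type*} [PseudoMetricSpace X] [MeasurableSpace X]
    (μ : Measure X) : ℝ≥0∞ :=
  essSup (lowerPtDim μ) μ

/-- the shift map on `E^ℕ` -/
def shift {α : Type*} (ω : ℕ → α) : ℕ → α := fun n => ω (n + 1)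

/-- the dynamical dimension: the supremum of `HD(π_*μ)` over shift-invariant
probability measures `μ` on `E^ℕ` -/
noncomputable def DiagIFS.dynDim (Φ : DiagIFS d A) : ℝ≥0∞ :=
  sSup {x : ℝ≥0∞ | ∃ μ : Measure (ℕ → Φ.Symb), IsProbabilityMeasure μ ∧
    Measure.map shift μ = μ ∧ x = measDim (Measure.map Φ.coding μ)}

/-- `μ` is the product measure on `E^ℕ` whose `k`-th factor has density `p k`
(this property characterizes `μ` uniquely) -/
def IsProductMeasure (Φ : DiagIFS d A) (p : ℕ → Φ.Symb → ℝ)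
    (μ : Measure (ℕ → Φ.Symb)) : Prop :=
  IsProbabilityMeasure μ ∧
    ∀ (n : ℕ) (w : ℕ → Φ.Symb),
      (μ {ω | ∀ k < n, ω k = w k}).toReal = ∏ k ∈ Finset.range n, p k (w k)

/-- the set of Hausdorff dimensions of Bernoulli measures `ν_p = π_*[p^ℕ]` -/
noncomputable def bernoulliDims (Φ : DiagIFS d A) : Set ℝ≥0∞ :=
  {x | ∃ p : Φ.Symb → ℝ, IsProbVec p ∧ ∃ μ : Measure (ℕ → Φ.Symb),
    IsProductMeasure Φ (fun _ => p) μ ∧ x = measDim (Measure.map Φ.coding μ)}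

/-- the set of Hausdorff dimensions of pseudo-Bernoulli measures
`ν_r = π_*[∏_n r_n]` -/
noncomputable def pseudoBernoulliDims (Φ : DiagIFS d A) : Set ℝ≥0∞ :=
  {x | ∃ c : Cycle Φ, ∃ μ : Measure (ℕ → Φ.Symb),
    IsProductMeasure Φ (fun n => c.r ((n : ℝ) + 1)) μ ∧
      x = measDim (Measure.map Φ.coding μ)}


section

namespace DiagIFS

/-- the exponent `-log |φ'_{a,i}|` of a single symbol -/
noncomputable def lexp (Φ : DiagIFS d A) (i : Fin d) (a : Φ.Symb) : ℝ :=
  -Real.log |Φ.slope i (a.1 i)|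

theorem chi_eq (Φ : DiagIFS d A) (i : Fin d) (p : Φ.Symb → ℝ) :
    Φ.chi i p = ∑ a, p a * Φ.lexp i a := by
  simp [chi, lexp, Finset.sum_neg_distrib]

theorem lexp_pos {Φ : DiagIFS d A} (hV : Φ.Valid) (i : Fin d) (a : Φ.Symb) :
    0 < Φ.lexp i a := by
  have h1 := hV.2.1 i (a.1 i)
  have h2 := hV.2.2.1 i (a.1 i)
  have := Real.log_neg (abs_pos.mpr h1) h2
  simp only [lexp]; linarith

theorem exp_neg_lexp {Φ : DiagIFS d A} (hV : Φ.Valid) (i : Fin d) (a : Φ.Symb) :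
    Real.exp (-Φ.lexp i a) = |Φ.slope i (a.1 i)| := by
  rw [lexp, neg_neg, Real.exp_log (abs_pos.mpr (hV.2.1 _ _))]

theorem exists_lexp_bounds {Φ : DiagIFS d A} (hV : Φ.Valid) :
    ∃ c C : ℝ, 0 < c ∧ c ≤ C ∧ ∀ i a, c ≤ Φ.lexp i a ∧ Φ.lexp i a ≤ C := by
  let g : Option (Fin d × Φ.Symb) → ℝ := fun x => x.elim 1 fun y => Φ.lexp y.1 y.2
  obtain ⟨x, hx⟩ := Finite.exists_min g
  obtain ⟨y, hy⟩ := Finite.exists_max g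
  refine ⟨g x, g y, ?_, hx y, fun i a => ⟨hx (some (i, a)), hy (some (i, a))⟩⟩
  rcases x with _ | x
  · simp [g]
  · exact lexp_pos hV _ _

/-- the coordinates in `I` of a tuple of symbols, the others being forgotten -/
noncomputable def proj (I : Finset (Fin d)) (a : ∀ i, A i) : ∀ i, Option (A i) :=
  fun i => if i ∈ I then some (a i) else none

omit [∀ i, Fintype (A i)] in
theorem proj_eq_iff {I : Finset (Fin d)} {a b : ∀ i, A i} :
    proj I a = proj I b ↔ ∀ i ∈ I, a i = b i := by
  constructor
  · intro h i hi
    have := congrFun h i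
    simpa [proj, hi] using this
  · intro h
    funext i
    by_cases hi : i ∈ I
    · simp [proj, hi, h i hi]
    · simp [proj, hi]

/-- the image of `p` under the projection to the coordinates in `I` -/
noncomputable def projMass (Φ : DiagIFS d A) (I : Finset (Fin d)) (p : Φ.Symb → ℝ)
    (v : ∀ i, Option (A i)) : ℝ :=
  ∑ b : Φ.Symb, if proj I b.1 = v then p b else 0

theorem cylMass_eq (Φ : DiagIFS d A) (I : Finset (Fin d)) (p : Φ.Symb → ℝ) (a : Φ.Symb) :
    Φ.cylMass I p a = Φ.projMass I p (proj I a.1) := by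
  simp [cylMass, projMass, proj_eq_iff]

theorem sum_projMass (Φ : DiagIFS d A) (I : Finset (Fin d)) (p : Φ.Symb → ℝ) :
    ∑ v, Φ.projMass I p v = ∑ a, p a := by
  simp only [projMass]
  rw [Finset.sum_comm]
  simp

theorem entropy_eq (Φ : DiagIFS d A) (I : Finset (Fin d)) (p : Φ.Symb → ℝ) :
    Φ.entropy I p = ∑ v, Real.negMulLog (Φ.projMass I p v) := by
  have h : ∀ a : Φ.Symb, p a * Real.log (Φ.cylMass I p a) =
      ∑ v, if proj I a.1 = v then p a * Real.log (Φ.projMass I p v) else 0 := by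
    intro a
    rw [cylMass_eq]
    simp
  simp only [entropy, h]
  rw [Finset.sum_comm, ← Finset.sum_neg_distrib]
  refine Finset.sum_congr rfl fun v _ => ?_
  rw [Real.negMulLog, neg_mul, projMass, Finset.sum_mul]
  congr 1
  refine Finset.sum_congr rfl fun a _ => ?_
  split_ifs <;> simp

theorem cylMass_mono (Φ : DiagIFS d A) {I I' : Finset (Fin d)} (h : I ⊆ I') {p : Φ.Symb → ℝ}
    (hp : ∀ a, 0 ≤ p a) (a : Φ.Symb) : Φ.cylMass I' p a ≤ Φ.cylMass I p a := by
  refine Finset.sum_le_sum fun b _ => ?_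
  by_cases h1 : ∀ i ∈ I', b.1 i = a.1 i
  · rw [if_pos h1, if_pos fun i hi => h1 i (h hi)]
  · rw [if_neg h1]
    split_ifs
    exacts [hp b, le_rfl]

theorem le_cylMass (Φ : DiagIFS d A) (I : Finset (Fin d)) {p : Φ.Symb → ℝ}
    (hp : ∀ a, 0 ≤ p a) (a : Φ.Symb) : p a ≤ Φ.cylMass I p a := by
  have := Finset.single_le_sum (f := fun b : Φ.Symb => if ∀ i ∈ I, b.1 i = a.1 i then p b else 0)
    (s := Finset.univ) (fun b _ => by split_ifs; exacts [hp b, le_rfl])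
    (Finset.mem_univ a)
  simpa [cylMass] using this

theorem cylMass_le_one (Φ : DiagIFS d A) (I : Finset (Fin d)) {p : Φ.Symb → ℝ}
    (hp : IsProbVec p) (a : Φ.Symb) : Φ.cylMass I p a ≤ 1 := by
  rw [← hp.2]
  refine Finset.sum_le_sum fun b _ => ?_
  split_ifs
  exacts [le_rfl, hp.1 b]

theorem entropy_mono (Φ : DiagIFS d A) {I I' : Finset (Fin d)} (h : I ⊆ I') {p : Φ.Symb → ℝ}
    (hp : IsProbVec p) : Φ.entropy I p ≤ Φ.entropy I' p := by
  refine neg_le_neg (Finset.sum_le_sum fun a _ => ?_)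
  rcases (hp.1 a).eq_or_lt with h0 | h0
  · simp [← h0]
  · exact mul_le_mul_of_nonneg_left (Real.log_le_log (h0.trans_le (Φ.le_cylMass _ hp.1 a))
      (Φ.cylMass_mono h hp.1 a)) h0.le

theorem entropy_empty (Φ : DiagIFS d A) {p : Φ.Symb → ℝ} (hp : IsProbVec p) :
    Φ.entropy ∅ p = 0 := by
  have h : ∀ a, Φ.cylMass ∅ p a = 1 := fun a => by
    rw [← hp.2]; exact Finset.sum_congr rfl fun b _ => if_pos fun i hi => absurd hi (by simp)
  simp only [entropy, h, Real.log_one, mul_zero, Finset.sum_const_zero, neg_zero]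

theorem entropy_nonneg (Φ : DiagIFS d A) (I : Finset (Fin d)) {p : Φ.Symb → ℝ}
    (hp : IsProbVec p) : 0 ≤ Φ.entropy I p :=
  (Φ.entropy_empty hp).symm.le.trans (Φ.entropy_mono (Finset.empty_subset I) hp)

theorem entropy_le_card (Φ : DiagIFS d A) (I : Finset (Fin d)) {p : Φ.Symb → ℝ}
    (hp : IsProbVec p) : Φ.entropy I p ≤ Fintype.card Φ.Symb := by
  rw [entropy, ← Finset.sum_neg_distrib]
  have : ∀ a : Φ.Symb, -(p a * Real.log (Φ.cylMass I p a)) ≤ 1 := by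
    intro a
    rcases (hp.1 a).eq_or_lt with h0 | h0
    · simp [← h0]
    · have h1 := Real.log_le_log h0 (Φ.le_cylMass I hp.1 a)
      have h2 := mul_le_mul_of_nonneg_left h1 h0.le
      have h3 := Real.one_sub_inv_le_log_of_pos h0
      have h4 := mul_le_mul_of_nonneg_left h3 h0.le
      have : p a * (1 - (p a)⁻¹) = p a - 1 := by field_simp
      linarith
  calc _ ≤ ∑ _a : Φ.Symb, (1 : ℝ) := Finset.sum_le_sum fun a _ => this a
    _ = _ := by simp

theorem continuous_projMass (Φ : DiagIFS d A) (I : Finset (Fin d)) (v : ∀ i, Option (A i)) :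
    Continuous fun p : Φ.Symb → ℝ => Φ.projMass I p v := by
  refine continuous_finsetSum _ fun b _ => ?_
  split_ifs <;> fun_prop

theorem continuous_entropy (Φ : DiagIFS d A) (I : Finset (Fin d)) :
    Continuous fun p : Φ.Symb → ℝ => Φ.entropy I p := by
  simp only [entropy_eq]
  exact continuous_finsetSum _ fun v _ => Real.continuous_negMulLog.comp (Φ.continuous_projMass I v)

theorem continuous_chi (Φ : DiagIFS d A) (i : Fin d) :
    Continuous fun p : Φ.Symb → ℝ => Φ.chi i p := by
  simp only [chi_eq]
  fun_prop

theorem entropy_uniform (Φ : DiagIFS d A) {ε : ℝ} (hε : 0 < ε) :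
    ∃ η > 0, ∀ I, ∀ p p' : Φ.Symb → ℝ, IsProbVec p → IsProbVec p' →
      (∀ a, |p a - p' a| ≤ η) → |Φ.entropy I p - Φ.entropy I p'| ≤ ε := by
  have hc : Continuous fun p : Φ.Symb → ℝ => fun I : Finset (Fin d) => Φ.entropy I p :=
    continuous_pi fun I => Φ.continuous_entropy I
  have hu := (isCompact_stdSimplex ℝ Φ.Symb).uniformContinuousOn_of_continuous hc.continuousOn
  obtain ⟨η, hη, h⟩ := Metric.uniformContinuousOn_iff.mp hu ε hε
  refine ⟨η / 2, half_pos hη, fun I p p' hp hp' hpp => ?_⟩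
  have h1 : dist p p' < η := by
    refine ((dist_pi_le_iff (half_pos hη).le).mpr fun a => ?_).trans_lt (half_lt_self hη)
    exact hpp a
  have h2 := h p ⟨hp.1, hp.2⟩ p' ⟨hp'.1, hp'.2⟩ h1
  exact ((dist_le_pi_dist _ _ I).trans_lt h2).le

theorem chi_bounds {Φ : DiagIFS d A} {c C : ℝ} (h : ∀ i a, c ≤ Φ.lexp i a ∧ Φ.lexp i a ≤ C)
    {p : Φ.Symb → ℝ} (hp : IsProbVec p) (i : Fin d) : c ≤ Φ.chi i p ∧ Φ.chi i p ≤ C := by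
  rw [chi_eq]
  constructor
  · calc c = ∑ a, p a * c := by rw [← Finset.sum_mul, hp.2, one_mul]
      _ ≤ _ := Finset.sum_le_sum fun a _ => mul_le_mul_of_nonneg_left (h i a).1 (hp.1 a)
  · calc _ ≤ ∑ a, p a * C :=
          Finset.sum_le_sum fun a _ => mul_le_mul_of_nonneg_left (h i a).2 (hp.1 a)
      _ = C := by rw [← Finset.sum_mul, hp.2, one_mul]

theorem chi_sub_le {Φ : DiagIFS d A} {c C : ℝ} (hc : 0 < c)
    (h : ∀ i a, c ≤ Φ.lexp i a ∧ Φ.lexp i a ≤ C)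
    {p p' : Φ.Symb → ℝ} {η : ℝ} (hpp : ∀ a, |p a - p' a| ≤ η) (i : Fin d) :
    Φ.chi i p ≤ Φ.chi i p' + Fintype.card Φ.Symb * (C * η) := by
  have : Φ.chi i p - Φ.chi i p' ≤ ∑ _a : Φ.Symb, C * η := by
    rw [chi_eq, chi_eq, ← Finset.sum_sub_distrib]
    refine Finset.sum_le_sum fun a _ => ?_
    have h1 := h i a
    have h2 := le_of_abs_le (hpp a)
    have h3 := (abs_nonneg _).trans (hpp a)
    nlinarith [mul_nonneg h3 (sub_nonneg.mpr h1.2)]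
  rw [Finset.sum_const, nsmul_eq_mul, Finset.card_univ] at this
  linarith

end DiagIFS

theorem IsProbVec.nonempty {α : Type*} [Fintype α] {p : α → ℝ} (h : IsProbVec p) :
    Nonempty α := by
  by_contra hα
  rw [not_nonempty_iff] at hα
  simpa using h.2

theorem IsProbVec.le_one {α : Type*} [Fintype α] {p : α → ℝ} (h : IsProbVec p) (a : α) :
    p a ≤ 1 := by
  rw [← h.2]
  exact Finset.single_le_sum (fun b _ => h.1 b) (Finset.mem_univ a)

end

section

namespace DiagIFS

/-- the linear part of `φ_{ω_0} ∘ ⋯ ∘ φ_{ω_{n-1}}` in coordinate `i` -/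
noncomputable def linPart (Φ : DiagIFS d A) (i : Fin d) (n : ℕ) (ω : ℕ → Φ.Symb) : ℝ :=
  ∏ k ∈ Finset.range n, Φ.slope i ((ω k).1 i)

/-- the constant part of `φ_{ω_0} ∘ ⋯ ∘ φ_{ω_{n-1}}` in coordinate `i` -/
noncomputable def constPart (Φ : DiagIFS d A) (i : Fin d) (n : ℕ) (ω : ℕ → Φ.Symb) : ℝ :=
  ∑ k ∈ Finset.range n, Φ.linPart i k ω * Φ.off i ((ω k).1 i)

/-- the sum of the exponents of the first `n` letters in coordinate `i` -/
noncomputable def lexpSum (Φ : DiagIFS d A) (i : Fin d) (n : ℕ) (ω : ℕ → Φ.Symb) : ℝ :=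
  ∑ k ∈ Finset.range n, Φ.lexp i (ω k)

variable {Φ : DiagIFS d A}

theorem abs_linPart (hV : Φ.Valid) (i : Fin d) (n : ℕ) (ω : ℕ → Φ.Symb) :
    |Φ.linPart i n ω| = Real.exp (-Φ.lexpSum i n ω) := by
  rw [linPart, lexpSum, Finset.abs_prod, ← Finset.sum_neg_distrib, Real.exp_sum]
  exact Finset.prod_congr rfl fun k _ => (exp_neg_lexp hV i (ω k)).symm

theorem linPart_ne_zero (hV : Φ.Valid) (i : Fin d) (n : ℕ) (ω : ℕ → Φ.Symb) :
    Φ.linPart i n ω ≠ 0 := by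
  rw [← abs_pos, abs_linPart hV]
  exact Real.exp_pos _

theorem base_mem_Ioo (hV : Φ.Valid) (i : Fin d) (a : A i) {x : ℝ} (hx : x ∈ Ioo (0 : ℝ) 1) :
    Φ.base i a x ∈ Ioo (0 : ℝ) 1 := by
  have h0 := hV.2.2.2 i a 0 (by simp)
  have h1 := hV.2.2.2 i a 1 (by simp)
  have hs := hV.2.1 i a
  simp only [base, mem_Icc, mem_Ioo] at *
  rcases lt_or_gt_of_ne hs with h | h
  · constructor <;> nlinarith
  · constructor <;> nlinarith

theorem cylinder_step (i : Fin d) (n : ℕ) (ω : ℕ → Φ.Symb) (x : ℝ) :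
    Φ.constPart i (n + 1) ω + Φ.linPart i (n + 1) ω * x =
      Φ.constPart i n ω + Φ.linPart i n ω * Φ.base i ((ω n).1 i) x := by
  simp only [constPart, linPart, Finset.sum_range_succ, Finset.prod_range_succ, base]
  ring

theorem cylinder_mem_Icc (hV : Φ.Valid) (i : Fin d) (n : ℕ) (ω : ℕ → Φ.Symb) {x : ℝ}
    (hx : x ∈ Icc (0 : ℝ) 1) :
    Φ.constPart i n ω + Φ.linPart i n ω * x ∈ Icc (0 : ℝ) 1 := by
  induction n generalizing x with
  | zero => simpa [constPart, linPart] using hx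
  | succ n ih =>
    rw [cylinder_step]
    exact ih (hV.2.2.2 i _ x hx)

theorem cylinder_factor (hV : Φ.Valid) (i : Fin d) {m n : ℕ} (hmn : m < n) (ω : ℕ → Φ.Symb)
    {x : ℝ} (hx : x ∈ Ioo (0 : ℝ) 1) :
    ∃ y ∈ Ioo (0 : ℝ) 1, Φ.constPart i n ω + Φ.linPart i n ω * x =
      Φ.constPart i m ω + Φ.linPart i m ω * Φ.base i ((ω m).1 i) y := by
  induction n, hmn using Nat.le_induction generalizing x with
  | base => exact ⟨x, hx, cylinder_step _ _ _ _⟩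
  | succ n hn ih =>
    rw [cylinder_step]
    exact ih (base_mem_Ioo hV i _ hx)

theorem lexpSum_ge {c C : ℝ} (h : ∀ i a, c ≤ Φ.lexp i a ∧ Φ.lexp i a ≤ C) (i : Fin d) (n : ℕ)
    (ω : ℕ → Φ.Symb) : c * n ≤ Φ.lexpSum i n ω := by
  calc c * n = ∑ _k ∈ Finset.range n, c := by simp [mul_comm]
    _ ≤ _ := Finset.sum_le_sum fun k _ => (h i (ω k)).1

theorem hasSum_coding (hV : Φ.Valid) (i : Fin d) (ω : ℕ → Φ.Symb) :
    HasSum (fun n => Φ.linPart i n ω * Φ.off i ((ω n).1 i)) (Φ.coding ω i) := by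
  obtain ⟨c, C, hc, -, h⟩ := exists_lexp_bounds hV
  have hs : Summable fun n => Φ.linPart i n ω * Φ.off i ((ω n).1 i) := by
    refine Summable.of_norm_bounded (g := fun n : ℕ => Real.exp (-c) ^ n)
      (summable_geometric_of_lt_one (Real.exp_pos _).le (by simpa using hc)) fun n => ?_
    have h1 := hV.2.2.2 i ((ω n).1 i) 0 (by simp)
    have h2 : |Φ.off i ((ω n).1 i)| ≤ 1 := by
      simp only [base, mul_zero, zero_add, mem_Icc] at h1
      rw [abs_le]
      constructor <;> linarith
    rw [norm_mul, Real.norm_eq_abs, Real.norm_eq_abs, abs_linPart hV, ← Real.exp_nat_mul]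
    refine (mul_le_of_le_one_right (Real.exp_pos _).le h2).trans (Real.exp_le_exp.mpr ?_)
    have := lexpSum_ge h i n ω
    linarith
  exact hs.hasSum

theorem coding_mem_Icc (hV : Φ.Valid) (i : Fin d) (ω : ℕ → Φ.Symb) :
    Φ.coding ω i ∈ Icc (0 : ℝ) 1 := by
  refine isClosed_Icc.mem_of_tendsto (hasSum_coding hV i ω).tendsto_sum_nat
    (Eventually.of_forall fun n => ?_)
  simpa [constPart] using cylinder_mem_Icc hV i n ω (x := 0) (by simp)

theorem coding_split (hV : Φ.Valid) (i : Fin d) (n : ℕ) (ω : ℕ → Φ.Symb) :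
    Φ.coding ω i = Φ.constPart i n ω + Φ.linPart i n ω * Φ.coding (fun k => ω (k + n)) i := by
  have h := hasSum_coding hV i ω
  have h1 := ((hasSum_nat_add_iff' n).mpr h)
  have h2 := (hasSum_coding hV i fun k => ω (k + n)).mul_left (Φ.linPart i n ω)
  have h3 : (fun k => Φ.linPart i (k + n) ω * Φ.off i ((ω (k + n)).1 i)) =
      fun k => Φ.linPart i n ω *
        (Φ.linPart i k (fun k => ω (k + n)) * Φ.off i ((ω (k + n)).1 i)) := by
    funext k
    rw [← mul_assoc]
    congr 1
    simp only [linPart]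
    rw [add_comm k n, Finset.prod_range_add]
    simp only [add_comm]
  rw [h3] at h1
  have := h1.unique h2
  rw [constPart]
  linarith

theorem linPart_congr {i : Fin d} {n : ℕ} {ω τ : ℕ → Φ.Symb}
    (h : ∀ k < n, (ω k).1 i = (τ k).1 i) : Φ.linPart i n ω = Φ.linPart i n τ :=
  Finset.prod_congr rfl fun k hk => by rw [h k (Finset.mem_range.mp hk)]

theorem constPart_congr {i : Fin d} {n : ℕ} {ω τ : ℕ → Φ.Symb}
    (h : ∀ k < n, (ω k).1 i = (τ k).1 i) : Φ.constPart i n ω = Φ.constPart i n τ :=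
  Finset.sum_congr rfl fun k hk => by
    have hk := Finset.mem_range.mp hk
    rw [h k hk, linPart_congr fun l hl => h l (hl.trans hk)]

theorem abs_coding_sub_le (hV : Φ.Valid) {i : Fin d} {n : ℕ} {ω τ : ℕ → Φ.Symb}
    (h : ∀ k < n, (ω k).1 i = (τ k).1 i) :
    |Φ.coding ω i - Φ.coding τ i| ≤ Real.exp (-Φ.lexpSum i n ω) := by
  rw [coding_split hV i n ω, coding_split hV i n τ, ← constPart_congr h, ← linPart_congr h,
    add_sub_add_left_eq_sub, ← mul_sub, abs_mul, abs_linPart hV]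
  refine mul_le_of_le_one_right (Real.exp_pos _).le ?_
  have h1 := coding_mem_Icc hV i fun k => ω (k + n)
  have h2 := coding_mem_Icc hV i fun k => τ (k + n)
  rw [mem_Icc] at h1 h2
  rw [abs_le]
  constructor <;> linarith

/-- the left endpoint of the image of `[0,1]` under `φ_{ω_0} ∘ ⋯ ∘ φ_{ω_{n-1}}` -/
noncomputable def leftEnd (Φ : DiagIFS d A) (i : Fin d) (n : ℕ) (ω : ℕ → Φ.Symb) : ℝ :=
  Φ.constPart i n ω + min (Φ.linPart i n ω) 0

theorem coding_mem_interval (hV : Φ.Valid) (i : Fin d) (n : ℕ) (ω : ℕ → Φ.Symb) :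
    Φ.coding ω i ∈ Icc (Φ.leftEnd i n ω) (Φ.leftEnd i n ω + |Φ.linPart i n ω|) := by
  rw [coding_split hV i n ω, leftEnd, mem_Icc]
  have h1 := coding_mem_Icc hV i fun k => ω (k + n)
  rw [mem_Icc] at h1
  rcases le_total (Φ.linPart i n ω) 0 with h | h
  · rw [min_eq_left h, abs_of_nonpos h]
    constructor <;> nlinarith
  · rw [min_eq_right h, abs_of_nonneg h]
    constructor <;> nlinarith

theorem exists_of_mem_interval (hV : Φ.Valid) (i : Fin d) (n : ℕ) (ω : ℕ → Φ.Symb) {z : ℝ}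
    (hz : z ∈ Ioo (Φ.leftEnd i n ω) (Φ.leftEnd i n ω + |Φ.linPart i n ω|)) :
    ∃ x ∈ Ioo (0 : ℝ) 1, z = Φ.constPart i n ω + Φ.linPart i n ω * x := by
  have h0 := linPart_ne_zero hV i n ω
  refine ⟨(z - Φ.constPart i n ω) / Φ.linPart i n ω, ?_, by field_simp; ring⟩
  rw [leftEnd, mem_Ioo] at hz
  rcases lt_or_gt_of_ne h0 with h | h
  · rw [min_eq_left h.le, abs_of_neg h] at hz
    rw [mem_Ioo, lt_div_iff_of_neg h, div_lt_iff_of_neg h]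
    constructor <;> linarith
  · rw [min_eq_right h.le, abs_of_pos h] at hz
    rw [mem_Ioo, lt_div_iff₀ h, div_lt_iff₀ h]
    constructor <;> linarith

theorem separation (hV : Φ.Valid) {i : Fin d} {m n n' : ℕ} (hn : m < n) (hn' : m < n')
    {ω τ : ℕ → Φ.Symb} (h : ∀ k < m, (ω k).1 i = (τ k).1 i)
    (hd : Disjoint (Φ.base i ((ω m).1 i) '' Ioo (0 : ℝ) 1) (Φ.base i ((τ m).1 i) '' Ioo (0 : ℝ) 1))
    {a a' ρ : ℝ} (ha : Φ.leftEnd i n ω ≤ a)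
    (ha2 : a + ρ ≤ Φ.leftEnd i n ω + |Φ.linPart i n ω|) (ha' : Φ.leftEnd i n' τ ≤ a')
    (ha2' : a' + ρ ≤ Φ.leftEnd i n' τ + |Φ.linPart i n' τ|) : ρ ≤ |a - a'| := by
  by_contra! hlt
  rw [abs_lt] at hlt
  obtain ⟨z, hz1, hz2⟩ : ∃ z, max a a' < z ∧ z < min a a' + ρ := by
    refine exists_between ?_
    rcases le_total a a' with h | h
    · rw [max_eq_right h, min_eq_left h]; linarith
    · rw [max_eq_left h, min_eq_right h]; linarith
  have e1 := le_max_left a a'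
  have e2 := le_max_right a a'
  have e3 := min_le_left a a'
  have e4 := min_le_right a a'
  obtain ⟨x, hx, hzx⟩ := exists_of_mem_interval hV i n ω (z := z) ⟨by linarith, by linarith⟩
  obtain ⟨x', hx', hzx'⟩ := exists_of_mem_interval hV i n' τ (z := z) ⟨by linarith, by linarith⟩
  obtain ⟨y, hy, hy2⟩ := cylinder_factor hV i hn ω hx
  obtain ⟨y', hy', hy2'⟩ := cylinder_factor hV i hn' τ hx'
  rw [← hzx, constPart_congr h, linPart_congr h] at hy2
  rw [← hzx'] at hy2'
  have hmul : Φ.linPart i m τ * Φ.base i ((ω m).1 i) y =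
      Φ.linPart i m τ * Φ.base i ((τ m).1 i) y' := by linarith
  have := mul_left_cancel₀ (linPart_ne_zero hV i m τ) hmul
  exact (Set.disjoint_left.mp hd) ⟨y, hy, rfl⟩ ⟨y', hy', this.symm⟩

theorem measurable_coding (hV : Φ.Valid) : Measurable Φ.coding := by
  refine measurable_pi_iff.mpr fun i => ?_
  refine measurable_of_tendsto_metrizable (f := fun n ω => Φ.constPart i n ω) (fun n => ?_)
    (tendsto_pi_nhds.mpr fun ω => (hasSum_coding hV i ω).tendsto_sum_nat)
  have hm : ∀ (k : ℕ) (g : Φ.Symb → ℝ), Measurable fun ω : ℕ → Φ.Symb => g (ω k) :=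
    fun k g => measurable_from_top.comp (measurable_pi_apply k)
  refine Finset.measurable_sum _ fun k _ => (Finset.measurable_prod _ fun l _ => ?_).mul ?_
  · exact hm l fun a => Φ.slope i (a.1 i)
  · exact hm k fun a => Φ.off i (a.1 i)

end DiagIFS

end

section

/-- a continuous path of probability vectors on `(0,∞)` -/
structure IsPath (Φ : DiagIFS d A) (r : ℝ → Φ.Symb → ℝ) : Prop where
  prob : ∀ b > 0, IsProbVec (r b)
  cont : ContinuousOn r (Ioi 0)

variable {Φ : DiagIFS d A} {r : ℝ → Φ.Symb → ℝ}

theorem Cycle.isPath (c : Cycle Φ) : IsPath Φ c.r := ⟨c.prob, c.cont⟩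

theorem IsPath.scale (hr : IsPath Φ r) {κ : ℝ} (hκ : 0 < κ) : IsPath Φ fun u => r (κ * u) :=
  ⟨fun b hb => hr.prob _ (mul_pos hκ hb),
    hr.cont.comp (by fun_prop) fun b hb => mul_pos hκ hb⟩

/-- the integral `∫_0^x χ_i(r_b) db` -/
noncomputable def chiInt (Φ : DiagIFS d A) (r : ℝ → Φ.Symb → ℝ) (i : Fin d) (x : ℝ) : ℝ :=
  ∫ b in Set.Ioc (0 : ℝ) x, Φ.chi i (r b)

section Bounds

variable {c C : ℝ} (hc : 0 < c) (h : ∀ i a, c ≤ Φ.lexp i a ∧ Φ.lexp i a ≤ C) (hr : IsPath Φ r)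

include hc h hr

theorem integrableOn_chi (i : Fin d) {x y : ℝ} (hx : 0 ≤ x) :
    IntegrableOn (fun b => Φ.chi i (r b)) (Ioc x y) := by
  have hs : Ioc x y ⊆ Ioi 0 := fun b hb => hx.trans_lt hb.1
  refine Integrable.of_bound (C := C) ?_ ?_
  · exact (((Φ.continuous_chi i).comp_continuousOn hr.cont).mono hs).aestronglyMeasurable
      measurableSet_Ioc
  · filter_upwards [ae_restrict_mem measurableSet_Ioc] with b hb
    have := DiagIFS.chi_bounds h (hr.prob b (hs hb)) i
    rw [Real.norm_eq_abs, abs_le]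
    constructor <;> linarith

theorem chiInt_sub (i : Fin d) {x y : ℝ} (hx : 0 ≤ x) (hxy : x ≤ y) :
    chiInt Φ r i y - chiInt Φ r i x = ∫ b in Ioc x y, Φ.chi i (r b) := by
  rw [chiInt, chiInt, ← Ioc_union_Ioc_eq_Ioc hx hxy,
    setIntegral_union (Ioc_disjoint_Ioc_of_le le_rfl) measurableSet_Ioc
      (integrableOn_chi hc h hr i le_rfl) (integrableOn_chi hc h hr i hx)]
  ring

theorem chiInt_sub_bounds (i : Fin d) {x y : ℝ} (hx : 0 ≤ x) (hxy : x ≤ y) :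
    c * (y - x) ≤ chiInt Φ r i y - chiInt Φ r i x ∧
      chiInt Φ r i y - chiInt Φ r i x ≤ C * (y - x) := by
  rw [chiInt_sub hc h hr i hx hxy]
  have h1 : ∀ K : ℝ, ∫ _b in Ioc x y, K = K * (y - x) := fun K => by
    rw [setIntegral_const, smul_eq_mul, mul_comm]; simp [hxy]
  rw [← h1, ← h1]
  constructor
  · exact setIntegral_mono_on (integrableOn_const (by simp)) (integrableOn_chi hc h hr i hx)
      measurableSet_Ioc fun b hb => (DiagIFS.chi_bounds h (hr.prob b (hx.trans_lt hb.1)) i).1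
  · exact setIntegral_mono_on (integrableOn_chi hc h hr i hx) (integrableOn_const (by simp))
      measurableSet_Ioc fun b hb => (DiagIFS.chi_bounds h (hr.prob b (hx.trans_lt hb.1)) i).2

theorem chiInt_strictMono (i : Fin d) {x y : ℝ} (hx : 0 ≤ x) (hxy : x < y) :
    chiInt Φ r i x < chiInt Φ r i y := by
  have := (chiInt_sub_bounds hc h hr i hx hxy.le).1
  have := mul_pos hc (sub_pos.mpr hxy)
  linarith

omit hc h hr in
theorem chiInt_zero (i : Fin d) : chiInt Φ r i 0 = 0 := by simp [chiInt]

theorem bcoord_eq_of_chiInt_eq (i : Fin d) {x B : ℝ} (hx : 0 ≤ x) (hB : chiInt Φ r i x = B) :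
    Bcoord Φ r B i = x := by
  have : {y : ℝ | 0 ≤ y ∧ B ≤ ∫ b in Set.Ioc (0:ℝ) y, Φ.chi i (r b)} = Ici x := by
    ext y
    simp only [mem_ofPred_eq, mem_Ici]
    constructor
    · rintro ⟨hy, hy2⟩
      by_contra! hlt
      have := chiInt_strictMono hc h hr i hy hlt
      rw [hB] at this
      exact absurd hy2 (not_le.mpr this)
    · intro hy
      refine ⟨hx.trans hy, ?_⟩
      have := (chiInt_sub_bounds hc h hr i hx hy).1
      have h2 := mul_nonneg hc.le (sub_nonneg.mpr hy)
      change B ≤ chiInt Φ r i y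
      linarith
  rw [Bcoord, this, csInf_Ici]

theorem bcoord_spec (i : Fin d) {B : ℝ} (hB : 0 ≤ B) :
    0 ≤ Bcoord Φ r B i ∧ chiInt Φ r i (Bcoord Φ r B i) = B := by
  have hcont : ContinuousOn (chiInt Φ r i) (Icc 0 (B / c)) := by
    have hl : LipschitzOnWith (Real.toNNReal C) (chiInt Φ r i) (Icc 0 (B / c)) := by
      refine LipschitzOnWith.of_le_add_mul _ fun x hx y hy => ?_
      have hCC : C ≤ (Real.toNNReal C : ℝ) := Real.le_coe_toNNReal C
      rcases le_total x y with hxy | hxy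
      · have := (chiInt_sub_bounds hc h hr i hx.1 hxy).1
        have h2 := mul_nonneg hc.le (sub_nonneg.mpr hxy)
        have h3 : 0 ≤ (Real.toNNReal C : ℝ) * dist x y := by positivity
        linarith
      · have := (chiInt_sub_bounds hc h hr i hy.1 hxy).2
        rw [Real.dist_eq, abs_of_nonneg (sub_nonneg.mpr hxy)]
        have := mul_le_mul_of_nonneg_right hCC (sub_nonneg.mpr hxy)
        linarith
    exact hl.continuousOn
  have h0 : 0 ≤ B / c := div_nonneg hB hc.le
  have h1 : B ≤ chiInt Φ r i (B / c) := by
    have := (chiInt_sub_bounds hc h hr i le_rfl h0).1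
    rw [chiInt_zero, sub_zero, sub_zero] at this
    have h2 : c * (B / c) = B := by field_simp
    linarith
  obtain ⟨x, hx, hxB⟩ := intermediate_value_Icc h0 hcont ⟨by rw [chiInt_zero]; exact hB, h1⟩
  rw [bcoord_eq_of_chiInt_eq hc h hr i hx.1 hxB]
  exact ⟨hx.1, hxB⟩

theorem le_bcoord_iff (i : Fin d) {B b : ℝ} (hB : 0 ≤ B) (hb : 0 ≤ b) :
    b ≤ Bcoord Φ r B i ↔ chiInt Φ r i b ≤ B := by
  obtain ⟨h1, h2⟩ := bcoord_spec hc h hr i hB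
  constructor
  · intro hle
    rcases hle.eq_or_lt with rfl | hlt
    · exact h2.le
    · exact ((chiInt_strictMono hc h hr i hb hlt).trans_eq h2).le
  · intro hle
    by_contra! hlt
    have := chiInt_strictMono hc h hr i h1 hlt
    linarith

theorem lt_bcoord_iff (i : Fin d) {B b : ℝ} (hB : 0 ≤ B) (hb : 0 ≤ b) :
    b < Bcoord Φ r B i ↔ chiInt Φ r i b < B := by
  obtain ⟨h1, h2⟩ := bcoord_spec hc h hr i hB
  constructor
  · intro hlt
    exact (chiInt_strictMono hc h hr i hb hlt).trans_eq h2
  · intro hlt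
    by_contra! hle
    rcases hle.eq_or_lt with h3 | h3
    · rw [← h3] at hlt; linarith
    · have := chiInt_strictMono hc h hr i h1 h3
      linarith

theorem bcoord_le (i : Fin d) {B : ℝ} (hB : 0 ≤ B) : Bcoord Φ r B i ≤ B / c := by
  obtain ⟨h1, h2⟩ := bcoord_spec hc h hr i hB
  have := (chiInt_sub_bounds hc h hr i le_rfl h1).1
  rw [chiInt_zero, h2] at this
  rw [le_div_iff₀ hc]
  linarith

theorem bcoord_mono (i : Fin d) {B B' : ℝ} (hB : 0 ≤ B) (hBB : B ≤ B') :
    Bcoord Φ r B i ≤ Bcoord Φ r B' i := by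
  obtain ⟨h1, h2⟩ := bcoord_spec hc h hr i hB
  rw [le_bcoord_iff hc h hr i (hB.trans hBB) h1, h2]
  exact hBB

theorem bcoord_scale (i : Fin d) {B κ : ℝ} (hB : 0 ≤ B) (hκ : 0 < κ) :
    Bcoord Φ (fun u => r (κ * u)) B i = κ⁻¹ * Bcoord Φ r (κ * B) i := by
  obtain ⟨h1, h2⟩ := bcoord_spec hc h hr i (mul_nonneg hκ.le hB)
  refine bcoord_eq_of_chiInt_eq hc h (hr.scale hκ) i (by positivity) ?_
  have h3 : (0 : ℝ) ≤ κ⁻¹ * Bcoord Φ r (κ * B) i := by positivity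
  rw [chiInt, ← intervalIntegral.integral_of_le h3,
    intervalIntegral.integral_comp_mul_left (fun b => Φ.chi i (r b)) hκ.ne', mul_zero,
    mul_inv_cancel_left₀ hκ.ne', intervalIntegral.integral_of_le h1]
  change κ⁻¹ • chiInt Φ r i _ = B
  rw [h2, smul_eq_mul, inv_mul_cancel_left₀ hκ.ne']

theorem deltaRB_scale {B κ : ℝ} (hB : 0 ≤ B) (hκ : 0 < κ) :
    deltaRB Φ (fun u => r (κ * u)) B = deltaRB Φ r (κ * B) := by
  have h1 : ∀ b : ℝ, ∀ i, b ≤ Bcoord Φ (fun u => r (κ * u)) B i ↔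
      κ * b ≤ Bcoord Φ r (κ * B) i := fun b i => by
    rw [bcoord_scale hc h hr i hB hκ, inv_mul_eq_div, le_div_iff₀ hκ, mul_comm]
  simp only [deltaRB, h1]
  rw [integral_comp_mul_left_Ioi (fun b => Φ.entropy
    (Finset.univ.filter fun i => b ≤ Bcoord Φ r (κ * B) i) (r b)) 0 hκ, mul_zero, smul_eq_mul,
    ← mul_assoc, mul_inv_rev]

end Bounds

theorem deltaRB_congr {r' : ℝ → Φ.Symb → ℝ} (h : ∀ b > 0, r b = r' b) (B : ℝ) :
    deltaRB Φ r B = deltaRB Φ r' B := by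
  have h1 : ∀ i, Bcoord Φ r B i = Bcoord Φ r' B i := fun i => by
    simp only [Bcoord]
    congr 1
    ext x
    simp only [mem_ofPred_eq, and_congr_right_iff]
    intro _
    rw [setIntegral_congr_fun measurableSet_Ioc fun b hb => by
      show Φ.chi i (r b) = Φ.chi i (r' b)
      rw [h b hb.1]]
  simp only [deltaRB, h1]
  congr 1
  exact setIntegral_congr_fun measurableSet_Ioi fun b hb => by simp only [h b hb]

theorem filter_le_eq_empty {β : Fin d → ℝ} {M : ℝ} (hβ : ∀ i, β i ≤ M) {b : ℝ} (hb : M < b) :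
    (Finset.univ.filter fun i => b ≤ β i) = ∅ := by
  simp only [Finset.filter_eq_empty_iff, Finset.mem_univ, not_le, forall_const]
  exact fun i => (hβ i).trans_lt hb

theorem integrableOn_entropy (hr : IsPath Φ r) (β : Fin d → ℝ) :
    IntegrableOn (fun b => Φ.entropy (Finset.univ.filter fun i => b ≤ β i) (r b)) (Ioi 0) := by
  obtain ⟨M, hM⟩ : ∃ M, ∀ i, β i ≤ M := by
    obtain ⟨M, hM⟩ := (finite_range β).bddAbove
    exact ⟨M, fun i => hM (mem_range_self i)⟩
  have hmeas : AEStronglyMeasurable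
      (fun b => Φ.entropy (Finset.univ.filter fun i => b ≤ β i) (r b))
      (volume.restrict (Ioi 0)) := by
    have heq : (fun b => Φ.entropy (Finset.univ.filter fun i => b ≤ β i) (r b)) =
        fun b => ∑ I : Finset (Fin d), {b : ℝ | (Finset.univ.filter fun i => b ≤ β i) = I}.indicator
          (fun b => Φ.entropy I (r b)) b := by
      funext b
      simp [indicator_apply]
    rw [heq]
    refine Finset.aestronglyMeasurable_fun_sum _ fun I _ => ?_
    refine AEStronglyMeasurable.indicator ?_ ?_
    · exact ((Φ.continuous_entropy I).comp_continuousOn hr.cont).aestronglyMeasurable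
        measurableSet_Ioi
    · have : {b : ℝ | (Finset.univ.filter fun i => b ≤ β i) = I} =
          ⋂ i, {b | b ≤ β i ↔ i ∈ I} := by
        ext b
        simp [Finset.ext_iff]
      rw [this]
      refine MeasurableSet.iInter fun i => ?_
      by_cases hi : i ∈ I
      · simp only [hi, iff_true]
        exact measurableSet_Iic
      · simp only [hi, iff_false, not_le]
        exact measurableSet_Ioi
  refine IntegrableOn.of_forall_sdiff_eq_zero (s := Ioc 0 M) ?_ measurableSet_Ioi ?_
  · refine Integrable.of_bound (hmeas.mono_set Ioc_subset_Ioi_self) (C := Fintype.card Φ.Symb) ?_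
    filter_upwards [ae_restrict_mem measurableSet_Ioc] with b hb
    rw [Real.norm_eq_abs, abs_of_nonneg (Φ.entropy_nonneg _ (hr.prob b hb.1))]
    exact Φ.entropy_le_card _ (hr.prob b hb.1)
  · intro b hb
    have hb0 : 0 < b := hb.1
    have hbM : M < b := by
      by_contra! hle
      exact hb.2 ⟨hb0, hle⟩
    rw [filter_le_eq_empty hM hbM, Φ.entropy_empty (hr.prob b hb0)]

theorem deltaRB_nonneg (hr : IsPath Φ r) {B : ℝ} (hB : 0 ≤ B) : 0 ≤ deltaRB Φ r B :=
  mul_nonneg (inv_nonneg.mpr hB) (setIntegral_nonneg measurableSet_Ioi fun b hb =>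
    Φ.entropy_nonneg _ (hr.prob b hb))

theorem mul_deltaRB {B : ℝ} (hB : 0 < B) : B * deltaRB Φ r B =
    ∫ b in Set.Ioi (0:ℝ), Φ.entropy (Finset.univ.filter fun i => b ≤ Bcoord Φ r B i) (r b) := by
  rw [deltaRB, mul_inv_cancel_left₀ hB.ne']

theorem mul_deltaRB_mono {c C : ℝ} (hc : 0 < c)
    (h : ∀ i a, c ≤ Φ.lexp i a ∧ Φ.lexp i a ≤ C) (hr : IsPath Φ r) {B B' : ℝ} (hB : 0 < B)
    (hBB : B ≤ B') : B * deltaRB Φ r B ≤ B' * deltaRB Φ r B' := by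
  rw [mul_deltaRB hB, mul_deltaRB (hB.trans_le hBB)]
  refine setIntegral_mono_on (integrableOn_entropy hr _) (integrableOn_entropy hr _)
    measurableSet_Ioi fun b hb => Φ.entropy_mono ?_ (hr.prob b hb)
  intro i hi
  simp only [Finset.mem_filter, Finset.mem_univ, true_and] at hi ⊢
  exact hi.trans (bcoord_mono hc h hr i hB.le hBB)

theorem Cycle.lam_pow_mul (c : Cycle Φ) (m : ℕ) {b : ℝ} (hb : 0 < b) :
    c.r (c.lam ^ m * b) = c.r b := by
  induction m with
  | zero => simp
  | succ m ih =>
    have h1 : 0 < c.lam ^ m * b := mul_pos (pow_pos (zero_lt_one.trans_le c.one_le_lam) m) hb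
    rw [pow_succ', mul_assoc, c.periodic _ h1, ih]

theorem Cycle.delta_le (hV : Φ.Valid) (c : Cycle Φ) {B : ℝ} (hB : 1 ≤ B) :
    c.delta ≤ deltaRB Φ c.r B := by
  obtain ⟨k, K, hk, -, h⟩ := DiagIFS.exists_lexp_bounds hV
  have hbdd : BddBelow (deltaRB Φ c.r '' Icc 1 c.lam) := by
    refine ⟨0, ?_⟩
    rintro _ ⟨B, hB, rfl⟩
    exact deltaRB_nonneg c.isPath (zero_le_one.trans hB.1)
  have hmem : ∀ B ∈ Icc 1 c.lam, c.delta ≤ deltaRB Φ c.r B := fun B hB =>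
    csInf_le hbdd ⟨B, hB, rfl⟩
  have hB0 : 0 < B := zero_lt_one.trans_le hB
  rcases c.one_le_lam.eq_or_lt with h1 | h1
  · have h2 := deltaRB_scale hk h c.isPath zero_le_one hB0
    rw [mul_one] at h2
    rw [← h2, ← deltaRB_congr (r := c.r) fun b hb =>
      c.const_of_lam_eq_one h1.symm b hb _ (mul_pos hB0 hb)]
    exact hmem 1 ⟨le_rfl, h1.le⟩
  · obtain ⟨m, hm1, hm2⟩ := exists_nat_pow_near hB h1
    have hp : 0 < c.lam ^ m := pow_pos (zero_lt_one.trans h1) m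
    have h3 := deltaRB_scale hk h c.isPath (B := B / c.lam ^ m) (by positivity) hp
    rw [mul_div_cancel₀ _ hp.ne'] at h3
    rw [← h3, deltaRB_congr (r' := c.r) fun b hb => c.lam_pow_mul m hb]
    refine hmem _ ⟨(one_le_div hp).mpr hm1, ?_⟩
    rw [div_le_iff₀ hp, ← pow_succ']
    exact hm2.le

end

section

open ProbabilityTheory

instance (Φ : DiagIFS d A) : DiscreteMeasurableSpace Φ.Symb := ⟨fun _ => trivial⟩

section VecMeasure

variable {α : Type*} [Fintype α] [MeasurableSpace α] [DiscreteMeasurableSpace α]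

/-- the measure with density `p` on a finite set -/
noncomputable def vecMeasure (p : α → ℝ) : Measure α :=
  Measure.sum fun a => ENNReal.ofReal (p a) • Measure.dirac a

theorem vecMeasure_apply (p : α → ℝ) (s : Set α) :
    vecMeasure p s = ∑ a, if a ∈ s then ENNReal.ofReal (p a) else 0 := by
  rw [vecMeasure, Measure.sum_apply _ (MeasurableSet.of_discrete), tsum_fintype]
  refine Finset.sum_congr rfl fun a _ => ?_
  simp [indicator_apply]

theorem isProbabilityMeasure_vecMeasure {p : α → ℝ} (hp : IsProbVec p) :
    IsProbabilityMeasure (vecMeasure p) := by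
  refine ⟨?_⟩
  rw [vecMeasure_apply]
  simp only [mem_univ, if_true]
  rw [← ENNReal.ofReal_sum_of_nonneg fun a _ => hp.1 a, hp.2, ENNReal.ofReal_one]

theorem vecMeasure_real_singleton {p : α → ℝ} (hp : IsProbVec p) (a : α) :
    (vecMeasure p).real {a} = p a := by
  rw [Measure.real, vecMeasure_apply]
  simp [ENNReal.toReal_ofReal (hp.1 a)]

theorem integral_vecMeasure {p : α → ℝ} (hp : IsProbVec p) (f : α → ℝ) :
    ∫ a, f a ∂(vecMeasure p) = ∑ a, p a * f a := by
  have := isProbabilityMeasure_vecMeasure hp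
  rw [integral_fintype .of_finite]
  simp [vecMeasure_real_singleton hp]

theorem exp_neg_le_quadratic {y : ℝ} (hy : 0 ≤ y) : Real.exp (-y) ≤ 1 - y + y ^ 2 / 2 := by
  have h1 := Real.quadratic_le_exp_of_nonneg hy
  have h2 : 0 < 1 - y + y ^ 2 / 2 := by nlinarith [sq_nonneg (y - 1)]
  rw [Real.exp_neg, inv_le_comm₀ (Real.exp_pos _) h2]
  refine le_trans ?_ h1
  rw [inv_le_iff_one_le_mul₀ h2]
  nlinarith [sq_nonneg (y ^ 2)]

omit [MeasurableSpace α] [DiscreteMeasurableSpace α] in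
theorem sum_exp_neg_le {p f : α → ℝ} (hp : IsProbVec p) (hf : ∀ a, 0 ≤ f a) {M t : ℝ}
    (hM : ∑ a, p a * f a ^ 2 ≤ M) (ht : 0 ≤ t) :
    ∑ a, p a * Real.exp (-t * f a) ≤ Real.exp (-t * ∑ a, p a * f a + t ^ 2 * M / 2) := by
  calc ∑ a, p a * Real.exp (-t * f a)
      ≤ ∑ a, (p a - t * (p a * f a) + t ^ 2 / 2 * (p a * f a ^ 2)) := by
        refine Finset.sum_le_sum fun a _ => ?_
        have := mul_le_mul_of_nonneg_left (exp_neg_le_quadratic (mul_nonneg ht (hf a))) (hp.1 a)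
        rw [neg_mul]
        refine this.trans (le_of_eq (by ring))
    _ = 1 - t * ∑ a, p a * f a + t ^ 2 / 2 * ∑ a, p a * f a ^ 2 := by
        rw [Finset.sum_add_distrib, Finset.sum_sub_distrib, hp.2, Finset.mul_sum, Finset.mul_sum]
    _ ≤ 1 - t * ∑ a, p a * f a + t ^ 2 / 2 * M := by gcongr
    _ = (-t * ∑ a, p a * f a + t ^ 2 * M / 2) + 1 := by ring
    _ ≤ _ := Real.add_one_le_exp _

variable {p : ℕ → α → ℝ} (hp : ∀ k, IsProbVec (p k))

/-- the product of the measures with densities `p k` -/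
noncomputable def prodMeasure (p : ℕ → α → ℝ) : Measure (ℕ → α) :=
  Measure.infinitePi fun k => vecMeasure (p k)

include hp

theorem isProbabilityMeasure_prodMeasure : IsProbabilityMeasure (prodMeasure p) := by
  have := fun k => isProbabilityMeasure_vecMeasure (hp k)
  rw [prodMeasure]
  infer_instance

theorem prodMeasure_pi (n : ℕ) (s : ℕ → Set α) :
    prodMeasure p {ω | ∀ k < n, ω k ∈ s k} = ∏ k ∈ Finset.range n, vecMeasure (p k) (s k) := by
  have := fun k => isProbabilityMeasure_vecMeasure (hp k)
  rw [prodMeasure, ← Measure.infinitePi_pi _ fun i _ => MeasurableSet.of_discrete]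
  congr 1
  ext ω
  simp [Set.mem_pi]

theorem prodMeasure_chernoff {f : ℕ → α → ℝ} (hf : ∀ k a, 0 ≤ f k a) {M t : ℝ}
    (hM : ∀ k, ∑ a, p k a * f k a ^ 2 ≤ M) (ht : 0 ≤ t) (n : ℕ) (x : ℝ) :
    (prodMeasure p).real {ω | ∑ k ∈ Finset.range n, f k (ω k) ≤
        ∑ k ∈ Finset.range n, ∑ a, p k a * f k a - x} ≤
      Real.exp (-t * x + t ^ 2 * M * n / 2) := by
  have hpv := fun k => isProbabilityMeasure_vecMeasure (hp k)
  have := isProbabilityMeasure_prodMeasure hp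
  have hm : ∀ k, Measurable fun ω : ℕ → α => f k (ω k) := fun k =>
    Measurable.of_discrete.comp (measurable_pi_apply k)
  have hind : iIndepFun (fun k (ω : ℕ → α) => f k (ω k)) (prodMeasure p) :=
    iIndepFun_infinitePi (P := fun k => vecMeasure (p k)) fun k => Measurable.of_discrete
  have hmgf : ∀ k, mgf (fun ω : ℕ → α => f k (ω k)) (prodMeasure p) (-t) ≤
      Real.exp (-t * ∑ a, p k a * f k a + t ^ 2 * M / 2) := by
    intro k
    refine le_trans (le_of_eq ?_) (sum_exp_neg_le (hp k) (hf k) (hM k) ht)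
    rw [mgf, ← integral_vecMeasure (hp k)]
    exact (measurePreserving_eval_infinitePi (fun k => vecMeasure (p k)) k).hasLaw.integral_comp
      (f := fun a => Real.exp (-t * f k a)) Measurable.of_discrete.aestronglyMeasurable
  set X : (ℕ → α) → ℝ := ∑ k ∈ Finset.range n, fun ω => f k (ω k) with hX
  have hXe : ∀ ω, X ω = ∑ k ∈ Finset.range n, f k (ω k) := fun ω => by
    rw [hX, Finset.sum_apply]
  have hXm : Measurable X := by
    rw [show X = fun ω => ∑ k ∈ Finset.range n, f k (ω k) from funext hXe]
    exact Finset.measurable_sum _ fun k _ => hm k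
  simp only [← hXe]
  have hint : Integrable (fun ω => Real.exp (-t * X ω)) (prodMeasure p) := by
    refine Integrable.of_bound (C := 1) (by fun_prop) (Eventually.of_forall fun ω => ?_)
    rw [Real.norm_eq_abs, abs_of_pos (Real.exp_pos _), Real.exp_le_one_iff, neg_mul,
      neg_nonpos, hXe]
    exact mul_nonneg ht (Finset.sum_nonneg fun k _ => hf k _)
  refine (measure_le_le_exp_mul_mgf _ (neg_nonpos.mpr ht) hint).trans ?_
  rw [hind.mgf_sum hm]
  calc _ ≤ Real.exp (- -t * (∑ k ∈ Finset.range n, ∑ a, p k a * f k a - x)) *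
        ∏ k ∈ Finset.range n, Real.exp (-t * ∑ a, p k a * f k a + t ^ 2 * M / 2) := by
        gcongr with k _
        · exact fun k _ => mgf_nonneg
        · exact hmgf k
    _ = _ := by
        rw [← Real.exp_sum, ← Real.exp_add, Finset.sum_add_distrib, ← Finset.mul_sum,
          Finset.sum_const, Finset.card_range, nsmul_eq_mul]
        congr 1
        ring

end VecMeasure

end

section

theorem mul_log_sq_le {x : ℝ} (h0 : 0 < x) (h1 : x ≤ 1) : x * Real.log x ^ 2 ≤ 4 := by
  have h2 := Real.abs_log_mul_self_lt (√x) (Real.sqrt_pos.mpr h0) (Real.sqrt_le_one.mpr h1)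
  rw [Real.log_sqrt h0.le, abs_lt] at h2
  have h3 : (Real.log x / 2 * √x) ^ 2 ≤ 1 := by nlinarith
  have h4 := Real.sq_sqrt h0.le
  have h5 : (Real.log x / 2 * √x) ^ 2 = x * Real.log x ^ 2 / 4 := by
    rw [mul_pow, h4]; ring
  linarith

namespace DiagIFS

variable {Φ : DiagIFS d A}

theorem cylMass_nonneg (I : Finset (Fin d)) {p : Φ.Symb → ℝ} (hp : IsProbVec p) (a : Φ.Symb) :
    0 ≤ Φ.cylMass I p a := (hp.1 a).trans (Φ.le_cylMass I hp.1 a)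

theorem sum_log_sq_cylMass_le (I : Finset (Fin d)) {p : Φ.Symb → ℝ} (hp : IsProbVec p) :
    ∑ a, p a * (-Real.log (Φ.cylMass I p a)) ^ 2 ≤ 4 * Fintype.card Φ.Symb := by
  calc _ ≤ ∑ _a : Φ.Symb, (4 : ℝ) := by
        refine Finset.sum_le_sum fun a _ => ?_
        rw [neg_sq]
        rcases (hp.1 a).eq_or_lt with h0 | h0
        · rw [← h0, zero_mul]; norm_num
        · have h1 := Φ.le_cylMass I hp.1 a
          exact (mul_le_mul_of_nonneg_right h1 (sq_nonneg _)).trans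
            (mul_log_sq_le (h0.trans_le h1) (Φ.cylMass_le_one I hp a))
    _ = _ := by rw [Finset.sum_const, nsmul_eq_mul, Finset.card_univ, mul_comm]

/-- points whose cylinders agree and are all wide share labels only within a cylinder class -/
theorem same_class_of_close (hV : Φ.Valid) {N : Fin d → ℕ}
    (hgood : ∀ k, Φ.GoodIdx (Finset.univ.filter fun i => k < N i)) {ρ : ℝ} {ω τ : ℕ → Φ.Symb}
    {a a' : Fin d → ℝ} (ha : ∀ i, Φ.leftEnd i (N i) ω ≤ a i)
    (ha2 : ∀ i, a i + ρ ≤ Φ.leftEnd i (N i) ω + |Φ.linPart i (N i) ω|)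
    (ha' : ∀ i, Φ.leftEnd i (N i) τ ≤ a' i)
    (ha2' : ∀ i, a' i + ρ ≤ Φ.leftEnd i (N i) τ + |Φ.linPart i (N i) τ|)
    (haa : ∀ i, |a i - a' i| < ρ) : ∀ k i, k < N i → (ω k).1 i = (τ k).1 i := by
  intro k
  induction k using Nat.strong_induction_on with
  | _ k ih =>
    by_contra! hcon
    obtain ⟨j, hj, hne⟩ := hcon
    obtain ⟨i, hi, hd⟩ := hgood k _ (ω k).2 _ (τ k).2 ⟨j, by simpa using hj, hne⟩
    have hi : k < N i := by simpa using hi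
    exact (separation hV hi hi (fun l hl => ih l hl i (hl.trans hi)) hd (ha i) (ha2 i) (ha' i)
      (ha2' i)).not_gt (haa i)

theorem prodMeasure_class_le {p : ℕ → Φ.Symb → ℝ} (hp : ∀ k, IsProbVec (p k)) (N : Fin d → ℕ)
    {M : ℕ} (ω : ℕ → Φ.Symb) :
    prodMeasure p {τ | ∀ k i, k < N i → (τ k).1 i = (ω k).1 i} ≤
      ENNReal.ofReal (Real.exp (-∑ k ∈ Finset.range M,
        -Real.log (Φ.cylMass (Finset.univ.filter fun i => k < N i) (p k) (ω k)))) := by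
  calc _ ≤ prodMeasure p {τ | ∀ k < M, τ k ∈ {b : Φ.Symb | ∀ i, k < N i → b.1 i = (ω k).1 i}} :=
        measure_mono (show {τ : ℕ → Φ.Symb | ∀ k i, k < N i → (τ k).1 i = (ω k).1 i} ⊆ _ from
          fun τ hτ k _ => hτ k)
    _ = ∏ k ∈ Finset.range M, ENNReal.ofReal
          (Φ.cylMass (Finset.univ.filter fun i => k < N i) (p k) (ω k)) := by
        rw [prodMeasure_pi hp]
        refine Finset.prod_congr rfl fun k _ => ?_
        rw [vecMeasure_apply, cylMass, ENNReal.ofReal_sum_of_nonneg]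
        · refine Finset.sum_congr rfl fun a _ => ?_
          simp only [mem_ofPred_eq, Finset.mem_filter, Finset.mem_univ, true_and]
          split_ifs <;> simp
        · intro a _
          split_ifs
          exacts [(hp k).1 a, le_rfl]
    _ = ENNReal.ofReal (∏ k ∈ Finset.range M,
          Φ.cylMass (Finset.univ.filter fun i => k < N i) (p k) (ω k)) := by
        rw [ENNReal.ofReal_prod_of_nonneg fun k _ => cylMass_nonneg _ (hp k) _]
    _ ≤ _ := by
        refine ENNReal.ofReal_le_ofReal ?_
        rw [Finset.sum_neg_distrib, neg_neg, Real.exp_sum]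
        refine Finset.prod_le_prod (fun k _ => cylMass_nonneg _ (hp k) _) fun k _ => ?_
        rcases (cylMass_nonneg (Finset.univ.filter fun i => k < N i) (hp k) (ω k)).eq_or_lt
          with h0 | h0
        · rw [← h0]; exact (Real.exp_pos _).le
        · rw [Real.exp_log h0]

theorem prodMeasure_ball_le (hV : Φ.Valid) {p : ℕ → Φ.Symb → ℝ} (hp : ∀ k, IsProbVec (p k))
    {N : Fin d → ℕ} (hgood : ∀ k, Φ.GoodIdx (Finset.univ.filter fun i => k < N i)) {n s : ℝ}
    {M : ℕ} {K : Set (ℕ → Φ.Symb)} (hK : ∀ ω ∈ K, ∀ i, Φ.lexpSum i (N i) ω ≤ n)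
    (hK2 : ∀ ω ∈ K, s ≤ ∑ k ∈ Finset.range M,
        -Real.log (Φ.cylMass (Finset.univ.filter fun i => k < N i) (p k) (ω k)))
    (x : Fin d → ℝ) :
    prodMeasure p (K ∩ {ω | ∀ i, |Φ.coding ω i - x i| ≤ Real.exp (-n)}) ≤
      ENNReal.ofReal (4 ^ d * Real.exp (-s)) := by
  set ρ := Real.exp (-n) with hρ
  have hρ0 : 0 < ρ := Real.exp_pos _
  set S := K ∩ {ω | ∀ i, |Φ.coding ω i - x i| ≤ ρ} with hS
  let a : (ℕ → Φ.Symb) → Fin d → ℝ := fun ω i =>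
    min (Φ.coding ω i) (Φ.leftEnd i (N i) ω + |Φ.linPart i (N i) ω| - ρ)
  have ha : ∀ ω ∈ S, ∀ i, Φ.leftEnd i (N i) ω ≤ a ω i := by
    intro ω hω i
    refine le_min (coding_mem_interval hV i (N i) ω).1 ?_
    rw [abs_linPart hV]
    have : ρ ≤ Real.exp (-Φ.lexpSum i (N i) ω) :=
      Real.exp_le_exp.mpr (neg_le_neg (hK ω hω.1 i))
    linarith
  have ha2 : ∀ ω, ∀ i, a ω i + ρ ≤ Φ.leftEnd i (N i) ω + |Φ.linPart i (N i) ω| := by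
    intro ω i
    have := min_le_right (Φ.coding ω i) (Φ.leftEnd i (N i) ω + |Φ.linPart i (N i) ω| - ρ)
    change a ω i ≤ _ at this
    linarith
  have ha3 : ∀ ω ∈ S, ∀ i, -2 ≤ (a ω i - x i) / ρ ∧ (a ω i - x i) / ρ < 2 := by
    intro ω hω i
    have h1 := abs_le.mp (hω.2 i)
    have h2 : a ω i ≤ Φ.coding ω i := min_le_left _ _
    have h3 : Φ.coding ω i - ρ ≤ a ω i := by
      refine le_min (by linarith) ?_
      have := (coding_mem_interval hV i (N i) ω).2
      linarith
    rw [le_div_iff₀ hρ0, div_lt_iff₀ hρ0]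
    constructor <;> linarith
  let lab : (ℕ → Φ.Symb) → Fin d → ℤ := fun ω i => ⌊(a ω i - x i) / ρ⌋
  have hlab : ∀ ω ∈ S, lab ω ∈ Fintype.piFinset fun _ : Fin d => Finset.Ico (-2 : ℤ) 2 := by
    intro ω hω
    rw [Fintype.mem_piFinset]
    intro i
    obtain ⟨h1, h2⟩ := ha3 ω hω i
    rw [Finset.mem_Ico]
    exact ⟨Int.le_floor.mpr (by exact_mod_cast h1), Int.floor_lt.mpr (by exact_mod_cast h2)⟩
  have hclose : ∀ ω τ, lab ω = lab τ → ∀ i, |a ω i - a τ i| < ρ := by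
    intro ω τ h i
    have h1 := Int.abs_sub_lt_one_of_floor_eq_floor (congrFun h i)
    rw [← sub_div, abs_div, abs_of_pos hρ0, div_lt_one hρ0] at h1
    rwa [show a ω i - a τ i = a ω i - x i - (a τ i - x i) by ring]
  have hcov : S ⊆ ⋃ l ∈ Fintype.piFinset fun _ : Fin d => Finset.Ico (-2 : ℤ) 2,
      {ω | ω ∈ S ∧ lab ω = l} := by
    intro ω hω
    simp only [mem_iUnion]
    exact ⟨lab ω, hlab ω hω, hω, rfl⟩
  refine (measure_mono hcov).trans ((measure_biUnion_finset_le _ _).trans ?_)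
  have hone : ∀ l, prodMeasure p {ω | ω ∈ S ∧ lab ω = l} ≤ ENNReal.ofReal (Real.exp (-s)) := by
    intro l
    rcases Set.eq_empty_or_nonempty {ω | ω ∈ S ∧ lab ω = l} with h0 | ⟨ω, hω, hl⟩
    · rw [h0, measure_empty]; exact zero_le
    · refine le_trans (measure_mono fun τ hτ => ?_) ((prodMeasure_class_le hp N (M := M) ω).trans
        (ENNReal.ofReal_le_ofReal (Real.exp_le_exp.mpr (neg_le_neg (hK2 ω hω.1)))))
      exact same_class_of_close hV hgood (ha τ hτ.1) (ha2 τ) (ha ω hω) (ha2 ω)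
        (hclose τ ω (hτ.2.trans hl.symm))
  refine (Finset.sum_le_sum fun l _ => hone l).trans ?_
  rw [Finset.sum_const, Fintype.card_piFinset, Finset.prod_const]
  rw [ENNReal.ofReal_mul (by positivity), nsmul_eq_mul]
  simp

end DiagIFS

end

section

namespace DiagIFS

variable {Φ : DiagIFS d A}

theorem exists_full_mass_ball_bound (hV : Φ.Valid) {p : ℕ → Φ.Symb → ℝ}
    (hp : ∀ k, IsProbVec (p k)) {N : ℕ → Fin d → ℕ} {L : ℕ} (hL : 0 < L)
    (hN : ∀ n i, N n i ≤ L * n)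
    (hgood : ∀ n k, 1 ≤ n → Φ.GoodIdx (Finset.univ.filter fun i => k < N n i)) {s ε D : ℝ}
    (hε : 0 < ε)
    (hχ : ∀ n i, ∑ k ∈ Finset.range (N n i), Φ.chi i (p k) ≤ (1 - ε) * n)
    (hs : ∀ n : ℕ, s * n - D ≤ ∑ k ∈ Finset.range (L * n),
      Φ.entropy (Finset.univ.filter fun i => k < N n i) (p k)) :
    ∃ K : ℕ → Set (ℕ → Φ.Symb), Monotone K ∧ (∀ m, MeasurableSet (K m)) ∧
      prodMeasure p (⋃ m, K m) = 1 ∧ ∀ (m : ℕ) (x : Fin d → ℝ) (n : ℕ), 1 ≤ n → m ≤ n →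
        prodMeasure p (K m ∩ {ω | ∀ i, |Φ.coding ω i - x i| ≤ Real.exp (-n)}) ≤
          ENNReal.ofReal (4 ^ d * Real.exp (-((s - ε) * n - D))) := by
  obtain ⟨c, C, hc, hcC, h⟩ := exists_lexp_bounds hV
  have := isProbabilityMeasure_prodMeasure hp
  let f : ℕ → ℕ → Φ.Symb → ℝ := fun n k a =>
    -Real.log (Φ.cylMass (Finset.univ.filter fun i => k < N n i) (p k) a)
  have hf : ∀ n k a, 0 ≤ f n k a := fun n k a => by
    have := Real.log_nonpos (cylMass_nonneg (Finset.univ.filter fun i => k < N n i) (hp k) a)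
      (Φ.cylMass_le_one _ (hp k) a)
    simpa [f] using this
  have hfE : ∀ n k, ∑ a, p k a * f n k a =
      Φ.entropy (Finset.univ.filter fun i => k < N n i) (p k) := fun n k => by
    simp only [f, entropy, mul_neg, Finset.sum_neg_distrib]
  let g : Fin d → Φ.Symb → ℝ := fun i a => C - Φ.lexp i a
  have hg : ∀ i a, 0 ≤ g i a := fun i a => sub_nonneg.mpr (h i a).2
  have hgE : ∀ i k, ∑ a, p k a * g i a = C - Φ.chi i (p k) := fun i k => by
    simp only [g, mul_sub, Finset.sum_sub_distrib, ← Finset.sum_mul, (hp k).2, one_mul, chi_eq]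
  obtain ⟨M, hM0, hMf, hMg⟩ : ∃ M : ℝ, 0 < M ∧ (∀ n k, ∑ a, p k a * f n k a ^ 2 ≤ M) ∧
      ∀ i k, ∑ a, p k a * g i a ^ 2 ≤ M := by
    refine ⟨max (4 * Fintype.card Φ.Symb) (C ^ 2), ?_, fun n k => ?_, fun i k => ?_⟩
    · have : 0 < C ^ 2 := by have := hc.trans_le hcC; positivity
      exact lt_max_of_lt_right this
    · exact (sum_log_sq_cylMass_le _ (hp k)).trans (le_max_left _ _)
    · refine le_trans ?_ (le_max_right _ _)
      calc ∑ a, p k a * g i a ^ 2 ≤ ∑ a, p k a * C ^ 2 := by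
            refine Finset.sum_le_sum fun a _ => mul_le_mul_of_nonneg_left ?_ ((hp k).1 a)
            have h1 := hg i a
            have h2 : g i a ≤ C := by
              have := (h i a).1
              simp only [g]; linarith
            gcongr
        _ = C ^ 2 := by rw [← Finset.sum_mul, (hp k).2, one_mul]
  have hL' : (0 : ℝ) < L := by exact_mod_cast hL
  set κ := ε ^ 2 / (2 * M * L) with hκ
  have hκ0 : 0 < κ := by positivity
  have hbound : ∀ n n' : ℕ, n' ≤ L * n →
      Real.exp (-(ε / (M * L)) * (ε * n) + (ε / (M * L)) ^ 2 * M * n' / 2) ≤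
        Real.exp (-κ) ^ n := by
    intro n n' hn'
    rw [← Real.exp_nat_mul, Real.exp_le_exp]
    have h1 : (n' : ℝ) ≤ L * n := by exact_mod_cast hn'
    have h2 : (ε / (M * L)) ^ 2 * M * n' / 2 ≤ (ε / (M * L)) ^ 2 * M * (L * n) / 2 := by gcongr
    refine (add_le_add_right h2 _).trans (le_of_eq ?_)
    rw [hκ]
    field_simp
    ring
  have hsum : ∑' n : ℕ, ENNReal.ofReal (Real.exp (-κ) ^ n) ≠ ⊤ := by
    rw [← ENNReal.ofReal_tsum_of_nonneg (fun n => by positivity)]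
    · exact ENNReal.ofReal_ne_top
    · exact summable_geometric_of_lt_one (Real.exp_pos _).le (by simpa using hκ0)
  let Bf : ℕ → Set (ℕ → Φ.Symb) := fun n => {ω | ∑ k ∈ Finset.range (L * n), f n k (ω k) ≤
    ∑ k ∈ Finset.range (L * n), ∑ a, p k a * f n k a - ε * n}
  let Bg : Fin d → ℕ → Set (ℕ → Φ.Symb) := fun i n =>
    {ω | ∑ k ∈ Finset.range (N n i), g i (ω k) ≤
      ∑ k ∈ Finset.range (N n i), ∑ a, p k a * g i a - ε * n}
  have hmeas : ∀ (F : ℕ → Φ.Symb → ℝ) (n : ℕ),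
      Measurable fun ω : ℕ → Φ.Symb => ∑ k ∈ Finset.range n, F k (ω k) := fun F n =>
    Finset.measurable_sum _ fun k _ => Measurable.of_discrete.comp (measurable_pi_apply k)
  have hBfm : ∀ n, MeasurableSet (Bf n) := fun n =>
    measurableSet_le (hmeas (f n) _) measurable_const
  have hBgm : ∀ i n, MeasurableSet (Bg i n) := fun i n =>
    measurableSet_le (hmeas (fun _ => g i) _) measurable_const
  have hBf : ∀ᵐ ω ∂(prodMeasure p), ∀ᶠ n in atTop, ω ∉ Bf n := by
    refine ae_eventually_notMem (ne_top_of_le_ne_top hsum (ENNReal.tsum_le_tsum fun n => ?_))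
    rw [← ENNReal.ofReal_toReal (measure_ne_top (prodMeasure p) (Bf n))]
    exact ENNReal.ofReal_le_ofReal ((prodMeasure_chernoff hp (hf n) (hMf n)
      (t := ε / (M * L)) (by positivity) (L * n) _).trans (hbound n _ le_rfl))
  have hBg : ∀ i, ∀ᵐ ω ∂(prodMeasure p), ∀ᶠ n in atTop, ω ∉ Bg i n := by
    intro i
    refine ae_eventually_notMem (ne_top_of_le_ne_top hsum (ENNReal.tsum_le_tsum fun n => ?_))
    rw [← ENNReal.ofReal_toReal (measure_ne_top (prodMeasure p) (Bg i n))]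
    exact ENNReal.ofReal_le_ofReal ((prodMeasure_chernoff hp (f := fun _ => g i) (fun _ => hg i)
      (hMg i) (t := ε / (M * L)) (by positivity) (N n i) _).trans (hbound n _ (hN n i)))
  let K : ℕ → Set (ℕ → Φ.Symb) := fun m => {ω | ∀ n, m ≤ n → ω ∉ Bf n ∧ ∀ i, ω ∉ Bg i n}
  refine ⟨K, fun m m' hm ω hω n hn => hω n (hm.trans hn), fun m => ?_, ?_, ?_⟩
  · have : K m = ⋂ n, ⋂ _ : m ≤ n, ((Bf n)ᶜ ∩ ⋂ i, (Bg i n)ᶜ) := by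
      ext ω
      simp [K]
    rw [this]
    exact MeasurableSet.iInter fun n => MeasurableSet.iInter fun _ =>
      (hBfm n).compl.inter (MeasurableSet.iInter fun i => (hBgm i n).compl)
  · rw [← measure_univ (μ := prodMeasure p)]
    refine measure_congr ?_
    rw [eventuallyEq_univ]
    filter_upwards [hBf, ae_all_iff.mpr hBg] with ω h1 h2
    obtain ⟨m, hm⟩ := eventually_atTop.mp (h1.and (eventually_all.mpr h2))
    exact mem_iUnion.mpr ⟨m, hm⟩
  · intro m x n hn hmn
    refine prodMeasure_ball_le hV hp (hgood n · hn) (M := L * n) (fun ω hω i => ?_)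
      (fun ω hω => ?_) x
    · have h1 := (hω n hmn).2 i
      simp only [Bg, mem_ofPred_eq, not_le, hgE, Finset.sum_sub_distrib, g] at h1
      have h2 := hχ n i
      change ∑ k ∈ Finset.range (N n i), Φ.lexp i (ω k) ≤ n
      linarith
    · have h1 := (hω n hmn).1
      simp only [Bf, mem_ofPred_eq, not_le, hfE] at h1
      have h2 := hs n
      have h3 : (s - ε) * n - D = s * n - D - ε * n := by ring
      rw [h3]
      exact (sub_le_sub_right h2 _).trans h1.le

end DiagIFS

end

section

variable {Φ : DiagIFS d A} {r : ℝ → Φ.Symb → ℝ}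

/-- the average of a path over `(k, k+1]` -/
noncomputable def unitAvg (r : ℝ → Φ.Symb → ℝ) (k : ℕ) : Φ.Symb → ℝ :=
  fun a => ∫ b in Ioc (k : ℝ) (k + 1), r b a

theorem IsPath.integrableOn (hr : IsPath Φ r) (a : Φ.Symb) {x : ℝ} (hx : 0 ≤ x) (y : ℝ) :
    IntegrableOn (fun b => r b a) (Ioc x y) := by
  have hs : Ioc x y ⊆ Ioi 0 := fun b hb => hx.trans_lt hb.1
  refine Integrable.of_bound (C := 1) ?_ ?_
  · exact ((continuousOn_pi.mp hr.cont a).mono hs).aestronglyMeasurable measurableSet_Ioc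
  · filter_upwards [ae_restrict_mem measurableSet_Ioc] with b hb
    have := hr.prob b (hs hb)
    rw [Real.norm_eq_abs, abs_of_nonneg (this.1 a)]
    exact this.le_one a

theorem isProbVec_unitAvg (hr : IsPath Φ r) (k : ℕ) : IsProbVec (unitAvg r k) := by
  have hk : (0 : ℝ) ≤ k := k.cast_nonneg
  constructor
  · exact fun a => setIntegral_nonneg measurableSet_Ioc fun b hb =>
      (hr.prob b (hk.trans_lt hb.1)).1 a
  · simp only [unitAvg]
    rw [← integral_finsetSum _ fun a _ => hr.integrableOn a hk _,
      setIntegral_congr_fun measurableSet_Ioc (g := fun _ => (1 : ℝ)) fun b hb =>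
        (hr.prob b (hk.trans_lt hb.1)).2]
    simp

theorem chi_setIntegral (hr : IsPath Φ r) (i : Fin d) {x y : ℝ} (hx : 0 ≤ x) :
    Φ.chi i (fun a => ∫ b in Ioc x y, r b a) = ∫ b in Ioc x y, Φ.chi i (r b) := by
  simp only [DiagIFS.chi_eq]
  rw [integral_finsetSum _ fun a _ => (hr.integrableOn a hx _).mul_const _]
  exact Finset.sum_congr rfl fun a _ => (integral_mul_const _ _).symm

theorem chi_smul (i : Fin d) (t : ℝ) (p : Φ.Symb → ℝ) :
    Φ.chi i (fun a => t * p a) = t * Φ.chi i p := by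
  simp only [DiagIFS.chi_eq, Finset.mul_sum, mul_assoc]

theorem entropy_unitAvg (hr : IsPath Φ r) (I : Finset (Fin d)) (k : ℕ) :
    ∫ b in Ioc (k : ℝ) (k + 1), Φ.entropy I (r b) ≤ Φ.entropy I (unitAvg r k) := by
  have hk : (0 : ℝ) ≤ k := k.cast_nonneg
  have hs : Ioc (k : ℝ) (k + 1) ⊆ Ioi 0 := fun b hb => hk.trans_lt hb.1
  have hpm : ∀ v, Φ.projMass I (unitAvg r k) v =
      ∫ b in Ioc (k : ℝ) (k + 1), Φ.projMass I (r b) v := by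
    intro v
    simp only [DiagIFS.projMass, unitAvg]
    rw [integral_finsetSum]
    · refine Finset.sum_congr rfl fun a _ => ?_
      split_ifs <;> simp
    · intro a _
      split_ifs
      exacts [hr.integrableOn a hk _, integrable_zero _ _ _]
  have hprob : IsProbabilityMeasure (volume.restrict (Ioc (k : ℝ) (k + 1))) :=
    ⟨by simp⟩
  have hnn : ∀ b ∈ Ioc (k : ℝ) (k + 1), ∀ v, 0 ≤ Φ.projMass I (r b) v ∧
      Φ.projMass I (r b) v ≤ 1 := by
    intro b hb v
    have hb := hr.prob b (hs hb)
    have h0 : ∀ v, 0 ≤ Φ.projMass I (r b) v := fun v => Finset.sum_nonneg fun a _ => by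
      split_ifs
      exacts [hb.1 a, le_rfl]
    refine ⟨h0 v, ?_⟩
    rw [← hb.2, ← Φ.sum_projMass I]
    exact Finset.single_le_sum (fun v _ => h0 v) (Finset.mem_univ v)
  have hcont : ∀ v, ContinuousOn (fun b => Φ.projMass I (r b) v) (Ioc (k : ℝ) (k + 1)) :=
    fun v => (Φ.continuous_projMass I v).comp_continuousOn (hr.cont.mono hs)
  have hint : ∀ v, IntegrableOn (fun b => Φ.projMass I (r b) v) (Ioc (k : ℝ) (k + 1)) := by
    intro v
    refine Integrable.of_bound (C := 1) ((hcont v).aestronglyMeasurable measurableSet_Ioc) ?_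
    filter_upwards [ae_restrict_mem measurableSet_Ioc] with b hb
    rw [Real.norm_eq_abs, abs_of_nonneg (hnn b hb v).1]
    exact (hnn b hb v).2
  have hint2 : ∀ v, IntegrableOn (fun b => Real.negMulLog (Φ.projMass I (r b) v))
      (Ioc (k : ℝ) (k + 1)) := by
    intro v
    refine Integrable.of_bound (C := 1) ((Real.continuous_negMulLog.comp_continuousOn
      (hcont v)).aestronglyMeasurable measurableSet_Ioc) ?_
    filter_upwards [ae_restrict_mem measurableSet_Ioc] with b hb
    obtain ⟨h1, h2⟩ := hnn b hb v
    rw [Real.norm_eq_abs]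
    rcases h1.eq_or_lt with h0 | h0
    · simp [← h0]
    · have := Real.abs_log_mul_self_lt _ h0 h2
      rw [Real.negMulLog, neg_mul, abs_neg, mul_comm]
      exact this.le
  simp only [DiagIFS.entropy_eq]
  rw [integral_finsetSum _ fun v _ => hint2 v]
  refine Finset.sum_le_sum fun v _ => ?_
  rw [hpm]
  exact Real.concaveOn_negMulLog.le_map_integral Real.continuous_negMulLog.continuousOn isClosed_Ici
    (by filter_upwards [ae_restrict_mem measurableSet_Ioc] with b hb using (hnn b hb v).1)
    (hint v) (hint2 v)

theorem DiagIFS.goodIdx_empty : Φ.GoodIdx ∅ := fun a _ b _ ⟨i, hi, _⟩ => absurd hi (by simp)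

theorem DiagIFS.GoodVec.goodIdx_lt {q : Φ.Symb → ℝ} (hq : Φ.GoodVec q) (h0 : ∀ i, 0 < Φ.chi i q)
    (y : ℝ) : Φ.GoodIdx (Finset.univ.filter fun i => Φ.chi i q < y) := by
  rcases (Finset.univ.filter fun i => Φ.chi i q < y).eq_empty_or_nonempty with he | hne
  · rw [he]; exact goodIdx_empty
  · obtain ⟨j, hj, hmax⟩ := Finset.exists_max_image _ (fun i => Φ.chi i q) hne
    convert hq (Φ.chi j q) (h0 j) using 1
    ext i
    simp only [Finset.mem_filter, Finset.mem_univ, true_and] at hj hmax ⊢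
    exact ⟨fun hi => hmax i hi, fun hi => hi.trans_lt hj⟩

theorem sum_chi_unitAvg {c C : ℝ} (hc : 0 < c) (h : ∀ i a, c ≤ Φ.lexp i a ∧ Φ.lexp i a ≤ C)
    (hr : IsPath Φ r) (i : Fin d) (n : ℕ) :
    ∑ k ∈ Finset.range n, Φ.chi i (unitAvg r k) = chiInt Φ r i n := by
  induction n with
  | zero => simp [chiInt]
  | succ n ih =>
    have hn : (0 : ℝ) ≤ n := n.cast_nonneg
    have := chiInt_sub hc h hr i hn (y := n + 1) (by linarith)
    rw [Finset.sum_range_succ, ih]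
    rw [show unitAvg r n = fun a => ∫ b in Ioc (n : ℝ) (n + 1), r b a from rfl,
      chi_setIntegral hr i hn, ← this]
    push_cast
    ring

theorem integral_entropy_le_sum (hr : IsPath Φ r) {β : Fin d → ℝ} {M : ℕ} (hβ : ∀ i, β i ≤ M) :
    ∫ b in Ioi (0 : ℝ), Φ.entropy (Finset.univ.filter fun i => b ≤ β i) (r b) ≤
      ∑ k ∈ Finset.range M,
        Φ.entropy (Finset.univ.filter fun i => k < ⌈β i⌉₊) (unitAvg r k) := by
  have hI := integrableOn_entropy hr β
  have hM : ∀ n : ℕ,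
      ∫ b in Ioc (0 : ℝ) n, Φ.entropy (Finset.univ.filter fun i => b ≤ β i) (r b) ≤
      ∑ k ∈ Finset.range n,
        Φ.entropy (Finset.univ.filter fun i => k < ⌈β i⌉₊) (unitAvg r k) := by
    intro n
    induction n with
    | zero => simp
    | succ n ih =>
      have hn : (0 : ℝ) ≤ n := n.cast_nonneg
      rw [Finset.sum_range_succ]
      push_cast
      rw [← Ioc_union_Ioc_eq_Ioc hn (by linarith : (n : ℝ) ≤ n + 1),
        setIntegral_union (Ioc_disjoint_Ioc_of_le le_rfl) measurableSet_Ioc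
          (hI.mono_set fun b hb => hb.1) (hI.mono_set fun b hb => hn.trans_lt hb.1)]
      refine add_le_add ih ((setIntegral_mono_on (hI.mono_set fun b hb => hn.trans_lt hb.1) ?_
        measurableSet_Ioc fun b hb => ?_).trans (entropy_unitAvg hr _ n))
      · have hs : Ioc (n : ℝ) (n + 1) ⊆ Ioi 0 := fun b hb => hn.trans_lt hb.1
        refine Integrable.of_bound (C := Fintype.card Φ.Symb) (((Φ.continuous_entropy
          _).comp_continuousOn (hr.cont.mono hs)).aestronglyMeasurable measurableSet_Ioc) ?_
        filter_upwards [ae_restrict_mem measurableSet_Ioc] with b hb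
        rw [Real.norm_eq_abs, abs_of_nonneg (Φ.entropy_nonneg _ (hr.prob b (hs hb)))]
        exact Φ.entropy_le_card _ (hr.prob b (hs hb))
      · refine Φ.entropy_mono (fun i hi => ?_) (hr.prob b (hn.trans_lt hb.1))
        simp only [Finset.mem_filter, Finset.mem_univ, true_and] at hi ⊢
        exact Nat.lt_ceil.mpr (hb.1.trans_le hi)
  refine le_trans (le_of_eq ?_) (hM M)
  refine setIntegral_eq_of_subset_of_forall_sdiff_eq_zero measurableSet_Ioi (fun b hb => hb.1)
    fun b hb => ?_
  have hb0 : 0 < b := hb.1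
  have hbM : (M : ℝ) < b := by
    by_contra! hle
    exact hb.2 ⟨hb0, hle⟩
  rw [filter_le_eq_empty hβ hbM, Φ.entropy_empty (hr.prob b hb0)]

theorem exists_full_mass_of_path (hV : Φ.Valid) (hr : IsPath Φ r)
    (hgood : ∀ B > 0, Φ.GoodVec fun a => B⁻¹ * ∫ b in Ioc (0 : ℝ) B, r b a) {δ ε : ℝ}
    (hδ0 : 0 ≤ δ) (hδ : ∀ B, 1 ≤ B → δ ≤ deltaRB Φ r B) (hε : 0 < ε) (hε1 : ε < 1) :
    ∃ (D : ℝ) (K : ℕ → Set (ℕ → Φ.Symb)), Monotone K ∧ (∀ m, MeasurableSet (K m)) ∧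
      prodMeasure (unitAvg r) (⋃ m, K m) = 1 ∧
      ∀ (m : ℕ) (x : Fin d → ℝ) (n : ℕ), 1 ≤ n → m ≤ n →
        prodMeasure (unitAvg r) (K m ∩ {ω | ∀ i, |Φ.coding ω i - x i| ≤ Real.exp (-n)}) ≤
          ENNReal.ofReal (4 ^ d * Real.exp (-(((1 - ε) * δ - ε) * n - D))) := by
  obtain ⟨c, C, hc, hcC, h⟩ := DiagIFS.exists_lexp_bounds hV
  have hC : 0 < C := hc.trans_le hcC
  let B : ℕ → ℝ := fun n => max 0 ((1 - ε) * n - C)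
  have hB0 : ∀ n, 0 ≤ B n := fun n => le_max_left _ _
  have hBn : ∀ n : ℕ, B n ≤ n := fun n => max_le n.cast_nonneg (by
    have : (0 : ℝ) ≤ ε * n := by positivity
    linarith)
  set L : ℕ := ⌈c⁻¹⌉₊ + 1 with hL
  have hLc : c⁻¹ ≤ L := by rw [hL]; push_cast; linarith [Nat.le_ceil c⁻¹]
  have hbL : ∀ n i, Bcoord Φ r (B n) i ≤ ((L * n : ℕ) : ℝ) := by
    intro n i
    refine (bcoord_le hc h hr i (hB0 n)).trans ?_
    rw [div_eq_mul_inv, mul_comm]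
    push_cast
    have := hBn n
    have := hB0 n
    gcongr
  refine ⟨δ * (C + 1), DiagIFS.exists_full_mass_ball_bound hV (isProbVec_unitAvg hr)
    (N := fun n i => ⌈Bcoord Φ r (B n) i⌉₊) (L := L) (by omega)
    (fun n i => Nat.ceil_le.mpr (hbL n i)) ?_ hε ?_ ?_⟩
  · intro n k _
    have hset : (Finset.univ.filter fun i => k < ⌈Bcoord Φ r (B n) i⌉₊) =
        Finset.univ.filter fun i => chiInt Φ r i k < B n := by
      ext i
      simp only [Finset.mem_filter, Finset.mem_univ, true_and]
      rw [Nat.lt_ceil, lt_bcoord_iff hc h hr i (hB0 n) k.cast_nonneg]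
    rw [hset]
    have hchi : ∀ (x : ℝ) (i : Fin d), Φ.chi i (fun a => x⁻¹ * ∫ b in Ioc (0 : ℝ) x, r b a) =
        x⁻¹ * chiInt Φ r i x := fun x i => by
      rw [chi_smul, chi_setIntegral hr i le_rfl, chiInt]
    have hpos : ∀ (x : ℝ) (i : Fin d), 0 < x →
        0 < Φ.chi i (fun a => x⁻¹ * ∫ b in Ioc (0 : ℝ) x, r b a) := fun x i hx => by
      rw [hchi]
      have := chiInt_strictMono hc h hr i le_rfl hx
      rw [chiInt_zero] at this
      positivity
    rcases Nat.eq_zero_or_pos k with rfl | hk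
    · simp only [Nat.cast_zero, chiInt_zero]
      by_cases hBp : 0 < B n
      · have := (hgood 1 one_pos).goodIdx_lt (fun i => hpos 1 i one_pos) (C + 1)
        convert this using 1
        ext i
        simp only [hBp, Finset.mem_filter, Finset.mem_univ, true_and, true_iff, hchi]
        have := (chiInt_sub_bounds hc h hr i le_rfl zero_le_one).2
        rw [chiInt_zero] at this
        rw [inv_one, one_mul]
        linarith
      · simp only [hBp, Finset.filter_false]
        exact DiagIFS.goodIdx_empty
    · have hk' : (0 : ℝ) < k := by exact_mod_cast hk
      have := (hgood k hk').goodIdx_lt (fun i => hpos k i hk') ((k : ℝ)⁻¹ * B n)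
      convert this using 1
      ext i
      simp only [Finset.mem_filter, Finset.mem_univ, true_and, hchi]
      rw [mul_lt_mul_iff_right₀ (by positivity)]
  · intro n i
    rw [sum_chi_unitAvg hc h hr]
    obtain ⟨h1, h2⟩ := bcoord_spec hc h hr i (hB0 n)
    rcases (hB0 n).eq_or_lt with h0 | h0
    · have : Bcoord Φ r (B n) i = 0 :=
        bcoord_eq_of_chiInt_eq hc h hr i le_rfl (by rw [chiInt_zero, h0])
      rw [this]
      simp only [Nat.ceil_zero, Nat.cast_zero, chiInt_zero]
      have : (0 : ℝ) ≤ n := n.cast_nonneg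
      nlinarith
    · have h3 := (chiInt_sub_bounds hc h hr i h1 (Nat.le_ceil _)).2
      have h4 := Nat.ceil_lt_add_one h1
      have h5 : B n = (1 - ε) * n - C := by
        rcases max_choice 0 ((1 - ε) * n - C) with h6 | h6
        · exact absurd h6 h0.ne'
        · exact h6
      rw [h2] at h3
      nlinarith
  · intro n
    have h1 := integral_entropy_le_sum hr (hbL n)
    refine le_trans ?_ h1
    have h2 : (1 - ε) * n - C ≤ B n := le_max_right _ _
    have h3 : (1 - ε) * δ * n - δ * (C + 1) ≤ δ * (B n - 1) := by nlinarith
    refine h3.trans ?_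
    rcases le_total 1 (B n) with h4 | h4
    · rw [← mul_deltaRB (zero_lt_one.trans_le h4)]
      have := mul_le_mul_of_nonneg_left (hδ _ h4) (hB0 n)
      linarith
    · refine le_trans ?_ (setIntegral_nonneg measurableSet_Ioi fun b hb =>
        Φ.entropy_nonneg _ (hr.prob b hb))
      nlinarith

end

section

section MassDistribution

variable {X : Type*} [MetricSpace X] [MeasurableSpace X] [BorelSpace X]

theorem hausdorffMeasure_ne_zero_of_ball_bound {ν : Measure X} {F S : Set X}
    (hF : MeasurableSet F) {s D ρ₀ : ℝ} (hs : 0 < s) (hD : 0 < D) (hρ₀ : 0 < ρ₀)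
    (h : ∀ x ∈ F, ∀ ρ, 0 < ρ → ρ < ρ₀ → ν (closedBall x ρ) ≤ ENNReal.ofReal (D * ρ ^ s))
    (hS : ν (S ∩ F) ≠ 0) : Measure.hausdorffMeasure s S ≠ 0 := by
  have hle : (ENNReal.ofReal D)⁻¹ • ν.restrict F ≤ Measure.hausdorffMeasure s := by
    refine Measure.le_hausdorffMeasure s _ (ENNReal.ofReal (ρ₀ / 2))
      (ENNReal.ofReal_pos.mpr (by linarith)) fun T hT => ?_
    rw [Measure.smul_apply, smul_eq_mul, Measure.restrict_apply' hF]
    rcases (T ∩ F).eq_empty_or_nonempty with h0 | ⟨y, hyT, hyF⟩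
    · rw [h0, measure_empty, mul_zero]; exact zero_le
    have hfin : ediam T ≠ ⊤ := ne_top_of_le_ne_top ENNReal.ofReal_ne_top hT
    set t := (ediam T).toReal with ht
    have htt : ENNReal.ofReal t = ediam T := ENNReal.ofReal_toReal hfin
    have ht0 : 0 ≤ t := ENNReal.toReal_nonneg
    have htρ : t < ρ₀ := by
      rw [← htt, ENNReal.ofReal_le_ofReal_iff (by linarith)] at hT
      linarith
    have hball : ν (T ∩ F) ≤ ENNReal.ofReal (D * t ^ s) := by
      have hcont : Tendsto (fun ρ : ℝ => ENNReal.ofReal (D * ρ ^ s)) (𝓝[>] t)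
          (𝓝 (ENNReal.ofReal (D * t ^ s))) := by
        refine tendsto_nhdsWithin_of_tendsto_nhds ?_
        exact (ENNReal.continuous_ofReal.comp
          (continuous_const.mul (Real.continuous_rpow_const hs.le))).tendsto t
      refine ge_of_tendsto hcont ?_
      filter_upwards [Ioo_mem_nhdsGT htρ] with ρ hρ
      refine (measure_mono fun z hz => ?_).trans (h y hyF ρ (ht0.trans_lt hρ.1) hρ.2)
      rw [mem_closedBall, ← ENNReal.ofReal_le_ofReal_iff (ht0.trans hρ.1.le), ← edist_dist]
      exact (edist_le_ediam_of_mem hz.1 hyT).trans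
        (htt ▸ ENNReal.ofReal_le_ofReal hρ.1.le)
    rw [ENNReal.ofReal_mul hD.le, ← ENNReal.ofReal_rpow_of_nonneg ht0 hs.le, htt] at hball
    rw [ENNReal.inv_mul_le_iff (ENNReal.ofReal_pos.mpr hD).ne' ENNReal.ofReal_ne_top]
    exact hball
  intro h0
  have := hle S
  rw [h0, Measure.smul_apply, smul_eq_mul, Measure.restrict_apply' hF, nonpos_iff_eq_zero,
    mul_eq_zero, ENNReal.inv_eq_zero] at this
  exact this.elim (fun h => ENNReal.ofReal_ne_top h) hS

omit [BorelSpace X] in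
theorem le_lowerPtDim {ν : Measure X} [IsFiniteMeasure ν] {x : X} {s D : ℝ} (hD : 0 < D)
    (h : ∀ᶠ ρ : ℝ in 𝓝[>] 0, ν (ball x ρ) ≤ ENNReal.ofReal (D * ρ ^ s))
    (hpos : ∀ ρ > 0, ν (ball x ρ) ≠ 0) : ENNReal.ofReal s ≤ lowerPtDim ν x := by
  refine le_of_forall_lt fun b hb => ?_
  obtain ⟨t, ht0, htb, hts⟩ := (ENNReal.lt_iff_exists_real_btwn).mp hb
  have hts' : t < s := (ENNReal.ofReal_lt_ofReal_iff_of_nonneg ht0).mp hts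
  refine htb.trans_le (le_liminf_of_le (by isBoundedDefault) ?_)
  have hlim : Tendsto (fun ρ : ℝ => ρ ^ (s - t)) (𝓝[>] 0) (𝓝 0) := by
    have := (Real.continuous_rpow_const (sub_pos.mpr hts').le).tendsto (0 : ℝ)
    rw [Real.zero_rpow (sub_pos.mpr hts').ne'] at this
    exact tendsto_nhdsWithin_of_tendsto_nhds this
  filter_upwards [h, hlim.eventually (gt_mem_nhds (inv_pos.mpr hD)), self_mem_nhdsWithin,
    Ioo_mem_nhdsGT (zero_lt_one' ℝ)] with ρ h1 h2 h3 h4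
  refine ENNReal.ofReal_le_ofReal ?_
  have h3 : 0 < ρ := h3
  rw [le_div_iff_of_neg (Real.log_neg h3 h4.2), ← Real.log_rpow h3]
  refine Real.log_le_log (ENNReal.toReal_pos (hpos ρ h3) (measure_ne_top _ _)) ?_
  refine ENNReal.toReal_le_of_le_ofReal (by positivity) (h1.trans (ENNReal.ofReal_le_ofReal ?_))
  have h5 : ρ ^ s = ρ ^ (s - t) * ρ ^ t := by rw [← Real.rpow_add h3]; ring_nf
  rw [h5, ← mul_assoc]
  refine mul_le_of_le_one_left (by positivity) ?_
  have := mul_lt_mul_of_pos_left h2 hD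
  rw [mul_inv_cancel₀ hD.ne'] at this
  exact this.le

theorem le_measDim_of_restrict [SecondCountableTopology X] [HasBesicovitchCovering X]
    {ν κ : Measure X} [IsFiniteMeasure ν] (hκν : κ ≤ ν) (hκ : κ univ ≠ 0) {s D ρ₀ : ℝ}
    (hD : 0 < D) (hρ₀ : 0 < ρ₀)
    (h : ∀ x, ∀ ρ, 0 < ρ → ρ < ρ₀ → κ (closedBall x ρ) ≤ ENNReal.ofReal (D * ρ ^ s)) :
    ENNReal.ofReal s ≤ measDim ν := by
  have : IsFiniteMeasure κ := isFiniteMeasure_of_le ν hκν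
  by_contra! hlt
  have hae := ae_lt_of_essSup_lt hlt
  have hder := Besicovitch.ae_tendsto_rnDeriv κ ν
  refine hκ ?_
  rw [← Measure.lintegral_rnDeriv (Measure.absolutelyContinuous_of_le hκν),
    lintegral_eq_zero_iff (Measure.measurable_rnDeriv κ ν)]
  filter_upwards [hae, hder] with x hx hdx
  by_contra hne
  refine hx.not_ge ?_
  set q := κ.rnDeriv ν x with hq
  have hq0 : 0 < q := pos_iff_ne_zero.mpr hne
  obtain ⟨e, he0, heq⟩ := exists_between hq0
  have he_top : e ≠ ⊤ := heq.ne_top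
  have hev := hdx.eventually (lt_mem_nhds heq)
  have hcb : ∀ᶠ ρ : ℝ in 𝓝[>] 0, ν (closedBall x ρ) ≤ ENNReal.ofReal (D / e.toReal * ρ ^ s) ∧
      ν (closedBall x ρ) ≠ 0 := by
    filter_upwards [hev, Ioo_mem_nhdsGT hρ₀] with ρ h1 h2
    have hν0 : ν (closedBall x ρ) ≠ 0 := by
      intro h0
      have : κ (closedBall x ρ) = 0 := le_antisymm ((hκν _).trans h0.le) zero_le
      rw [this, ENNReal.zero_div] at h1
      exact absurd h1 (not_lt.mpr zero_le)
    refine ⟨?_, hν0⟩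
    have h3 := (ENNReal.le_div_iff_mul_le (Or.inl hν0) (Or.inl (measure_ne_top _ _))).mp h1.le
    have h4 := h3.trans (h x ρ h2.1 h2.2)
    rw [mul_comm, ← ENNReal.le_div_iff_mul_le (Or.inl he0.ne') (Or.inl he_top)] at h4
    refine h4.trans (le_of_eq ?_)
    rw [div_mul_eq_mul_div, ENNReal.ofReal_div_of_pos (ENNReal.toReal_pos he0.ne' he_top),
      ENNReal.ofReal_toReal he_top]
  refine le_lowerPtDim (D := D / e.toReal) (div_pos hD (ENNReal.toReal_pos he0.ne' he_top))
    (hcb.mono fun ρ hρ => (measure_mono ball_subset_closedBall).trans hρ.1) fun ρ hρ h0 => ?_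
  obtain ⟨ρ', h1, h2⟩ := (hcb.and (Ioo_mem_nhdsGT hρ)).exists
  exact h1.2 (measure_mono_null (closedBall_subset_ball h2.2) h0)

end MassDistribution

variable {Φ : DiagIFS d A}

/-- a measure obeying exponential bounds along scales `e^{-n}` obeys power bounds -/
theorem ball_bound_of_exp {X : Type*} [PseudoMetricSpace X] [MeasurableSpace X] {κ : Measure X}
    {s D : ℝ} (hs : 0 ≤ s) (hD : 0 ≤ D) {m : ℕ}
    (h : ∀ (x : X) (n : ℕ), 1 ≤ n → m ≤ n →
      κ (closedBall x (Real.exp (-n))) ≤ ENNReal.ofReal (D * Real.exp (-(s * n)))) :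
    ∀ x : X, ∀ ρ, 0 < ρ → ρ < Real.exp (-((m : ℝ) + 1)) →
      κ (closedBall x ρ) ≤ ENNReal.ofReal (D * Real.exp s * ρ ^ s) := by
  intro x ρ h0 hρ
  have hlog : (m : ℝ) + 1 < -Real.log ρ := by
    have := Real.log_lt_log h0 hρ
    rw [Real.log_exp] at this
    linarith
  set n := ⌊-Real.log ρ⌋₊ with hn
  have hm0 : (0 : ℝ) ≤ m := m.cast_nonneg
  have hn1 : (n : ℝ) ≤ -Real.log ρ := Nat.floor_le (by linarith)
  have hn2 : -Real.log ρ < n + 1 := Nat.lt_floor_add_one _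
  have hmn : m + 1 ≤ n := Nat.le_floor (by push_cast; exact hlog.le)
  have hρn : ρ ≤ Real.exp (-n) := by
    rw [← Real.exp_log h0, Real.exp_le_exp]
    linarith
  refine (measure_mono (closedBall_subset_closedBall hρn)).trans
    ((h x n (by omega) (by omega)).trans (ENNReal.ofReal_le_ofReal ?_))
  rw [mul_assoc, Real.rpow_def_of_pos h0, ← Real.exp_add]
  refine mul_le_mul_of_nonneg_left (Real.exp_le_exp.mpr ?_) hD
  nlinarith

theorem exists_ball_bound_of_path (hV : Φ.Valid) {r : ℝ → Φ.Symb → ℝ} (hr : IsPath Φ r)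
    (hgood : ∀ B > 0, Φ.GoodVec fun a => B⁻¹ * ∫ b in Ioc (0 : ℝ) B, r b a) {δ ε : ℝ}
    (hδ0 : 0 ≤ δ) (hδ : ∀ B, 1 ≤ B → δ ≤ deltaRB Φ r B) (hε : 0 < ε) (hε1 : ε < 1)
    (hs : 0 ≤ (1 - ε) * δ - ε) :
    ∃ (K : Set (ℕ → Φ.Symb)) (D ρ₀ : ℝ), MeasurableSet K ∧ prodMeasure (unitAvg r) K ≠ 0 ∧
      0 < D ∧ 0 < ρ₀ ∧ ∀ x : Fin d → ℝ, ∀ ρ, 0 < ρ → ρ < ρ₀ →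
        ((prodMeasure (unitAvg r)).restrict K).map Φ.coding (closedBall x ρ) ≤
          ENNReal.ofReal (D * ρ ^ ((1 - ε) * δ - ε)) := by
  obtain ⟨D, K, hmono, hKm, hK1, hK⟩ := exists_full_mass_of_path hV hr hgood hδ0 hδ hε hε1
  obtain ⟨m, hm⟩ : ∃ m, prodMeasure (unitAvg r) (K m) ≠ 0 := by
    by_contra! h0
    rw [measure_iUnion_null h0] at hK1
    exact zero_ne_one hK1
  refine ⟨K m, 4 ^ d * Real.exp D * Real.exp ((1 - ε) * δ - ε), Real.exp (-((m : ℝ) + 1)), hKm m,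
    hm, by positivity, by positivity, ball_bound_of_exp hs (by positivity) fun x n hn hmn => ?_⟩
  rw [Measure.map_apply (DiagIFS.measurable_coding hV) measurableSet_closedBall,
    Measure.restrict_apply' (hKm m), inter_comm]
  refine le_trans (le_of_eq ?_) ((hK m x n hn hmn).trans (le_of_eq ?_))
  · congr 2
    ext ω
    simp only [mem_preimage, mem_closedBall, mem_ofPred_eq,
      dist_pi_le_iff (Real.exp_pos (-(n : ℝ))).le, Real.dist_eq]
  · rw [mul_assoc, ← Real.exp_add]
    congr 3
    ring

theorem ofReal_le_of_forall_eps {δ : ℝ} {x : ℝ≥0∞}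
    (h : ∀ ε, 0 < ε → ε < 1 → 0 < (1 - ε) * δ - ε → ENNReal.ofReal ((1 - ε) * δ - ε) ≤ x) :
    ENNReal.ofReal δ ≤ x := by
  have hcont : Tendsto (fun ε : ℝ => ENNReal.ofReal ((1 - ε) * δ - ε)) (𝓝[>] 0)
      (𝓝 (ENNReal.ofReal δ)) := by
    have : Continuous fun ε : ℝ => ENNReal.ofReal ((1 - ε) * δ - ε) :=
      ENNReal.continuous_ofReal.comp (by fun_prop)
    have := this.tendsto 0
    simp only [sub_zero, one_mul] at this
    exact tendsto_nhdsWithin_of_tendsto_nhds this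
  refine le_of_tendsto hcont ?_
  filter_upwards [Ioo_mem_nhdsGT (zero_lt_one' ℝ)] with ε hε
  rcases le_or_gt ((1 - ε) * δ - ε) 0 with h0 | h0
  · rw [ENNReal.ofReal_of_nonpos h0]; exact zero_le
  · exact h ε hε.1 hε.2 h0

theorem Cycle.delta_nonneg (c : Cycle Φ) : 0 ≤ c.delta := by
  refine Real.sInf_nonneg ?_
  rintro _ ⟨B, hB, rfl⟩
  exact deltaRB_nonneg c.isPath (zero_le_one.trans hB.1)

theorem delta_le_dimH (hV : Φ.Valid) (c : Cycle Φ) (hc : c.Good) :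
    ENNReal.ofReal c.delta ≤ dimH Φ.limitSet := by
  refine ofReal_le_of_forall_eps fun ε hε hε1 hs => ?_
  obtain ⟨K, D, ρ₀, hKm, hK, hD, hρ₀, hb⟩ := exists_ball_bound_of_path hV c.isPath hc
    c.delta_nonneg (fun B hB => c.delta_le hV hB) hε hε1 hs.le
  refine le_trans (le_of_eq ?_)
    (le_dimH_of_hausdorffMeasure_ne_zero (d := ⟨(1 - ε) * c.delta - ε, hs.le⟩) ?_)
  · rw [ENNReal.ofReal, Real.toNNReal_of_nonneg hs.le]; rfl
  · refine hausdorffMeasure_ne_zero_of_ball_bound MeasurableSet.univ hs hD hρ₀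
      (fun x _ => hb x) ?_
    rw [inter_univ]
    intro h0
    have := Measure.le_map_apply (DiagIFS.measurable_coding hV).aemeasurable
      (μ := (prodMeasure (unitAvg c.r)).restrict K) Φ.limitSet
    rw [h0, show Φ.coding ⁻¹' Φ.limitSet = univ from eq_univ_of_forall fun ω => Φ.coding_mem ω,
      Measure.restrict_apply_univ] at this
    exact hK (nonpos_iff_eq_zero.mp this)

theorem isPath_const {p : Φ.Symb → ℝ} (hp : IsProbVec p) : IsPath Φ fun _ => p :=
  ⟨fun _ _ => hp, continuousOn_const⟩

theorem chiInt_const (p : Φ.Symb → ℝ) (i : Fin d) {x : ℝ} (hx : 0 ≤ x) :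
    chiInt Φ (fun _ => p) i x = x * Φ.chi i p := by
  simp [chiInt, hx]

theorem deltaRB_const (hV : Φ.Valid) {p : Φ.Symb → ℝ} (hp : IsProbVec p) {B : ℝ} (hB : 0 < B) :
    deltaRB Φ (fun _ => p) B = deltaP Φ p := by
  obtain ⟨c, C, hc, -, h⟩ := DiagIFS.exists_lexp_bounds hV
  have h1 := deltaRB_scale hc h (isPath_const hp) zero_le_one hB
  rw [mul_one] at h1
  have h2 : ∀ i, Bcoord Φ (fun _ => p) 1 i = (Φ.chi i p)⁻¹ := fun i => by
    have h3 := hc.trans_le (DiagIFS.chi_bounds h hp i).1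
    refine bcoord_eq_of_chiInt_eq hc h (isPath_const hp) i (by positivity) ?_
    rw [chiInt_const p i (by positivity), inv_mul_cancel₀ h3.ne']
  rw [← h1, deltaRB, deltaP]
  simp only [h2, inv_one, one_mul]

theorem map_shift_prodMeasure {p : Φ.Symb → ℝ} (hp : IsProbVec p) :
    (prodMeasure fun _ => p).map shift = prodMeasure (α := Φ.Symb) fun _ => p := by
  have hpv := isProbabilityMeasure_vecMeasure hp
  have hsh : Measurable (shift : (ℕ → Φ.Symb) → ℕ → Φ.Symb) :=
    measurable_pi_iff.mpr fun n => measurable_pi_apply (n + 1)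
  refine Measure.eq_infinitePi (fun _ => vecMeasure p) fun s t ht => ?_
  rw [Measure.map_apply hsh (MeasurableSet.pi s.countable_toSet fun i _ => ht i)]
  have : shift ⁻¹' (s : Set ℕ).pi t =
      ((s.map (addRightEmbedding 1) : Finset ℕ) : Set ℕ).pi fun n => t (n - 1) := by
    ext ω
    simp [Set.mem_pi, shift]
  rw [this, prodMeasure, Measure.infinitePi_pi _ fun i _ => ht _, Finset.prod_map]
  simp

theorem deltaP_nonneg {p : Φ.Symb → ℝ} (hp : IsProbVec p) : 0 ≤ deltaP Φ p :=
  setIntegral_nonneg measurableSet_Ioi fun _ _ => Φ.entropy_nonneg _ hp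

theorem deltaP_le_dynDim (hV : Φ.Valid) {p : Φ.Symb → ℝ} (hp : IsProbVec p) (hg : Φ.GoodVec p) :
    ENNReal.ofReal (deltaP Φ p) ≤ Φ.dynDim := by
  have havg : unitAvg (fun _ : ℝ => p) = fun _ => p := by
    funext k a
    simp [unitAvg]
  have hprob := isProbabilityMeasure_prodMeasure fun _ : ℕ => hp
  refine le_trans ?_ (le_sSup ⟨prodMeasure fun _ => p, hprob, map_shift_prodMeasure hp, rfl⟩)
  refine ofReal_le_of_forall_eps fun ε hε hε1 hs => ?_
  obtain ⟨K, D, ρ₀, hKm, hK, hD, hρ₀, hb⟩ := exists_ball_bound_of_path hV (isPath_const hp)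
    (fun B hB => by
      convert hg using 2 with a
      simp [hB.le, hB.ne'])
    (deltaP_nonneg hp) (fun B hB => (deltaRB_const hV hp (zero_lt_one.trans_le hB)).ge) hε hε1 hs.le
  rw [havg] at hK hb
  have hmc := DiagIFS.measurable_coding hV
  have := Measure.isProbabilityMeasure_map (μ := prodMeasure fun _ => p) hmc.aemeasurable
  refine le_measDim_of_restrict (Measure.map_mono Measure.restrict_le_self hmc) ?_ hD hρ₀ hb
  rw [Measure.map_apply hmc MeasurableSet.univ, preimage_univ, Measure.restrict_apply_univ]
  exact hK

end

section

/-- Lengths of consecutive blocks: `N` blocks of each length `2 ^ m`. -/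
def blockLen (N j : ℕ) : ℕ := 2 ^ (j / N)

/-- Starting position of the `j`-th block. -/
def blockStart (N j : ℕ) : ℕ := ∑ l ∈ Finset.range j, blockLen N l

/-- The starting positions shifted by `N`, which makes them exactly scale invariant. -/
def blockTime (N j : ℕ) : ℕ := N + blockStart N j

theorem blockLen_pos (N j : ℕ) : 0 < blockLen N j := by unfold blockLen; positivity

theorem blockStart_succ (N j : ℕ) : blockStart N (j + 1) = blockStart N j + blockLen N j :=
  Finset.sum_range_succ _ _

theorem blockTime_succ (N j : ℕ) : blockTime N (j + 1) = blockTime N j + blockLen N j := by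
  rw [blockTime, blockTime, blockStart_succ, add_assoc]

theorem blockLen_add {N : ℕ} (hN : 0 < N) (j : ℕ) : blockLen N (j + N) = 2 * blockLen N j := by
  rw [blockLen, blockLen, Nat.add_div_right _ hN, pow_succ, mul_comm]

theorem blockTime_add {N : ℕ} (hN : 0 < N) (j : ℕ) :
    blockTime N (j + N) = 2 * blockTime N j := by
  induction j with
  | zero =>
    have : ∀ k ≤ N, blockTime N k = N + k := by
      intro k
      induction k with
      | zero => intro _; simp [blockTime, blockStart]
      | succ k ih =>
        intro hk
        rw [blockTime_succ, ih (by omega), blockLen, Nat.div_eq_of_lt (by omega)]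
        ring
    rw [this 0 (by omega), zero_add, this N le_rfl]
    ring
  | succ j ih =>
    rw [show j + 1 + N = (j + N) + 1 by ring, blockTime_succ, ih, blockLen_add hN, blockTime_succ]
    ring

theorem blockTime_add_mul {N : ℕ} (hN : 0 < N) (j g : ℕ) :
    blockTime N (j + g * N) = 2 ^ g * blockTime N j := by
  induction g with
  | zero => simp
  | succ g ih =>
    rw [show j + (g + 1) * N = (j + g * N) + N by ring, blockTime_add hN, ih]
    ring

theorem blockTime_strictMono (N : ℕ) : StrictMono (blockTime N) :=
  strictMono_nat_of_lt_succ fun j => by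
    rw [blockTime_succ]
    exact Nat.lt_add_of_pos_right (blockLen_pos N j)

theorem blockTime_mono (N : ℕ) : Monotone (blockTime N) := (blockTime_strictMono N).monotone

theorem le_blockTime (N j : ℕ) : N ≤ blockTime N j := Nat.le_add_right _ _

theorem mul_blockLen_le {N : ℕ} (hN : 0 < N) (j : ℕ) : N * blockLen N j ≤ blockTime N j := by
  have h1 := blockTime_add_mul hN 0 (j / N)
  have h2 : blockTime N (0 + j / N * N) ≤ blockTime N j :=
    blockTime_mono N (by rw [zero_add]; exact Nat.div_mul_le_self j N)
  rw [h1] at h2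
  have h3 : blockTime N 0 = N := by simp [blockTime, blockStart]
  rw [h3] at h2
  rw [blockLen, mul_comm]
  exact h2

theorem exists_block {N k j : ℕ} (hk : k < blockStart N j) :
    ∃ l < j, ∃ x < blockLen N l, k = blockStart N l + x := by
  induction j with
  | zero => simp [blockStart] at hk
  | succ j ih =>
    by_cases h : k < blockStart N j
    · obtain ⟨l, hl, x, hx⟩ := ih h
      exact ⟨l, by omega, x, hx⟩
    · rw [blockStart_succ] at hk
      exact ⟨j, by omega, k - blockStart N j, by omega, by omega⟩

theorem sum_blocks {M : Type*} [AddCommMonoid M] (N j : ℕ) (f : ℕ → M) :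
    ∑ k ∈ Finset.range (blockStart N j), f k =
      ∑ l ∈ Finset.range j, ∑ x ∈ Finset.range (blockLen N l), f (blockStart N l + x) := by
  induction j with
  | zero => simp [blockStart]
  | succ j ih => rw [blockStart_succ, Finset.sum_range_add, ih, Finset.sum_range_succ]

theorem eventually_sq_le_blockTime {N : ℕ} (hN : 0 < N) (K : ℝ) {ε : ℝ} (hε : 0 < ε) :
    ∀ᶠ J : ℕ in atTop, K * ((J : ℝ) + 1) ^ 2 ≤ ε * blockTime N J := by
  have h1 : Tendsto (fun m : ℕ => (m : ℝ) ^ 3 / 2 ^ m) atTop (𝓝 0) :=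
    tendsto_pow_const_div_const_pow_of_one_lt 3 one_lt_two
  have h2 : Tendsto (fun J : ℕ => J / N) atTop atTop := Nat.tendsto_div_const_atTop hN.ne'
  have h3 : ∀ᶠ m : ℕ in atTop, (m : ℝ) ^ 3 ≤ 2 ^ m := by
    filter_upwards [h1.eventually (gt_mem_nhds one_pos)] with m hm
    rw [div_lt_one (by positivity)] at hm
    exact hm.le
  obtain ⟨R, hR⟩ := exists_nat_gt (|K| * (3 * N) ^ 2 / ε)
  filter_upwards [h2.eventually h3, h2.eventually (eventually_ge_atTop (R + 1))] with J hJ hJR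
  set m := J / N with hm
  have h4 : (J : ℝ) + 1 ≤ 3 * N * m := by
    have h5 : J < N * (m + 1) := Nat.lt_mul_div_succ J hN
    have h6 : J + 1 ≤ 3 * N * m := by nlinarith
    exact_mod_cast h6
  have h7 : (2 : ℝ) ^ m ≤ blockTime N J := by
    have := mul_blockLen_le hN J
    have h8 : 2 ^ m ≤ blockTime N J := by
      refine le_trans ?_ this
      rw [blockLen]
      exact Nat.le_mul_of_pos_left _ hN
    exact_mod_cast h8
  have hmR : (R : ℝ) ≤ m := by exact_mod_cast (by omega : R ≤ m)
  have hb : |K| * (3 * N) ^ 2 ≤ ε * m := by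
    rw [div_lt_iff₀ hε] at hR
    nlinarith
  calc K * ((J : ℝ) + 1) ^ 2 ≤ |K| * (3 * N * m) ^ 2 := by
        gcongr
        exact le_abs_self K
    _ = |K| * (3 * N) ^ 2 * (m : ℝ) ^ 2 := by ring
    _ ≤ ε * m * (m : ℝ) ^ 2 := by gcongr
    _ = ε * (m : ℝ) ^ 3 := by ring
    _ ≤ ε * blockTime N J := by gcongr; exact hJ.trans h7

end

section

namespace DiagIFS

/-- Empirical frequencies of the symbols of `ω` in the `j`-th block. -/
noncomputable def freq (Φ : DiagIFS d A) (N : ℕ) (ω : ℕ → Φ.Symb) (j : ℕ) (a : Φ.Symb) : ℝ :=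
  ((Finset.range (blockLen N j)).filter fun x => ω (blockStart N j + x) = a).card / blockLen N j

/-- Coordinates in which the cylinder of `ω` up to the `j`-th block is still wider than
`exp (-blockTime N J)`. -/
noncomputable def active (Φ : DiagIFS d A) (N : ℕ) (ω : ℕ → Φ.Symb) (J j : ℕ) : Finset (Fin d) :=
  Finset.univ.filter fun i => Φ.lexpSum i (blockStart N j) ω < blockTime N J

/-- The empirical entropy needed to describe `π ω` up to precision `exp (-blockTime N J)`. -/
noncomputable def blockEntropy (Φ : DiagIFS d A) (N g : ℕ) (ω : ℕ → Φ.Symb) (J : ℕ) : ℝ :=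
  ∑ j ∈ Finset.range (J + g * N),
    blockLen N j * Φ.entropy (Φ.active N ω J j) (Φ.freq N ω j)

variable {Φ : DiagIFS d A}

theorem sum_block_eq (N : ℕ) (ω : ℕ → Φ.Symb) (j : ℕ) (f : Φ.Symb → ℝ) :
    ∑ x ∈ Finset.range (blockLen N j), f (ω (blockStart N j + x)) =
      blockLen N j * ∑ a, Φ.freq N ω j a * f a := by
  have hl : (blockLen N j : ℝ) ≠ 0 := by exact_mod_cast (blockLen_pos N j).ne'
  rw [← Finset.sum_fiberwise (Finset.range (blockLen N j))
    (fun x => ω (blockStart N j + x)) (fun x => f (ω (blockStart N j + x))), Finset.mul_sum]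
  refine Finset.sum_congr rfl fun a _ => ?_
  rw [freq, Finset.sum_congr rfl (g := fun _ => f a)
    (fun x hx => by rw [(Finset.mem_filter.mp hx).2]), Finset.sum_const, nsmul_eq_mul]
  field_simp

theorem isProbVec_freq (N : ℕ) (ω : ℕ → Φ.Symb) (j : ℕ) : IsProbVec (Φ.freq N ω j) := by
  refine ⟨fun a => by unfold freq; positivity, ?_⟩
  have hl : (blockLen N j : ℝ) ≠ 0 := by exact_mod_cast (blockLen_pos N j).ne'
  have h := sum_block_eq N ω j fun _ => 1
  simp only [Finset.sum_const, Finset.card_range, nsmul_eq_mul, mul_one] at h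
  exact mul_left_cancel₀ hl (by rw [← h, mul_one])

theorem lexpSum_blockStart (N : ℕ) (ω : ℕ → Φ.Symb) (i : Fin d) (j : ℕ) :
    Φ.lexpSum i (blockStart N j) ω =
      ∑ l ∈ Finset.range j, blockLen N l * Φ.chi i (Φ.freq N ω l) := by
  rw [lexpSum, sum_blocks]
  refine Finset.sum_congr rfl fun l _ => ?_
  rw [sum_block_eq N ω l (Φ.lexp i), chi_eq]

theorem freq_pos (N : ℕ) (ω : ℕ → Φ.Symb) (j : ℕ) {x : ℕ} (hx : x < blockLen N j) :
    0 < Φ.freq N ω j (ω (blockStart N j + x)) := by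
  have h1 : 0 < ((Finset.range (blockLen N j)).filter
      fun y => ω (blockStart N j + y) = ω (blockStart N j + x)).card :=
    Finset.card_pos.mpr ⟨x, by simp [hx]⟩
  have h2 := blockLen_pos N j
  unfold freq
  positivity

theorem prod_block_eq (N : ℕ) (ω : ℕ → Φ.Symb) (j : ℕ) (I : Finset (Fin d)) :
    ∏ x : Fin (blockLen N j),
        Φ.projMass I (Φ.freq N ω j) (proj I (ω (blockStart N j + x)).1) =
      Real.exp (-(blockLen N j * Φ.entropy I (Φ.freq N ω j))) := by
  rw [Finset.prod_range (f := fun x : ℕ =>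
    Φ.projMass I (Φ.freq N ω j) (proj I (ω (blockStart N j + x)).1)) |>.symm]
  have h1 : ∀ x ∈ Finset.range (blockLen N j),
      Φ.projMass I (Φ.freq N ω j) (proj I (ω (blockStart N j + x)).1) =
        Real.exp (Real.log (Φ.cylMass I (Φ.freq N ω j) (ω (blockStart N j + x)))) := by
    intro x hx
    rw [← cylMass_eq, Real.exp_log]
    exact (freq_pos N ω j (Finset.mem_range.mp hx)).trans_le
      (le_cylMass Φ I (isProbVec_freq N ω j).1 _)
  rw [Finset.prod_congr rfl h1, ← Real.exp_sum,
    sum_block_eq N ω j fun a => Real.log (Φ.cylMass I (Φ.freq N ω j) a), entropy]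
  congr 1
  ring

/-- Combinatorial data describing `ω` at level `J`: active coordinates, symbol counts and
projected words. -/
abbrev Key (Φ : DiagIFS d A) (N n : ℕ) : Type _ :=
  (Fin n → Finset (Fin d) × (Φ.Symb → Fin (2 ^ n + 1))) ×
    ((Σ j : Fin n, Fin (blockLen N j)) → ∀ i, Option (A i))

theorem count_lt {N n : ℕ} (ω : ℕ → Φ.Symb) (j : Fin n) (a : Φ.Symb) :
    ((Finset.range (blockLen N j)).filter fun x => ω (blockStart N j + x) = a).card
      < 2 ^ n + 1 := by
  refine Nat.lt_succ_of_le ((Finset.card_filter_le _ _).trans ?_)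
  rw [Finset.card_range]
  exact Nat.pow_le_pow_right two_pos ((Nat.div_le_self _ _).trans j.2.le)

/-- The key of `ω` at level `J`, recorded over the first `n` blocks. -/
noncomputable def key (Φ : DiagIFS d A) (N n J : ℕ) (ω : ℕ → Φ.Symb) : Φ.Key N n :=
  (fun j => (Φ.active N ω J j, fun a => ⟨_, count_lt (N := N) ω j a⟩),
    fun p => proj (Φ.active N ω J p.1) (ω (blockStart N p.1 + p.2)).1)

/-- The weight of a key: the probability of its words under the product of its frequencies. -/
noncomputable def weight (Φ : DiagIFS d A) (N n : ℕ) (κ : Φ.Key N n) : ℝ :=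
  ∏ p : Σ j : Fin n, Fin (blockLen N j),
    Φ.projMass (κ.1 p.1).1 (fun a => ((κ.1 p.1).2 a : ℕ) / (blockLen N p.1 : ℝ)) (κ.2 p)

theorem weight_key (N n J : ℕ) (ω : ℕ → Φ.Symb) :
    Φ.weight N n (Φ.key N n J ω) = Real.exp (-∑ j ∈ Finset.range n,
      blockLen N j * Φ.entropy (Φ.active N ω J j) (Φ.freq N ω j)) := by
  rw [weight, Fintype.prod_sigma, ← Finset.sum_neg_distrib, Real.exp_sum, Finset.prod_range]
  exact Finset.prod_congr rfl fun j _ => prod_block_eq N ω j (Φ.active N ω J j)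

theorem weight_nonneg (N n : ℕ) (κ : Φ.Key N n) : 0 ≤ Φ.weight N n κ := by
  refine Finset.prod_nonneg fun p _ => ?_
  unfold projMass
  refine Finset.sum_nonneg fun a _ => ?_
  split_ifs
  · positivity
  · exact le_rfl

theorem sum_weight_key (N n J : ℕ) (ω : ℕ → Φ.Symb) :
    ∑ w, Φ.weight N n ((Φ.key N n J ω).1, w) = 1 := by
  unfold weight
  rw [← Fintype.prod_sum (f := fun (p : Σ j : Fin n, Fin (blockLen N j)) v =>
    Φ.projMass ((Φ.key N n J ω).1 p.1).1
      (fun a => (((Φ.key N n J ω).1 p.1).2 a : ℕ) / (blockLen N p.1 : ℝ)) v)]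
  refine Finset.prod_eq_one fun p _ => ?_
  rw [sum_projMass]
  exact (isProbVec_freq N ω p.1).2

theorem card_keys_le (N g J : ℕ) {G : Set (ℕ → Φ.Symb)} {B : ℝ}
    (hG : ∀ ω ∈ G, Φ.blockEntropy N g ω J ≤ B) :
    ((Finset.univ.filter fun κ => ∃ ω ∈ G, Φ.key N (J + g * N) J ω = κ).card : ℝ) ≤
      Fintype.card (Fin (J + g * N) → Finset (Fin d) × (Φ.Symb → Fin (2 ^ (J + g * N) + 1))) *
        Real.exp B := by
  set n := J + g * N with hn
  set K := Finset.univ.filter fun κ => ∃ ω ∈ G, Φ.key N n J ω = κ with hK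
  have h1 : (K.card : ℝ) * Real.exp (-B) ≤ ∑ κ ∈ K, Φ.weight N n κ := by
    rw [← nsmul_eq_mul, ← Finset.sum_const]
    refine Finset.sum_le_sum fun κ hκ => ?_
    obtain ⟨ω, hω, rfl⟩ := (Finset.mem_filter.mp hκ).2
    rw [weight_key, Real.exp_le_exp]
    exact neg_le_neg (hG ω hω)
  have h2 : ∑ κ ∈ K, Φ.weight N n κ ≤ ∑ θ ∈ K.image Prod.fst, ∑ w, Φ.weight N n (θ, w) := by
    rw [← Finset.sum_product']
    refine Finset.sum_le_sum_of_subset_of_nonneg (fun κ hκ => ?_) fun κ _ _ => weight_nonneg N n κ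
    exact Finset.mem_product.mpr ⟨Finset.mem_image_of_mem _ hκ, Finset.mem_univ _⟩
  have h3 : ∑ θ ∈ K.image Prod.fst, ∑ w, Φ.weight N n (θ, w) = (K.image Prod.fst).card := by
    rw [Finset.sum_congr rfl (g := fun _ => (1 : ℝ)), Finset.sum_const, nsmul_eq_mul, mul_one]
    intro θ hθ
    obtain ⟨κ, hκ, rfl⟩ := Finset.mem_image.mp hθ
    obtain ⟨ω, -, rfl⟩ := (Finset.mem_filter.mp hκ).2
    exact sum_weight_key N n J ω
  have h4 : ((K.image Prod.fst).card : ℝ) ≤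
      Fintype.card (Fin n → Finset (Fin d) × (Φ.Symb → Fin (2 ^ n + 1))) := by
    exact_mod_cast Finset.card_le_univ _
  have h5 : (K.card : ℝ) * Real.exp (-B) ≤ _ := h1.trans (h2.trans (h3.le.trans h4))
  rw [Real.exp_neg, ← div_eq_mul_inv, div_le_iff₀ (Real.exp_pos _)] at h5
  exact h5

theorem card_types_le (Φ : DiagIFS d A) (n : ℕ) :
    (Fintype.card (Fin n → Finset (Fin d) × (Φ.Symb → Fin (2 ^ n + 1))) : ℝ) ≤
      Real.exp ((d + Fintype.card Φ.Symb) * (n + 1 : ℝ) ^ 2) := by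
  have h2 : (2 : ℝ) ≤ Real.exp 1 := by
    have := Real.add_one_le_exp (1 : ℝ); linarith
  have h3 : ((2 : ℝ) ^ n + 1) ≤ Real.exp (n + 1) := by
    have h4 : (2 : ℝ) ^ n + 1 ≤ 2 ^ (n + 1) := by
      have := one_le_pow₀ (n := n) (one_le_two : (1 : ℝ) ≤ 2)
      rw [pow_succ]; linarith
    refine h4.trans ?_
    calc (2 : ℝ) ^ (n + 1) ≤ Real.exp 1 ^ (n + 1) := by gcongr
      _ = Real.exp (n + 1) := by rw [← Real.exp_nat_mul]; push_cast; ring_nf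
  have h5 : ((2 : ℝ) ^ d) ≤ Real.exp d := by
    calc (2 : ℝ) ^ d ≤ Real.exp 1 ^ d := by gcongr
      _ = Real.exp d := by rw [← Real.exp_nat_mul]; ring_nf
  simp only [Fintype.card_fun, Fintype.card_prod, Fintype.card_finset, Fintype.card_fin]
  push_cast
  calc ((2 : ℝ) ^ d * (2 ^ n + 1) ^ Fintype.card Φ.Symb) ^ n
      ≤ (Real.exp d * Real.exp (n + 1) ^ Fintype.card Φ.Symb) ^ n := by gcongr
    _ = Real.exp (n * (d + Fintype.card Φ.Symb * (n + 1))) := by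
        rw [← Real.exp_nat_mul, ← Real.exp_add, ← Real.exp_nat_mul]
    _ ≤ _ := by
        rw [Real.exp_le_exp]
        have hn : (0 : ℝ) ≤ n := Nat.cast_nonneg n
        have hd : (0 : ℝ) ≤ d := Nat.cast_nonneg d
        have hc : (0 : ℝ) ≤ Fintype.card Φ.Symb := Nat.cast_nonneg _
        have : (n : ℝ) * (d + Fintype.card Φ.Symb * (n + 1)) ≤
          (n + 1) * (d * (n + 1) + Fintype.card Φ.Symb * (n + 1)) := by
          gcongr <;> nlinarith
        linarith

theorem dist_coding_le_of_key_eq (hV : Φ.Valid) {c C : ℝ}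
    (h : ∀ i a, c ≤ Φ.lexp i a ∧ Φ.lexp i a ≤ C) {N g : ℕ} (hN : 0 < N)
    (hg : 1 ≤ c * (2 ^ g - 1)) (hc : 0 < c) {J : ℕ} {ω τ : ℕ → Φ.Symb}
    (hk : Φ.key N (J + g * N) J ω = Φ.key N (J + g * N) J τ) :
    dist (Φ.coding ω) (Φ.coding τ) ≤ Real.exp (-blockTime N J) := by
  rw [dist_pi_le_iff (Real.exp_pos _).le]
  intro i
  have hlast : (blockTime N J : ℝ) ≤ Φ.lexpSum i (blockStart N (J + g * N)) ω := by
    refine le_trans ?_ (lexpSum_ge h i _ ω)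
    have h1 := blockTime_add_mul hN J g
    have h2 : (N : ℝ) + blockStart N (J + g * N) = 2 ^ g * blockTime N J := by
      exact_mod_cast h1
    have h3 : (N : ℝ) ≤ blockTime N J := by exact_mod_cast le_blockTime N J
    have h4 : (0 : ℝ) ≤ blockTime N J := Nat.cast_nonneg _
    nlinarith
  have hex : ∃ j, (blockTime N J : ℝ) ≤ Φ.lexpSum i (blockStart N j) ω := ⟨_, hlast⟩
  set m := Nat.find hex with hm
  have hm1 : (blockTime N J : ℝ) ≤ Φ.lexpSum i (blockStart N m) ω := Nat.find_spec hex
  have hm2 : m ≤ J + g * N := Nat.find_min' hex hlast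
  rw [Real.dist_eq]
  refine (abs_coding_sub_le hV (n := blockStart N m) (ω := ω) (τ := τ) fun k hkm => ?_).trans
    (Real.exp_le_exp.mpr (neg_le_neg hm1))
  obtain ⟨l, hl, x, hx, rfl⟩ := exists_block hkm
  have hact : i ∈ Φ.active N ω J l :=
    Finset.mem_filter.mpr ⟨Finset.mem_univ i, not_le.mp (Nat.find_min hex hl)⟩
  have e1 : Φ.active N ω J l = Φ.active N τ J l :=
    congrArg (fun κ : Φ.Key N (J + g * N) => (κ.1 ⟨l, by omega⟩).1) hk
  have e2 : proj (Φ.active N ω J l) (ω (blockStart N l + x)).1 =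
      proj (Φ.active N τ J l) (τ (blockStart N l + x)).1 :=
    congrArg (fun κ : Φ.Key N (J + g * N) => κ.2 ⟨⟨l, by omega⟩, ⟨x, hx⟩⟩) hk
  rw [← e1] at e2
  exact proj_eq_iff.mp e2 i hact

end DiagIFS

end

section

namespace DiagIFS

variable {Φ : DiagIFS d A}

theorem card_keys_mul_le {N g : ℕ} (hN : 0 < N) {s s' : ℝ} (hss : s < s') :
    ∀ᶠ J : ℕ in atTop,
      ((Finset.univ.filter fun κ => ∃ ω ∈ {ω | Φ.blockEntropy N g ω J ≤ s * blockTime N J},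
        Φ.key N (J + g * N) J ω = κ).card : ℝ) * Real.exp (-(s' * blockTime N J)) ≤
        Real.exp (-J) := by
  filter_upwards [eventually_sq_le_blockTime hN
    (((d : ℝ) + Fintype.card Φ.Symb) * (1 + g * N) ^ 2 + 1) (sub_pos.mpr hss)] with J hJ
  have h1 := card_keys_le (Φ := Φ) N g J
    (G := {ω | Φ.blockEntropy N g ω J ≤ s * blockTime N J}) fun ω hω => hω
  have h2 := card_types_le Φ (J + g * N)
  have h3 : ((d : ℝ) + Fintype.card Φ.Symb) * (((J + g * N : ℕ) : ℝ) + 1) ^ 2 ≤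
      ((d : ℝ) + Fintype.card Φ.Symb) * ((1 + g * N) ^ 2 * (J + 1) ^ 2) := by
    have h4 : ((J + g * N : ℕ) : ℝ) + 1 ≤ (1 + g * N) * (J + 1) := by
      have : (0 : ℝ) ≤ (g : ℝ) * N * J := by positivity
      push_cast
      nlinarith
    rw [← mul_pow]
    gcongr
  have h5 : (J : ℝ) ≤ ((J : ℝ) + 1) ^ 2 := by
    have : (0 : ℝ) ≤ J := Nat.cast_nonneg J
    nlinarith
  calc _ ≤ Real.exp (((d : ℝ) + Fintype.card Φ.Symb) * (((J + g * N : ℕ) : ℝ) + 1) ^ 2) *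
        Real.exp (s * blockTime N J) * Real.exp (-(s' * blockTime N J)) := by
        gcongr
        exact h1.trans (by gcongr)
    _ ≤ _ := by
        rw [← Real.exp_add, ← Real.exp_add, Real.exp_le_exp]
        nlinarith

theorem dimH_image_frequently_le (hV : Φ.Valid) {c C : ℝ} (hc : 0 < c)
    (h : ∀ i a, c ≤ Φ.lexp i a ∧ Φ.lexp i a ≤ C) {N g : ℕ} (hN : 0 < N)
    (hg : 1 ≤ c * (2 ^ g - 1)) {s : ℝ} (hs : 0 ≤ s) :
    dimH (Φ.coding '' {ω | ∃ᶠ J in atTop, Φ.blockEntropy N g ω J ≤ s * blockTime N J}) ≤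
      ENNReal.ofReal s := by
  refine le_of_forall_gt_imp_ge_of_dense fun a ha => ?_
  obtain ⟨s', hss', hsa⟩ := ENNReal.lt_iff_exists_nnreal_btwn.mp ha
  refine le_trans ?_ hsa.le
  have hss : s < s' := by
    rwa [← ENNReal.ofReal_coe_nnreal, ENNReal.ofReal_lt_ofReal_iff_of_nonneg hs] at hss'
  have hs' : (0 : ℝ) < s' := hs.trans_lt hss
  refine dimH_le_of_hausdorffMeasure_ne_top ?_
  set S : ℕ → Set (ℕ → Φ.Symb) :=
    fun J => {ω | Φ.blockEntropy N g ω J ≤ s * blockTime N J} with hS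
  set U : ℕ → (Σ J, Φ.Key N (J + g * N)) → Set (Fin d → ℝ) := fun n p =>
    if n ≤ p.1 then Φ.coding '' {ω ∈ S p.1 | Φ.key N (p.1 + g * N) p.1 ω = p.2} else ∅ with hU
  have hdiam : ∀ n p, ediam (U n p) ≤ ENNReal.ofReal (Real.exp (-blockTime N p.1)) := by
    intro n p
    simp only [hU]
    split_ifs with hn
    · refine ediam_le ?_
      rintro _ ⟨ω, ⟨-, hω⟩, rfl⟩ _ ⟨τ, ⟨-, hτ⟩, rfl⟩
      rw [edist_dist]
      exact ENNReal.ofReal_le_ofReal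
        (dist_coding_le_of_key_eq hV h hN hg hc (hω.trans hτ.symm))
    · simp
  have hlim : Tendsto (fun n : ℕ => ENNReal.ofReal (Real.exp (-n))) atTop (𝓝 0) := by
    rw [← ENNReal.ofReal_zero]
    exact ENNReal.tendsto_ofReal
      (Real.tendsto_exp_neg_atTop_nhds_zero.comp tendsto_natCast_atTop_atTop)
  have : ∀ J, Countable (Φ.Key N (J + g * N)) := fun J => Finite.to_countable
  have : Countable (Σ J, Φ.Key N (J + g * N)) := inferInstance
  have hle := Measure.hausdorffMeasure_le_liminf_tsum (s' : ℝ)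
    (Φ.coding '' {ω | ∃ᶠ J in atTop, ω ∈ S J}) _ hlim U
    (Eventually.of_forall fun n p => by
      by_cases hn : n ≤ p.1
      · refine (hdiam n p).trans (ENNReal.ofReal_le_ofReal (Real.exp_le_exp.mpr (neg_le_neg ?_)))
        exact_mod_cast hn.trans ((blockTime_strictMono N).le_apply)
      · simp [hU, hn])
    (Eventually.of_forall fun n => by
      rintro _ ⟨ω, hω, rfl⟩
      obtain ⟨J, hJ, hJS⟩ := (frequently_atTop.mp hω) n
      refine mem_iUnion.mpr ⟨⟨J, Φ.key N (J + g * N) J ω⟩, ?_⟩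
      simp only [hU, if_pos hJ]
      exact ⟨ω, ⟨hJS, rfl⟩, rfl⟩)
  refine (hle.trans_lt ?_).ne
  obtain ⟨n₀, hn₀⟩ := eventually_atTop.mp (card_keys_mul_le (Φ := Φ) (g := g) hN hss)
  have hfin : ∑' J : ℕ, ENNReal.ofReal (Real.exp (-J)) < ∞ := by
    have hsum : Summable fun J : ℕ => Real.exp (-(J : ℝ)) := Real.summable_exp_neg_nat
    rw [← ENNReal.ofReal_tsum_of_nonneg (fun _ => (Real.exp_pos _).le) hsum]
    exact ENNReal.ofReal_lt_top
  refine lt_of_le_of_lt (liminf_le_of_frequently_le' (Eventually.frequently ?_)) hfin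
  filter_upwards [eventually_ge_atTop n₀] with n hn
  rw [ENNReal.tsum_sigma']
  refine ENNReal.tsum_le_tsum fun J => ?_
  by_cases hnJ : n ≤ J
  swap
  · simp [hU, hnJ, hs']
  set K := Finset.univ.filter fun κ => ∃ ω ∈ S J, Φ.key N (J + g * N) J ω = κ with hK
  have hpt : ∀ κ, ediam (U n ⟨J, κ⟩) ^ (s' : ℝ) ≤
      if κ ∈ K then ENNReal.ofReal (Real.exp (-(s' * blockTime N J))) else 0 := by
    intro κ
    split_ifs with hκ
    · refine (ENNReal.rpow_le_rpow (hdiam n ⟨J, κ⟩) hs'.le).trans ?_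
      rw [ENNReal.ofReal_rpow_of_pos (Real.exp_pos _), ← Real.exp_mul]
      exact ENNReal.ofReal_le_ofReal (Real.exp_le_exp.mpr (by simp only; linarith))
    · have : U n ⟨J, κ⟩ = ∅ := by
        simp only [hU, if_pos hnJ, image_eq_empty]
        refine eq_empty_of_forall_notMem fun ω hω => hκ ?_
        exact Finset.mem_filter.mpr ⟨Finset.mem_univ _, ω, hω.1, hω.2⟩
      rw [this, ediam_empty, ENNReal.zero_rpow_of_pos hs']
  rw [tsum_fintype]
  refine (Finset.sum_le_sum fun κ _ => hpt κ).trans ?_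
  simp only [Finset.sum_ite_mem, Finset.univ_inter]
  rw [Finset.sum_const, nsmul_eq_mul, ← ENNReal.ofReal_natCast, ← ENNReal.ofReal_mul (Nat.cast_nonneg _)]
  exact ENNReal.ofReal_le_ofReal (hn₀ J (hn.trans hnJ))

end DiagIFS

end

section

variable {Φ : DiagIFS d A} {r : ℝ → Φ.Symb → ℝ}

theorem setIntegral_Ioc_le_of_le_of_le {f : ℝ → ℝ} {x L θ P Q : ℝ} (hL : 0 ≤ L) (hθ : 0 ≤ θ)
    (hθ1 : θ ≤ 1) (hf : IntegrableOn f (Ioc x (x + L)))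
    (h1 : ∀ u ∈ Ioc x (x + L), u ≤ x + (1 - θ) * L → f u ≤ P)
    (h2 : ∀ u ∈ Ioc x (x + L), f u ≤ P + Q) :
    ∫ u in Ioc x (x + L), f u ≤ L * P + θ * L * Q := by
  have hθL : 0 ≤ θ * L := mul_nonneg hθ hL
  have hθL' : 0 ≤ (1 - θ) * L := mul_nonneg (by linarith) hL
  have e : Ioc x (x + L) = Ioc x (x + (1 - θ) * L) ∪ Ioc (x + (1 - θ) * L) (x + L) :=
    (Ioc_union_Ioc_eq_Ioc (by linarith) (by linarith)).symm
  have s1 : Ioc x (x + (1 - θ) * L) ⊆ Ioc x (x + L) := Ioc_subset_Ioc_right (by linarith)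
  have s2 : Ioc (x + (1 - θ) * L) (x + L) ⊆ Ioc x (x + L) := Ioc_subset_Ioc_left (by linarith)
  have d1 : Disjoint (Ioc x (x + (1 - θ) * L)) (Ioc (x + (1 - θ) * L) (x + L)) :=
    Ioc_disjoint_Ioc_of_le le_rfl
  have i1 : ∫ u in Ioc x (x + (1 - θ) * L), f u ≤ ((1 - θ) * L) * P := by
    have := setIntegral_mono_on (hf.mono_set s1) (integrableOn_const (by simp) (C := P))
      measurableSet_Ioc fun u hu => h1 u (s1 hu) hu.2
    rwa [setIntegral_const, smul_eq_mul, Measure.real, Real.volume_Ioc,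
      ENNReal.toReal_ofReal (by linarith), add_sub_cancel_left] at this
  have i2 : ∫ u in Ioc (x + (1 - θ) * L) (x + L), f u ≤ (θ * L) * (P + Q) := by
    have := setIntegral_mono_on (hf.mono_set s2) (integrableOn_const (by simp) (C := P + Q))
      measurableSet_Ioc fun u hu => h2 u (s2 hu)
    rwa [setIntegral_const, smul_eq_mul, Measure.real, Real.volume_Ioc,
      ENNReal.toReal_ofReal (by linarith),
      show x + L - (x + (1 - θ) * L) = θ * L by ring] at this
  rw [e, setIntegral_union d1 measurableSet_Ioc (hf.mono_set s1) (hf.mono_set s2)]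
  linarith

theorem sum_le_setIntegral_blocks {f : ℝ → ℝ} {w : ℕ → ℝ} {N J₀ J₁ : ℕ} (hJ : J₀ ≤ J₁)
    (hf : IntegrableOn f (Ioc (blockTime N J₀ : ℝ) (blockTime N J₁)))
    (hw : ∀ j, J₀ ≤ j → j < J₁ →
      w j ≤ ∫ u in Ioc (blockTime N j : ℝ) (blockTime N (j + 1)), f u) :
    ∑ j ∈ Finset.Ico J₀ J₁, w j ≤ ∫ u in Ioc (blockTime N J₀ : ℝ) (blockTime N J₁), f u := by
  induction J₁, hJ using Nat.le_induction with
  | base => simp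
  | succ J₁ hJ ih =>
    have m1 : (blockTime N J₀ : ℝ) ≤ blockTime N J₁ := by exact_mod_cast blockTime_mono N hJ
    have m2 : (blockTime N J₁ : ℝ) ≤ blockTime N (J₁ + 1) := by
      exact_mod_cast blockTime_mono N J₁.le_succ
    have e := Ioc_union_Ioc_eq_Ioc m1 m2
    rw [← e] at hf ⊢
    rw [setIntegral_union (Ioc_disjoint_Ioc_of_le le_rfl) measurableSet_Ioc
      (hf.mono_set subset_union_left) (hf.mono_set subset_union_right),
      Finset.sum_Ico_succ_top hJ]
    exact add_le_add (ih (hf.mono_set subset_union_left) fun j h1 h2 => hw j h1 (by omega))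
      (hw J₁ hJ (by omega))

variable {c C : ℝ} (hc : 0 < c) (h : ∀ i a, c ≤ Φ.lexp i a ∧ Φ.lexp i a ≤ C) (hr : IsPath Φ r)

include hc h hr in
theorem chiInt_blockTime_le (hC : 0 ≤ C) {N : ℕ} {ω : ℕ → Φ.Symb} {θ ε' : ℝ} (hθ : 0 ≤ θ) (hθ1 : θ ≤ 1)
    {J₀ J₁ : ℕ}
    (hq : ∀ l, J₀ ≤ l → l < J₁ → ∀ b : ℝ, blockTime N l ≤ b →
      b ≤ blockTime N l + (1 - θ) * blockLen N l → ∀ a, |r b a - Φ.freq N ω l a| ≤ ε')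
    (i : Fin d) {j : ℕ} (hj : J₀ ≤ j) (hj1 : j ≤ J₁) :
    chiInt Φ r i (blockTime N j) ≤ C * blockTime N J₀ + Φ.lexpSum i (blockStart N j) ω +
      (Fintype.card Φ.Symb * (C * ε') + θ * C) * (blockTime N j - blockTime N J₀) := by
  induction j, hj using Nat.le_induction with
  | base =>
    have h1 := (chiInt_sub_bounds hc h hr i le_rfl
      (Nat.cast_nonneg (α := ℝ) (blockTime N J₀))).2
    rw [chiInt_zero, sub_zero, sub_zero] at h1
    have h2 := DiagIFS.lexpSum_ge h i (blockStart N J₀) ω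
    have h3 : 0 ≤ c * blockStart N J₀ := by positivity
    linarith
  | succ j hj ih =>
    have ih := ih (by omega)
    have hL : (0 : ℝ) ≤ blockLen N j := Nat.cast_nonneg _
    have hb : (0 : ℝ) ≤ blockTime N j := Nat.cast_nonneg _
    have e : (blockTime N (j + 1) : ℝ) = blockTime N j + blockLen N j := by
      exact_mod_cast blockTime_succ N j
    have e2 : Φ.lexpSum i (blockStart N (j + 1)) ω = Φ.lexpSum i (blockStart N j) ω +
        blockLen N j * Φ.chi i (Φ.freq N ω j) := by
      rw [DiagIFS.lexpSum_blockStart, DiagIFS.lexpSum_blockStart, Finset.sum_range_succ]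
    have h1 := chiInt_sub hc h hr i hb (y := blockTime N (j + 1)) (by rw [e]; linarith)
    have hfreq := DiagIFS.isProbVec_freq N ω j
    have h2 := setIntegral_Ioc_le_of_le_of_le (f := fun b => Φ.chi i (r b))
      (P := Φ.chi i (Φ.freq N ω j) + Fintype.card Φ.Symb * (C * ε')) (Q := C) hL hθ hθ1
      (integrableOn_chi hc h hr i hb)
      (fun u hu hu2 => DiagIFS.chi_sub_le hc h (hq j hj (by omega) u hu.1.le hu2) i)
      (fun u hu => by
        have p1 := (DiagIFS.chi_bounds h (hr.1 u (hb.trans_lt hu.1)) i).2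
        have p2 := (DiagIFS.chi_bounds h hfreq i).1
        have p3 : 0 ≤ ε' := by
          obtain ⟨a⟩ := hfreq.nonempty
          exact (abs_nonneg _).trans (hq j hj (by omega) (blockTime N j) le_rfl
            (le_add_of_nonneg_right (mul_nonneg (by linarith) hL)) a)
        have p4 : 0 ≤ Fintype.card Φ.Symb * (C * ε') := by positivity
        linarith)
    rw [← e, ← h1] at h2
    rw [e2]
    rw [e] at h2 ⊢
    nlinarith

end

section

/-- The constant governing the comparison of empirical and path entropies. -/
noncomputable def compConst (Φ : DiagIFS d A) (c C : ℝ) (g : ℕ) : ℝ :=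
  Fintype.card Φ.Symb + (1 + Fintype.card Φ.Symb) * 2 ^ g +
    d * (Fintype.card Φ.Symb *
      ((C + (Fintype.card Φ.Symb * C + C) * 2 ^ g) / c + 2 ^ g))

theorem compConst_nonneg (Φ : DiagIFS d A) {c C : ℝ} (hc : 0 < c) (hC : 0 ≤ C) (g : ℕ) :
    0 ≤ compConst Φ c C g := by
  unfold compConst
  positivity

theorem blockEntropy_le {Φ : DiagIFS d A} {r : ℝ → Φ.Symb → ℝ} {c C : ℝ} (hc : 0 < c)
    (h : ∀ i a, c ≤ Φ.lexp i a ∧ Φ.lexp i a ≤ C) (hr : IsPath Φ r) (hC : 0 ≤ C)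
    {θ ε' : ℝ} (hθ : 0 < θ) (hθ1 : θ ≤ 1) (hεθ : ε' ≤ θ)
    (hent : ∀ I, ∀ p p' : Φ.Symb → ℝ, IsProbVec p → IsProbVec p' →
      (∀ a, |p a - p' a| ≤ ε') → |Φ.entropy I p - Φ.entropy I p'| ≤ θ)
    {N g g' : ℕ} (hN : 0 < N) (hθN : 1 ≤ θ * N) (hθg : 1 ≤ θ * 2 ^ g) {ω : ℕ → Φ.Symb} {J₀ : ℕ}
    (hq : ∀ l, J₀ ≤ l → l < J₀ + g * N + g' * N → ∀ b : ℝ, blockTime N l ≤ b →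
      b ≤ blockTime N l + (1 - θ) * blockLen N l → ∀ a, |r b a - Φ.freq N ω l a| ≤ ε') :
    Φ.blockEntropy N g' ω (J₀ + g * N) ≤ blockTime N (J₀ + g * N) *
      (deltaRB Φ r (blockTime N (J₀ + g * N)) + θ * compConst Φ c C g') := by
  set J := J₀ + g * N with hJ
  set J₁ := J + g' * N with hJ₁
  set m : ℝ := (Fintype.card Φ.Symb : ℝ) with hm
  set t : ℝ := (blockTime N J : ℝ) with ht
  set κ : ℝ := (C + (m * C + C) * 2 ^ g') / c + 2 ^ g' with hκ
  have hm0 : 0 ≤ m := Nat.cast_nonneg _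
  have ht0 : 0 < t := by
    rw [ht]
    exact_mod_cast hN.trans_le (le_blockTime N J)
  have hκ0 : 0 ≤ κ := by positivity
  have eJ : t = 2 ^ g * blockTime N J₀ := by
    rw [ht, hJ, blockTime_add_mul hN J₀ g]; push_cast; rfl
  have eJ₁ : (blockTime N J₁ : ℝ) = 2 ^ g' * t := by
    rw [ht, hJ₁, blockTime_add_mul hN J g']; push_cast; rfl
  have ht₀ : (0 : ℝ) ≤ blockTime N J₀ := Nat.cast_nonneg _
  have htJ₀ : (blockTime N J₀ : ℝ) ≤ θ * t := by rw [eJ]; nlinarith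
  have hJJ₁ : J₀ ≤ J₁ := by omega
  set β : Fin d → ℝ := fun i => Bcoord Φ r t i with hβ
  set F : ℝ → ℝ := fun u => Φ.entropy (Finset.univ.filter fun i => u ≤ β i) (r u) with hF
  set E : Fin d → ℝ → ℝ := fun i => (Ioc (β i) (β i + θ * κ * t)).indicator fun _ => m with hE
  set G : ℝ → ℝ := fun u => F u + θ + ∑ i, E i u with hG
  have hE0 : ∀ i u, 0 ≤ E i u := fun i u => indicator_nonneg (fun _ _ => hm0) u
  have hFi : IntegrableOn F (Ioi 0) := integrableOn_entropy hr β
  have hEi : ∀ i, Integrable (E i) := fun i =>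
    (integrable_indicator_iff measurableSet_Ioc).mpr (integrableOn_const (by simp))
  have hsub : ∀ x y : ℝ, 0 ≤ x → Ioc x y ⊆ Ioi 0 := fun x y hx u hu => hx.trans_lt hu.1
  have hGi : ∀ x y : ℝ, 0 ≤ x → IntegrableOn G (Ioc x y) := fun x y hx =>
    ((hFi.mono_set (hsub x y hx)).add (integrableOn_const (by simp))).add
      (integrable_finsetSum _ fun i _ => (hEi i).integrableOn)
  have hF0 : ∀ u, 0 < u → 0 ≤ F u := fun u hu => Φ.entropy_nonneg _ (hr.1 u hu)
  -- active coordinates at block `j` are still seen by the path, up to a small shift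
  have hact : ∀ j, J₀ ≤ j → j < J₁ → ∀ i ∈ Φ.active N ω J j, ∀ u : ℝ,
      u ≤ blockTime N j + blockLen N j → u ≤ β i + θ * κ * t := by
    intro j hj hj1 i hi u hu
    have hi : Φ.lexpSum i (blockStart N j) ω < t := (Finset.mem_filter.mp hi).2
    have h1 := chiInt_blockTime_le hc h hr hC hθ.le hθ1 hq i hj hj1.le
    have hj2 : (blockTime N j : ℝ) ≤ 2 ^ g' * t := by
      rw [← eJ₁]; exact_mod_cast blockTime_mono N hj1.le
    have hj3 : (0 : ℝ) ≤ blockTime N j := Nat.cast_nonneg _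
    have h2 : chiInt Φ r i (blockTime N j) ≤ t + θ * t * (C + (m * C + C) * 2 ^ g') := by
      have a1 : C * blockTime N J₀ ≤ C * (θ * t) := by gcongr
      have a2 : (m * (C * ε') + θ * C) * (blockTime N j - blockTime N J₀) ≤
          (m * (C * θ) + θ * C) * (2 ^ g' * t) := by
        apply mul_le_mul _ (by linarith) _ (by positivity)
        · gcongr
        · have : (blockTime N J₀ : ℝ) ≤ blockTime N j := by exact_mod_cast blockTime_mono N hj
          linarith
      linarith
    have h3 : (blockTime N j : ℝ) ≤ β i + θ * t * ((C + (m * C + C) * 2 ^ g') / c) := by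
      rcases le_total (blockTime N j : ℝ) (β i) with hle | hle
      · exact hle.trans (le_add_of_nonneg_right (by positivity))
      · have b1 := bcoord_spec hc h hr i ht0.le
        have b2 := (chiInt_sub_bounds hc h hr i b1.1 hle).1
        rw [b1.2] at b2
        have b3 : c * (blockTime N j - β i) ≤ θ * t * (C + (m * C + C) * 2 ^ g') := by linarith
        rw [← le_div_iff₀' hc, mul_div_assoc] at b3
        linarith
    have h4 : (blockLen N j : ℝ) ≤ θ * (2 ^ g' * t) := by
      have c1 : (N : ℝ) * blockLen N j ≤ blockTime N j := by exact_mod_cast mul_blockLen_le hN j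
      have c2 : (0 : ℝ) ≤ blockLen N j := Nat.cast_nonneg _
      nlinarith
    have : θ * κ * t = θ * t * ((C + (m * C + C) * 2 ^ g') / c) + θ * (2 ^ g' * t) := by
      rw [hκ]; ring
    linarith
  have hblock : ∀ j, J₀ ≤ j → j < J₁ →
      blockLen N j * Φ.entropy (Φ.active N ω J j) (Φ.freq N ω j) - θ * blockLen N j * m ≤
        ∫ u in Ioc (blockTime N j : ℝ) (blockTime N (j + 1)), G u := by
    intro j hj hj1
    have hL : (0 : ℝ) ≤ blockLen N j := Nat.cast_nonneg _
    have hb : (0 : ℝ) ≤ blockTime N j := Nat.cast_nonneg _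
    have e : (blockTime N (j + 1) : ℝ) = blockTime N j + blockLen N j := by
      exact_mod_cast blockTime_succ N j
    have hfreq := Φ.isProbVec_freq N ω j
    set e₀ := Φ.entropy (Φ.active N ω J j) (Φ.freq N ω j) with he₀
    have he₀m : e₀ ≤ m := Φ.entropy_le_card _ hfreq
    have key := setIntegral_Ioc_le_of_le_of_le (f := fun u => -G u) (P := -e₀) (Q := m)
      (x := blockTime N j) hL hθ.le hθ1 (hGi _ _ hb).neg
      (fun u hu hu2 => by
        have hu0 : 0 < u := hb.trans_lt hu.1
        have hsum : 0 ≤ ∑ i, E i u := Finset.sum_nonneg fun i _ => hE0 i u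
        rw [neg_le_neg_iff]
        by_cases hex : ∃ i, u ∈ Ioc (β i) (β i + θ * κ * t)
        · obtain ⟨i, hi⟩ := hex
          have h1 : E i u = m := indicator_of_mem hi _
          have h2 := Finset.single_le_sum (f := fun i => E i u) (fun i _ => hE0 i u)
            (Finset.mem_univ i)
          simp only [h1] at h2
          have := hF0 u hu0
          show e₀ ≤ F u + θ + ∑ i, E i u
          linarith
        · have hsubset : Φ.active N ω J j ⊆ Finset.univ.filter fun i => u ≤ β i := by
            intro i hi
            refine Finset.mem_filter.mpr ⟨Finset.mem_univ i, ?_⟩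
            by_contra hlt
            exact hex ⟨i, not_le.mp hlt, hact j hj hj1 i hi u hu.2⟩
          have h1 := Φ.entropy_mono hsubset hfreq
          have h2 := hent (Finset.univ.filter fun i => u ≤ β i) (r u) _ (hr.1 u hu0) hfreq
            (hq j hj hj1 u hu.1.le hu2)
          have h3 := (abs_le.mp h2).1
          show e₀ ≤ F u + θ + ∑ i, E i u
          have : F u = Φ.entropy (Finset.univ.filter fun i => u ≤ β i) (r u) := rfl
          linarith)
      (fun u hu => by
        have hu0 : 0 < u := hb.trans_lt hu.1
        have hsum : 0 ≤ ∑ i, E i u := Finset.sum_nonneg fun i _ => hE0 i u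
        have := hF0 u hu0
        show -(F u + θ + ∑ i, E i u) ≤ -e₀ + m
        linarith)
    rw [integral_neg] at key
    rw [e]
    linarith
  have hsumblocks := sum_le_setIntegral_blocks hJJ₁ (hGi _ _ ht₀) hblock
  have htJ₁ : (blockTime N J₀ : ℝ) ≤ blockTime N J₁ := by exact_mod_cast blockTime_mono N hJJ₁
  have hGint : ∫ u in Ioc (blockTime N J₀ : ℝ) (blockTime N J₁), G u ≤
      t * deltaRB Φ r t + θ * (2 ^ g' * t) + d * (m * (θ * κ * t)) := by
    have hs := hsub (blockTime N J₀) (blockTime N J₁) ht₀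
    have i1 : ∫ u in Ioc (blockTime N J₀ : ℝ) (blockTime N J₁), G u =
        (∫ u in Ioc (blockTime N J₀ : ℝ) (blockTime N J₁), F u) +
        (∫ _ in Ioc (blockTime N J₀ : ℝ) (blockTime N J₁), θ) +
        ∑ i, ∫ u in Ioc (blockTime N J₀ : ℝ) (blockTime N J₁), E i u := by
      rw [← integral_finsetSum _ fun i _ => (hEi i).integrableOn,
        ← integral_add (hFi.mono_set hs) (integrableOn_const (by simp))]
      exact integral_add ((hFi.mono_set hs).add (integrableOn_const (by simp)))
        (integrable_finsetSum _ fun i _ => (hEi i).integrableOn)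
    have i2 : ∫ u in Ioc (blockTime N J₀ : ℝ) (blockTime N J₁), F u ≤ t * deltaRB Φ r t := by
      rw [mul_deltaRB ht0]
      refine setIntegral_mono_set hFi ?_ hs.eventuallyLE
      filter_upwards [ae_restrict_mem measurableSet_Ioi] with u hu using hF0 u hu
    have i3 : ∫ _ in Ioc (blockTime N J₀ : ℝ) (blockTime N J₁), θ ≤ θ * (2 ^ g' * t) := by
      rw [setIntegral_const, smul_eq_mul, Measure.real, Real.volume_Ioc,
        ENNReal.toReal_ofReal (by linarith), eJ₁, mul_comm]
      gcongr
      linarith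
    have i4 : ∀ i ∈ (Finset.univ : Finset (Fin d)),
        ∫ u in Ioc (blockTime N J₀ : ℝ) (blockTime N J₁), E i u ≤ m * (θ * κ * t) := by
      intro i _
      refine (setIntegral_le_integral (hEi i) (Eventually.of_forall (hE0 i))).trans ?_
      have hp : 0 ≤ θ * κ * t := by positivity
      rw [hE, integral_indicator measurableSet_Ioc, setIntegral_const, smul_eq_mul, Measure.real,
        Real.volume_Ioc, add_sub_cancel_left, ENNReal.toReal_ofReal hp, mul_comm]
    have i5 := Finset.sum_le_sum i4
    rw [Finset.sum_const, nsmul_eq_mul, Finset.card_univ, Fintype.card_fin] at i5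
    rw [i1]
    linarith
  have hlen : ∀ a b : ℕ, a ≤ b → ∑ j ∈ Finset.Ico a b, (blockLen N j : ℝ) =
      blockTime N b - blockTime N a := by
    intro a b hab
    rw [← Finset.sum_Ico_sub (fun j => (blockTime N j : ℝ)) hab]
    refine Finset.sum_congr rfl fun j _ => ?_
    rw [blockTime_succ]
    push_cast
    ring
  have hinit : ∑ j ∈ Finset.Ico 0 J₀,
      blockLen N j * Φ.entropy (Φ.active N ω J j) (Φ.freq N ω j) ≤ m * (θ * t) := by
    calc _ ≤ ∑ j ∈ Finset.Ico 0 J₀, (blockLen N j : ℝ) * m :=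
          Finset.sum_le_sum fun j _ => mul_le_mul_of_nonneg_left
            (Φ.entropy_le_card _ (Φ.isProbVec_freq N ω j)) (Nat.cast_nonneg _)
      _ = (blockTime N J₀ - blockTime N 0) * m := by
          rw [← Finset.sum_mul, hlen 0 J₀ (Nat.zero_le _)]
      _ ≤ m * (θ * t) := by
          rw [mul_comm]
          have : (0 : ℝ) ≤ blockTime N 0 := Nat.cast_nonneg _
          gcongr
          linarith
  have hbad : ∑ j ∈ Finset.Ico J₀ J₁, θ * blockLen N j * m ≤ θ * (2 ^ g' * t) * m := by
    rw [← Finset.sum_mul, ← Finset.mul_sum, hlen J₀ J₁ hJJ₁, eJ₁]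
    gcongr
    linarith
  rw [Finset.sum_sub_distrib] at hsumblocks
  rw [DiagIFS.blockEntropy, Finset.range_eq_Ico,
    ← Finset.sum_Ico_consecutive _ (Nat.zero_le J₀) hJJ₁]
  have hfin : compConst Φ c C g' = m + (1 + m) * 2 ^ g' + d * (m * κ) := rfl
  rw [hfin]
  have expand : t * (deltaRB Φ r t + θ * (m + (1 + m) * 2 ^ g' + d * (m * κ))) =
    m * (θ * t) + θ * (2 ^ g' * t) * m + (t * deltaRB Φ r t + θ * (2 ^ g' * t) +
      d * (m * (θ * κ * t))) := by ring
  rw [expand]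
  linarith

end

section

/-- The piecewise linear path through the vectors `c k`, moving from `c k` to `c (k + 1)` during
the time interval of length `η k` that ends at `τ (k + 1)`. -/
noncomputable def interp {α : Type*} (c : ℕ → α → ℝ) (τ η : ℕ → ℝ) : ℕ → ℝ → α → ℝ
  | 0, _ => c 0
  | n + 1, u => interp c τ η n u +
      max 0 (min 1 ((u - (τ (n + 1) - η n)) / η n)) • (c (n + 1) - c n)

section Interp

variable {α : Type*} {c : ℕ → α → ℝ} {τ η : ℕ → ℝ}

theorem continuous_interp (n : ℕ) : Continuous (interp c τ η n) := by
  induction n with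
  | zero => exact continuous_const
  | succ n ih =>
    have h : Continuous fun u : ℝ => max 0 (min 1 ((u - (τ (n + 1) - η n)) / η n)) :=
      continuous_const.max
        (continuous_const.min ((continuous_id.sub continuous_const).div_const _))
    exact ih.add (h.smul (continuous_const (y := c (n + 1) - c n)))

variable (hη : ∀ k, 0 < η k ∧ η k < τ (k + 1) - τ k)
include hη

theorem interp_of_le {n m : ℕ} (hmn : m ≤ n) {u : ℝ} (hu : u ≤ τ m) :
    interp c τ η n u = interp c τ η m u := by
  induction n, hmn using Nat.le_induction with
  | base => rfl
  | succ n hn ih =>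
    have hτ : Monotone τ := monotone_nat_of_le_succ fun k => by
      have := hη k; linarith
    have h1 : (u - (τ (n + 1) - η n)) / η n ≤ 0 := by
      refine div_nonpos_of_nonpos_of_nonneg ?_ (hη n).1.le
      have := hτ hn
      have := hη n
      linarith
    rw [interp, ih, min_eq_right (h1.trans zero_le_one), max_eq_left h1, zero_smul, add_zero]

theorem interp_of_ge (n : ℕ) {u : ℝ} (hu : τ n ≤ u) : interp c τ η n u = c n := by
  induction n with
  | zero => rfl
  | succ n ih =>
    have h0 := hη n
    have h1 : 1 ≤ (u - (τ (n + 1) - η n)) / η n := by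
      rw [le_div_iff₀ h0.1]; linarith
    rw [interp, ih (by linarith), min_eq_left h1, max_eq_right zero_le_one, one_smul]
    abel

theorem interp_of_mem {n k : ℕ} (hk : k < n) {u : ℝ} (hu : τ k ≤ u) (hu' : u ≤ τ (k + 1)) :
    interp c τ η n u = c k + max 0 (min 1 ((u - (τ (k + 1) - η k)) / η k)) • (c (k + 1) - c k) := by
  rw [interp_of_le hη (Nat.succ_le_of_lt hk) hu', interp, interp_of_ge hη k hu]

omit hη in
theorem exists_mem_block {n : ℕ} {u : ℝ} (hu : τ 0 ≤ u) (hu' : u < τ n) :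
    ∃ k < n, τ k ≤ u ∧ u ≤ τ (k + 1) := by
  induction n with
  | zero => exact absurd hu' (not_lt.mpr hu)
  | succ n ih =>
    rcases lt_or_ge u (τ n) with h | h
    · obtain ⟨k, hk, h⟩ := ih h
      exact ⟨k, hk.trans n.lt_succ_self, h⟩
    · exact ⟨n, n.lt_succ_self, h, hu'.le⟩

theorem interp_isProbVec [Fintype α] (hc : ∀ k, IsProbVec (c k)) {n : ℕ} {u : ℝ} (hu : τ 0 ≤ u)
    (hu' : u < τ n) : IsProbVec (interp c τ η n u) := by
  obtain ⟨k, hk, h1, h2⟩ := exists_mem_block hu hu'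
  rw [interp_of_mem hη hk h1 h2]
  set x := max 0 (min 1 ((u - (τ (k + 1) - η k)) / η k)) with hx
  have hx0 : 0 ≤ x := le_max_left _ _
  have hx1 : x ≤ 1 := max_le zero_le_one (min_le_left _ _)
  constructor
  · intro a
    have e : (c k + x • (c (k + 1) - c k)) a = (1 - x) * c k a + x * c (k + 1) a := by
      simp only [Pi.add_apply, Pi.smul_apply, Pi.sub_apply, smul_eq_mul]; ring
    rw [e]
    exact add_nonneg (mul_nonneg (by linarith) ((hc k).1 a)) (mul_nonneg hx0 ((hc (k + 1)).1 a))
  · simp only [Pi.add_apply, Pi.smul_apply, Pi.sub_apply, smul_eq_mul, Finset.sum_add_distrib,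
      ← Finset.mul_sum, Finset.sum_sub_distrib, (hc k).2, (hc (k + 1)).2]
    ring

theorem exists_periodic_interpolation [Fintype α] (hc : ∀ k, IsProbVec (c k)) (hτ0 : 0 < τ 0)
    {K : ℕ} {l : ℝ} (hl : 1 < l) (hτK : τ K = l * τ 0) (hcK : c K = c 0) :
    ∃ r : ℝ → α → ℝ, (∀ b > 0, IsProbVec (r b)) ∧ ContinuousOn r (Ioi 0) ∧
      (∀ b > 0, r (l * b) = r b) ∧
      ∀ k < K, ∀ b, τ k ≤ b → b ≤ τ (k + 1) - η k → r b = c k := by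
  have hτ : Monotone τ := monotone_nat_of_le_succ fun k => by
    have := hη k; linarith
  have hl0 : 0 < l := one_pos.trans hl
  have hlog : 0 < Real.log l := Real.log_pos hl
  set f : ℝ → α → ℝ := fun x => interp c τ η K (τ 0 * l ^ x) with hf
  set ψ : ℝ → ℝ := fun b => Real.log (b / τ 0) / Real.log l with hψ
  have hψf : ∀ b, τ 0 ≤ b → b < τ K → Int.fract (ψ b) = ψ b := by
    intro b hb hb'
    have hb0 : 0 < b := hτ0.trans_le hb
    refine Int.fract_eq_self.mpr ⟨div_nonneg (Real.log_nonneg ?_) hlog.le, ?_⟩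
    · rwa [one_le_div hτ0]
    · rw [hψ, div_lt_one hlog]
      refine Real.log_lt_log (by positivity) ?_
      rw [div_lt_iff₀ hτ0]
      linarith
  have hψr : ∀ b, 0 < b → τ 0 * l ^ ψ b = b := by
    intro b hb
    rw [hψ, Real.rpow_def_of_pos hl0, mul_div_cancel₀ _ hlog.ne', Real.exp_log (by positivity)]
    field_simp
  have hrange : ∀ x : ℝ, τ 0 ≤ τ 0 * l ^ Int.fract x ∧ τ 0 * l ^ Int.fract x < τ K := by
    intro x
    have h1 : 1 ≤ l ^ Int.fract x := Real.one_le_rpow hl.le (Int.fract_nonneg x)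
    have h2 : l ^ Int.fract x < l ^ (1 : ℝ) :=
      Real.rpow_lt_rpow_of_exponent_lt hl (Int.fract_lt_one x)
    rw [Real.rpow_one] at h2
    rw [hτK]
    constructor <;> nlinarith
  have hfc : Continuous f :=
    (continuous_interp K).comp (continuous_const.mul (Real.continuous_const_rpow hl0.ne'))
  have hf01 : f 0 = f 1 := by
    simp only [hf, Real.rpow_zero, Real.rpow_one, mul_one]
    rw [interp_of_le hη (Nat.zero_le K) le_rfl, interp_of_ge hη K (by rw [hτK, mul_comm]),
      hcK]
    rfl
  refine ⟨fun b => f (Int.fract (ψ b)), fun b _ => interp_isProbVec hη hc (hrange _).1 (hrange _).2,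
    ?_, ?_, ?_⟩
  · have h1 : Continuous (f ∘ Int.fract) := hfc.continuousOn.comp_fract'' hf01
    refine h1.comp_continuousOn ?_
    refine ContinuousOn.div_const (ContinuousOn.log (continuousOn_id.div_const _) fun b hb => ?_) _
    exact (div_pos hb hτ0).ne'
  · intro b hb
    have : ψ (l * b) = ψ b + 1 := by
      simp only [hψ]
      rw [mul_div_assoc, Real.log_mul hl0.ne' (by positivity), add_div, div_self hlog.ne', add_comm]
    simp only [this, Int.fract_add_one]
  · intro k hk b hb hb'
    have h0 := hη k
    have hb0 : τ 0 ≤ b := (hτ (Nat.zero_le k)).trans hb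
    have hbK : b < τ K := by
      have := hτ (Nat.succ_le_of_lt hk)
      simp only [Nat.succ_eq_add_one] at this
      linarith
    have h1 : (b - (τ (k + 1) - η k)) / η k ≤ 0 :=
      div_nonpos_of_nonpos_of_nonneg (by linarith) h0.1.le
    simp only [hf]
    rw [hψf b hb0 hbK, hψr b (hτ0.trans_le hb0), interp_of_mem hη hk hb (by linarith),
      min_eq_right (h1.trans zero_le_one), max_eq_left h1, zero_smul, add_zero]

end Interp

end

section

theorem exists_finite_labelling (α : Type*) [Fintype α] {ε : ℝ} (hε : 0 < ε) :
    ∃ (n : ℕ) (lab : (α → ℝ) → α → Fin n), ∀ p p' : α → ℝ, IsProbVec p → IsProbVec p' →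
      lab p = lab p' → ∀ a, |p a - p' a| ≤ ε := by
  obtain ⟨n, hn⟩ := exists_nat_gt (1 / ε)
  have hn0 : (0 : ℝ) < n := (one_div_pos.mpr hε).trans hn
  refine ⟨n + 1, fun p a => ⟨min ⌊p a * n⌋₊ n, by omega⟩, fun p p' hp hp' h a => ?_⟩
  have h1 : ∀ p : α → ℝ, IsProbVec p → min ⌊p a * n⌋₊ n = ⌊p a * n⌋₊ := fun p hp => by
    refine min_eq_left (Nat.floor_le_of_le ?_)
    have : p a ≤ 1 := hp.2 ▸ Finset.single_le_sum (fun b _ => hp.1 b) (Finset.mem_univ a)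
    nlinarith
  have h2 := congrArg (fun f => (f a).val) h
  simp only [h1 p hp, h1 p' hp'] at h2
  have h3 := Nat.floor_le (mul_nonneg (hp.1 a) hn0.le)
  have h4 := Nat.floor_le (mul_nonneg (hp'.1 a) hn0.le)
  have h5 := Nat.lt_floor_add_one (p a * n)
  have h6 := Nat.lt_floor_add_one (p' a * n)
  rw [h2] at h3 h5
  rw [div_lt_iff₀ hε] at hn
  rw [abs_le]
  constructor <;> nlinarith

theorem exists_recurrence {α : Type*} [Fintype α] {q : ℕ → α → ℝ} (hq : ∀ l, IsProbVec (q l))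
    {ε : ℝ} (hε : 0 < ε) (M J : ℕ) :
    ∃ n₁ n₂, J ≤ n₁ ∧ n₁ < n₂ ∧
      ∀ x < M, ∀ a, |q (n₁ * M + x) a - q (n₂ * M + x) a| ≤ ε := by
  obtain ⟨n, lab, hlab⟩ := exists_finite_labelling α hε
  let V : ℕ → Fin M → α → Fin n := fun m x => lab (q ((J + m) * M + x))
  obtain ⟨m, m', hne, hV⟩ := Finite.exists_ne_map_eq_of_infinite V
  have key : ∀ m m', V m = V m' → ∀ x < M, ∀ a,
      |q ((J + m) * M + x) a - q ((J + m') * M + x) a| ≤ ε := fun m m' h x hx =>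
    hlab _ _ (hq _) (hq _) (congrFun h ⟨x, hx⟩)
  rcases lt_or_gt_of_ne hne with h | h
  · exact ⟨J + m, J + m', by omega, by omega, key m m' hV⟩
  · exact ⟨J + m', J + m, by omega, by omega, key m' m hV.symm⟩

theorem exists_periodic_path {α : Type*} [Fintype α] {q : ℕ → α → ℝ}
    (hq : ∀ l, IsProbVec (q l)) {N : ℕ} (hN : 0 < N) {θ ε : ℝ} (hθ : 0 < θ) (hθ1 : θ < 1)
    (hε : 0 ≤ ε) {j k M : ℕ} (hk : 0 < k) (hM : M ≤ k * N)
    (hqM : ∀ x < M, ∀ a, |q (j + x) a - q (j + k * N + x) a| ≤ ε) :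
    ∃ r : ℝ → α → ℝ, (∀ b > 0, IsProbVec (r b)) ∧ ContinuousOn r (Ioi 0) ∧
      (∀ b > 0, r (2 ^ k * b) = r b) ∧
      ∀ l, j ≤ l → l < j + k * N + M → ∀ b : ℝ, blockTime N l ≤ b →
        b ≤ blockTime N l + (1 - θ) * blockLen N l → ∀ a, |r b a - q l a| ≤ ε := by
  have hlen : ∀ l, (0 : ℝ) < blockLen N l := fun l => by exact_mod_cast blockLen_pos N l
  have ht : ∀ l, (0 : ℝ) < blockTime N l := fun l => by
    exact_mod_cast hN.trans_le (le_blockTime N l)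
  have hsucc : ∀ l, (blockTime N (l + 1) : ℝ) = blockTime N l + blockLen N l := fun l => by
    exact_mod_cast blockTime_succ N l
  have hscale : ∀ l, (blockTime N (l + k * N) : ℝ) = 2 ^ k * blockTime N l := fun l => by
    exact_mod_cast blockTime_add_mul hN l k
  have h2k : (1 : ℝ) < 2 ^ k := one_lt_pow₀ one_lt_two hk.ne'
  have hscale' : ∀ l, (blockLen N (l + k * N) : ℝ) = 2 ^ k * blockLen N l := fun l => by
    have h1 := hscale (l + 1)
    rw [show l + 1 + k * N = l + k * N + 1 by ring, hsucc, hsucc, hscale] at h1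
    linarith
  obtain ⟨r, hr1, hr2, hr3, hr4⟩ := exists_periodic_interpolation
    (c := fun x => if x < k * N then q (j + x) else q j) (τ := fun x => blockTime N (j + x))
    (η := fun x => θ * blockLen N (j + x)) (K := k * N) (l := 2 ^ k)
    (fun x => ⟨mul_pos hθ (hlen _), by
      rw [← add_assoc, hsucc, add_sub_cancel_left]; nlinarith [hlen (j + x)]⟩)
    (fun x => by split_ifs <;> exact hq _) (ht _) h2k (hscale j)
    (by simp [hk, hN])
  have hr5 : ∀ x < k * N, ∀ b : ℝ, blockTime N (j + x) ≤ b →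
      b ≤ blockTime N (j + x) + (1 - θ) * blockLen N (j + x) → r b = q (j + x) := by
    intro x hx b hb hb'
    have h1 := hr4 x hx b hb (by rw [← add_assoc, hsucc]; linarith)
    simpa [hx] using h1
  refine ⟨r, hr1, hr2, hr3, fun l hl hl' b hb hb' a => ?_⟩
  obtain ⟨x, rfl⟩ := Nat.exists_eq_add_of_le hl
  rcases lt_or_ge x (k * N) with hx | hx
  · rw [hr5 x hx b hb hb', sub_self, abs_zero]
    exact hε
  · obtain ⟨y, rfl⟩ := Nat.exists_eq_add_of_le hx
    have hy : y < M := by omega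
    have e : j + (k * N + y) = j + y + k * N := by ring
    rw [e, hscale] at hb hb'
    rw [hscale'] at hb'
    have h0 : (0 : ℝ) < 2 ^ k := by positivity
    have h1 : r b = q (j + y) := by
      have h2 := hr5 y (by omega) (b / 2 ^ k) (by rw [le_div_iff₀ h0]; linarith)
        (by rw [div_le_iff₀ h0]; linarith)
      rw [← h2, ← hr3 (b / 2 ^ k) (div_pos (lt_of_lt_of_le (mul_pos h0 (ht _)) hb) h0),
        mul_div_cancel₀ _ h0.ne']
    rw [h1, show j + (k * N + y) = j + k * N + y by ring]
    exact hqM y hy a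

theorem exists_comparison (Φ : DiagIFS d A) {c C : ℝ} (hc : 0 < c) (hC : 0 ≤ C)
    (h : ∀ i a, c ≤ Φ.lexp i a ∧ Φ.lexp i a ≤ C) (g' : ℕ) {ε : ℝ} (hε : 0 < ε) :
    ∃ (θ ε' : ℝ) (N g : ℕ), 0 < θ ∧ θ < 1 ∧ 0 < ε' ∧ 0 < N ∧ 1 ≤ ε * N ∧
      ∀ r : ℝ → Φ.Symb → ℝ, IsPath Φ r → ∀ (ω : ℕ → Φ.Symb) (J₀ : ℕ),
        (∀ l, J₀ ≤ l → l < J₀ + g * N + g' * N → ∀ b : ℝ, blockTime N l ≤ b →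
          b ≤ blockTime N l + (1 - θ) * blockLen N l → ∀ a, |r b a - Φ.freq N ω l a| ≤ ε') →
        Φ.blockEntropy N g' ω (J₀ + g * N) ≤ blockTime N (J₀ + g * N) *
          (deltaRB Φ r (blockTime N (J₀ + g * N)) + ε) := by
  have hκ := compConst_nonneg Φ hc hC g'
  set κ := compConst Φ c C g' with hκd
  set θ : ℝ := min (1 / 2) (min ε (ε / (κ + 1))) with hθd
  have hθ : 0 < θ := lt_min (by norm_num) (lt_min hε (by positivity))
  have hθ1 : θ < 1 := (min_le_left _ _).trans_lt (by norm_num)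
  have hθε : θ ≤ ε := (min_le_right _ _).trans (min_le_left _ _)
  have hθκ : θ * κ ≤ ε := by
    have h1 : θ ≤ ε / (κ + 1) := (min_le_right _ _).trans (min_le_right _ _)
    rw [le_div_iff₀ (by positivity)] at h1
    nlinarith
  obtain ⟨η, hη, hent⟩ := Φ.entropy_uniform hθ
  obtain ⟨N, hN⟩ := exists_nat_gt (1 / θ)
  obtain ⟨g, hg⟩ := pow_unbounded_of_one_lt (1 / θ) (one_lt_two (α := ℝ))
  have hN0 : (0 : ℝ) < N := (one_div_pos.mpr hθ).trans hN
  rw [div_lt_iff₀' hθ] at hN hg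
  refine ⟨θ, min η θ, N, g, hθ, hθ1, lt_min hη hθ, by exact_mod_cast hN0, by nlinarith,
    fun r hr ω J₀ hq => ?_⟩
  refine (blockEntropy_le hc h hr hC hθ hθ1.le (min_le_right η θ)
    (fun I p p' hp hp' hpp => hent I p p' hp hp' fun a => (hpp a).trans (min_le_left _ _))
    (by exact_mod_cast hN0) hN.le hg.le hq).trans ?_
  gcongr

theorem frequently_blockEntropy_le {Φ : DiagIFS d A} {c C : ℝ} (hc : 0 < c)
    (h : ∀ i a, c ≤ Φ.lexp i a ∧ Φ.lexp i a ≤ C) {s ε : ℝ} (hs : 0 ≤ s) (hε : 0 < ε)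
    (hsup : ∀ c : Cycle Φ, c.delta ≤ s) {θ ε' : ℝ} {N g g' : ℕ} (hθ : 0 < θ) (hθ1 : θ < 1)
    (hε' : 0 < ε') (hN : 0 < N) (hεN : 1 ≤ ε * N) {ω : ℕ → Φ.Symb}
    (hcomp : ∀ r : ℝ → Φ.Symb → ℝ, IsPath Φ r → ∀ J₀ : ℕ,
        (∀ l, J₀ ≤ l → l < J₀ + g * N + g' * N → ∀ b : ℝ, blockTime N l ≤ b →
          b ≤ blockTime N l + (1 - θ) * blockLen N l → ∀ a, |r b a - Φ.freq N ω l a| ≤ ε') →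
        Φ.blockEntropy N g' ω (J₀ + g * N) ≤ blockTime N (J₀ + g * N) *
          (deltaRB Φ r (blockTime N (J₀ + g * N)) + ε)) :
    ∃ᶠ J in atTop,
      Φ.blockEntropy N g' ω J ≤ (ε + (1 + ε) * (s + ε)) * blockTime N J := by
  by_contra hcon
  rw [not_frequently, eventually_atTop] at hcon
  obtain ⟨J', hJ'⟩ := hcon
  set w := g + g' + 1 with hw
  set M := w * N with hM
  have hq := Φ.isProbVec_freq N ω
  obtain ⟨n₁, n₂, hn₁, hn, hclose⟩ := exists_recurrence hq hε' M J'
  obtain ⟨m, rfl⟩ := Nat.exists_eq_add_of_lt hn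
  set k := (m + 1) * w with hk
  have hkN : k * N = (m + 1) * M := by rw [hk, hM]; ring
  set j := n₁ * M with hj
  have hM0 : 0 < M := by positivity
  have hjJ : J' ≤ j := hn₁.trans (Nat.le_mul_of_pos_right _ hM0)
  obtain ⟨r, hr1, hr2, hr3, hr4⟩ := exists_periodic_path hq hN hθ hθ1 hε'.le
    (j := j) (k := k) (M := M) (by positivity) (by rw [hkN]; exact Nat.le_mul_of_pos_left _ (by omega))
    (fun x hx a => by
      rw [hkN, show j + (m + 1) * M = (n₁ + m + 1) * M by rw [hj]; ring]
      exact hclose x hx a)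
  have hr : IsPath Φ r := ⟨hr1, hr2⟩
  have ht : ∀ l, (0 : ℝ) < blockTime N l := fun l => by
    exact_mod_cast hN.trans_le (le_blockTime N l)
  have hbig : ∀ J, j + g * N ≤ J → J ≤ j + g * N + k * N →
      (1 + ε) * (s + ε) < deltaRB Φ r (blockTime N J) := by
    intro J hJ hJu
    obtain ⟨x, rfl⟩ := Nat.exists_eq_add_of_le hJ
    rw [show j + g * N + x = j + x + g * N by ring] at hJu ⊢
    have h1 := hcomp r hr (j + x) fun l hl hl' => hr4 l (by omega) (by
      have : M = g * N + g' * N + N := by rw [hM, hw]; ring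
      omega)
    have h2 := not_le.mp (hJ' (j + x + g * N) (by omega))
    have h3 := ht (j + x + g * N)
    by_contra h4
    have h5 := not_lt.mp h4
    nlinarith
  have h2k : (1 : ℝ) < 2 ^ k := one_lt_pow₀ one_lt_two (by positivity)
  set T : ℝ := (blockTime N (j + g * N) : ℝ) with hT
  have hT0 : 0 < T := ht _
  let R : Cycle Φ :=
    { lam := 2 ^ k
      one_le_lam := h2k.le
      r := fun u => r (T * u)
      prob := (hr.scale hT0).prob
      cont := (hr.scale hT0).cont
      periodic := fun b hb => by
        show r (T * (2 ^ k * b)) = r (T * b)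
        rw [mul_left_comm, hr3 _ (mul_pos hT0 hb)]
      const_of_lam_eq_one := fun h => absurd h h2k.ne' }
  have hR : s + ε ≤ R.delta := by
    refine le_csInf ⟨_, mem_image_of_mem _ (left_mem_Icc.mpr R.one_le_lam)⟩ ?_
    rintro _ ⟨B, hB, rfl⟩
    have hB0 : 0 < B := zero_lt_one.trans_le hB.1
    have hBu : B ≤ 2 ^ k := hB.2
    have e : deltaRB Φ R.r B = deltaRB Φ r (T * B) := deltaRB_scale hc h hr hB0.le hT0
    rw [e]
    have hTB : T * B ≤ blockTime N (j + g * N + k * N) := by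
      rw [blockTime_add_mul hN]
      push_cast
      rw [← hT]
      nlinarith
    obtain ⟨x, hx, h1, h2⟩ := exists_mem_block (τ := fun x => (blockTime N (j + g * N + x) : ℝ))
      (n := k * N + 1) (u := T * B) (by simp only [add_zero]; nlinarith [hB.1])
      (lt_of_le_of_lt hTB (by exact_mod_cast blockTime_strictMono N (by omega)))
    set J := j + g * N + x with hJ
    rw [← add_assoc, ← hJ, blockTime_succ] at h2
    push_cast at h2
    have h3 := hbig J (by omega) (by omega)
    have h4 := mul_deltaRB_mono hc h hr (ht J) h1
    have h5 : (N : ℝ) * blockLen N J ≤ blockTime N J := by exact_mod_cast mul_blockLen_le hN J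
    have h6 : (blockLen N J : ℝ) ≤ ε * blockTime N J := by
      have : (0 : ℝ) ≤ blockLen N J := by positivity
      nlinarith
    have h7 : T * B ≤ (1 + ε) * blockTime N J := by linarith
    have h8 : 0 < T * B := mul_pos hT0 hB0
    have h9 : T * B * (s + ε) ≤ T * B * deltaRB Φ r (T * B) :=
      calc T * B * (s + ε) ≤ (1 + ε) * blockTime N J * (s + ε) := by gcongr
        _ = blockTime N J * ((1 + ε) * (s + ε)) := by ring
        _ ≤ blockTime N J * deltaRB Φ r (blockTime N J) := by gcongr
        _ ≤ _ := h4
    exact le_of_mul_le_mul_left h9 h8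
  have := hsup R
  linarith

theorem dimH_limitSet_le {Φ : DiagIFS d A} (hV : Φ.Valid) {s : ℝ} (hs : 0 ≤ s)
    (hsup : ∀ c : Cycle Φ, c.delta ≤ s) : dimH Φ.limitSet ≤ ENNReal.ofReal s := by
  obtain ⟨c, C, hc, hcC, h⟩ := DiagIFS.exists_lexp_bounds hV
  obtain ⟨g', hg'⟩ := pow_unbounded_of_one_lt (1 / c + 1) (one_lt_two (α := ℝ))
  have hg'' : 1 ≤ c * (2 ^ g' - 1) := by
    have : 1 / c < 2 ^ g' - 1 := by linarith
    rw [div_lt_iff₀' hc] at this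
    exact this.le
  have key : ∀ ε : ℝ, 0 < ε →
      dimH Φ.limitSet ≤ ENNReal.ofReal (ε + (1 + ε) * (s + ε)) := by
    intro ε hε
    obtain ⟨θ, ε', N, g, hθ, hθ1, hε', hN, hεN, hcomp⟩ :=
      exists_comparison Φ hc (hc.le.trans hcC) h g' hε
    refine le_trans (dimH_mono ?_)
      (Φ.dimH_image_frequently_le hV hc h hN hg'' (by positivity))
    rintro _ ⟨ω, rfl⟩
    exact ⟨ω, frequently_blockEntropy_le hc h hs hε hsup hθ hθ1 hε' hN hεN
      fun r hr J₀ => hcomp r hr ω J₀, rfl⟩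
  have hlim : Tendsto (fun ε : ℝ => ENNReal.ofReal (ε + (1 + ε) * (s + ε))) (𝓝[>] 0)
      (𝓝 (ENNReal.ofReal s)) := by
    have : Continuous fun ε : ℝ => ENNReal.ofReal (ε + (1 + ε) * (s + ε)) :=
      ENNReal.continuous_ofReal.comp (by fun_prop)
    have h0 := this.tendsto 0
    simp only [zero_add, add_zero, one_mul] at h0
    exact h0.mono_left nhdsWithin_le_nhds
  exact ge_of_tendsto hlim (eventually_nhdsWithin_of_forall fun ε hε => key ε hε)

end

section

theorem exists_tendstoInMeasure_average {Ω : Type*} [MeasurableSpace Ω] {μ : Measure Ω}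
    {T : Ω → Ω} (hT : MeasurePreserving T μ μ) {f : Ω → ℝ} (hf : MemLp f 2 μ)
    {n : ℕ → ℕ} (hn : Tendsto n atTop atTop) (k : ℕ → ℕ) :
    ∃ F : Ω → ℝ, TendstoInMeasure μ
      (fun l ω => (n l : ℝ)⁻¹ * ∑ x ∈ Finset.range (n l), f (T^[x + k l] ω)) atTop F := by
  set U : Lp ℝ 2 μ →ₗᵢ[ℝ] Lp ℝ 2 μ := Lp.compMeasurePreservingₗᵢ ℝ T hT with hU
  have hUk : ∀ (j : ℕ) (g : Lp ℝ 2 μ), U^[j] g = Lp.compMeasurePreserving T^[j] (hT.iterate j) g :=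
    fun j g => congrFun (Lp.compMeasurePreserving_iterate hT j) g
  set x := hf.toLp f with hx
  obtain ⟨P, hP⟩ : ∃ P : Lp ℝ 2 μ, Tendsto (birkhoffAverage ℝ U _root_.id · x) atTop (𝓝 P) :=
    ⟨_, U.toContinuousLinearMap.tendsto_birkhoffAverage_orthogonalProjection
      U.norm_toContinuousLinearMap_le x⟩
  have hfix : U P = P := by
    have h1 := (U.continuous.tendsto P).comp hP
    refine tendsto_nhds_unique h1 ?_
    have h2 : Tendsto (fun m => birkhoffAverage ℝ U _root_.id m (U x) -
        birkhoffAverage ℝ U _root_.id m x) atTop (𝓝 0) :=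
      tendsto_birkhoffAverage_apply_sub_birkhoffAverage ℝ
        ((isBounded_iff_forall_norm_le).mpr ⟨‖x‖, by
          rintro _ ⟨m, rfl⟩
          show ‖U^[m] x‖ ≤ ‖x‖
          rw [hUk, Lp.norm_compMeasurePreserving]⟩)
    have h3 := h2.add hP
    rw [zero_add] at h3
    refine h3.congr fun m => ?_
    rw [sub_add_cancel]
    simp only [birkhoffAverage, birkhoffSum, Function.comp_apply, map_smul, map_sum, id]
    congr 1
    refine Finset.sum_congr rfl fun j _ => ?_
    rw [← Function.iterate_succ_apply, ← Function.iterate_succ_apply' U]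
  have hfixk : ∀ j, U^[j] P = P := fun j => Function.iterate_fixed hfix j
  have hV : Tendsto (fun l => U^[k l] (birkhoffAverage ℝ U _root_.id (n l) x)) atTop (𝓝 P) := by
    rw [tendsto_iff_norm_sub_tendsto_zero]
    have h1 := tendsto_iff_norm_sub_tendsto_zero.mp (hP.comp hn)
    refine h1.congr fun l => ?_
    conv_rhs => rw [← hfixk (k l)]
    rw [hUk, hUk, ← map_sub, Lp.norm_compMeasurePreserving]
    rfl
  refine ⟨P, (tendstoInMeasure_of_tendsto_Lp hV).congr_left fun l => ?_⟩
  have hA : (birkhoffAverage ℝ U _root_.id (n l) x : Lp ℝ 2 μ) =ᵐ[μ]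
      fun ω => (n l : ℝ)⁻¹ * ∑ y ∈ Finset.range (n l), f (T^[y] ω) := by
    have h1 : ∀ y, (U^[y] x : Lp ℝ 2 μ) =ᵐ[μ] fun ω => f (T^[y] ω) := fun y => by
      rw [hUk, hx, Lp.toLp_compMeasurePreserving]
      exact MemLp.coeFn_toLp _
    rw [birkhoffAverage, birkhoffSum]
    refine (Lp.coeFn_smul _ _).trans ?_
    filter_upwards [Lp.coeFn_fun_finsetSum (Finset.range (n l)) fun y => U^[y] x,
      ae_all_iff.mpr h1] with ω h2 h3
    simp only [Pi.smul_apply, smul_eq_mul, id]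
    rw [h2]
    simp only [h3]
  rw [hUk]
  refine (Lp.coeFn_compMeasurePreserving _ _).trans ?_
  refine ((hT.iterate (k l)).quasiMeasurePreserving.ae_eq_comp hA).trans (Eq.eventuallyEq ?_)
  funext ω
  simp only [Function.comp_apply, Function.iterate_add_apply]

end

section

theorem ae_frequently_notMem_of_tendsto_measure_zero {Ω : Type*} [MeasurableSpace Ω]
    {μ : Measure Ω} {S : ℕ → Set Ω} (hS : Tendsto (fun J => μ (S J)) atTop (𝓝 0)) :
    ∀ᵐ ω ∂μ, ∃ᶠ J in atTop, ω ∉ S J := by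
  have h1 : ∀ n, μ (⋂ J ≥ n, S J) = 0 := fun n => by
    refine le_antisymm (ge_of_tendsto hS ?_) bot_le
    filter_upwards [eventually_ge_atTop n] with J hJ
    exact measure_mono (iInter₂_subset J hJ)
  have h2 : μ (⋃ n, ⋂ J ≥ n, S J) = 0 := measure_iUnion_null h1
  filter_upwards [measure_eq_zero_iff_ae_notMem.mp h2] with ω hω hcon
  rw [Filter.eventually_atTop] at hcon
  obtain ⟨n, hn⟩ := hcon
  exact hω (mem_iUnion.mpr ⟨n, mem_iInter₂.mpr fun J hJ => not_not.mp (hn J hJ)⟩)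

theorem ae_frequently_window {Ω α : Type*} [MeasurableSpace Ω] [Fintype α] {μ : Measure Ω}
    {f : α → ℕ → Ω → ℝ} {F : α → Ω → ℝ}
    (hf : ∀ a, TendstoInMeasure μ (f a) atTop (F a)) (W : ℕ) {δ : ℝ} (hδ : 0 < δ) :
    ∀ᵐ ω ∂μ, ∃ᶠ J in atTop, ∀ x < W, ∀ a, |f a (J + x) ω - F a ω| < δ := by
  have h1 : Tendsto (fun J => ∑ x ∈ Finset.range W, ∑ a,
      μ {ω | δ ≤ |f a (J + x) ω - F a ω|}) atTop (𝓝 0) := by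
    have : (0 : ℝ≥0∞) = ∑ x ∈ Finset.range W, ∑ a : α, 0 := by simp
    rw [this]
    refine tendsto_finsetSum _ fun x _ => tendsto_finsetSum _ fun a _ => ?_
    have h2 := (tendstoInMeasure_iff_dist.mp (hf a)) δ hδ
    simp only [Real.dist_eq] at h2
    exact h2.comp (tendsto_add_atTop_nat x)
  have h2 : Tendsto (fun J => μ (⋃ x ∈ Finset.range W, ⋃ a : α,
      {ω | δ ≤ |f a (J + x) ω - F a ω|})) atTop (𝓝 0) := by
    refine tendsto_of_tendsto_of_tendsto_of_le_of_le tendsto_const_nhds h1 (fun _ => bot_le)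
      fun J => ?_
    refine (measure_biUnion_finset_le _ _).trans (Finset.sum_le_sum fun x _ => ?_)
    exact measure_iUnion_fintype_le _ _
  filter_upwards [ae_frequently_notMem_of_tendsto_measure_zero h2] with ω hω
  refine hω.mono fun J hJ x hx a => ?_
  by_contra hcon
  refine hJ (mem_iUnion₂.mpr ⟨x, Finset.mem_range.mpr hx, mem_iUnion.mpr ⟨a, not_lt.mp hcon⟩⟩)

theorem measDim_le_dimH {X : Type*} [MetricSpace X] [MeasurableSpace X] [BorelSpace X]
    {ν : Measure X} [IsProbabilityMeasure ν] {S : Set X}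
    (hS : ∀ F, MeasurableSet F → ν F ≠ 0 → ν (S ∩ F) ≠ 0) : measDim ν ≤ dimH S := by
  refine le_of_forall_lt fun t ht => ?_
  obtain ⟨u, htu, hu⟩ := ENNReal.lt_iff_exists_nnreal_btwn.mp ht
  refine htu.trans_le ?_
  have hu0 : (0 : ℝ) < u := by
    have : (0 : ℝ≥0∞) < u := bot_le.trans_lt htu
    exact_mod_cast this
  have h1 : ν {x | (u : ℝ≥0∞) < lowerPtDim ν x} ≠ 0 := by
    intro h0
    refine not_le.mpr hu (essSup_le_of_ae_le (u : ℝ≥0∞) ?_)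
    rw [EventuallyLE, ae_iff]
    simpa only [not_le] using h0
  set F : ℕ → Set X := fun n => {x | ∀ ρ : ℝ, 0 < ρ → ρ < 1 / (n + 1 : ℝ) →
    ν (ball x ρ) ≤ ENNReal.ofReal (ρ ^ (u : ℝ))} with hF
  have h2 : {x | (u : ℝ≥0∞) < lowerPtDim ν x} ⊆ ⋃ n, F n := by
    intro x hx
    have hx' : (u : ℝ≥0∞) < liminf (fun ρ : ℝ => ENNReal.ofReal
      (Real.log (ν (ball x ρ)).toReal / Real.log ρ)) (𝓝[>] (0 : ℝ)) := hx
    have h3 := eventually_lt_of_lt_liminf hx'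
    obtain ⟨ρ₁, hρ₁, h4⟩ := mem_nhdsGT_iff_exists_Ioo_subset.mp h3
    obtain ⟨n, hn⟩ := exists_nat_one_div_lt (lt_min (show (0 : ℝ) < ρ₁ from hρ₁) one_pos)
    refine mem_iUnion.mpr ⟨n, fun ρ hρ hρn => ?_⟩
    have hρm := hρn.trans hn
    have h5 : (u : ℝ≥0∞) < ENNReal.ofReal (Real.log (ν (ball x ρ)).toReal / Real.log ρ) :=
      h4 ⟨hρ, hρm.trans_le (min_le_left _ _)⟩
    rw [ENNReal.lt_ofReal_iff_toReal_lt ENNReal.coe_ne_top, ENNReal.coe_toReal] at h5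
    have hlog : Real.log ρ < 0 := Real.log_neg hρ (hρm.trans_le (min_le_right _ _))
    rw [lt_div_iff_of_neg hlog] at h5
    refine (ENNReal.le_ofReal_iff_toReal_le (measure_ne_top _ _) (by positivity)).mpr ?_
    rcases (ENNReal.toReal_nonneg (a := ν (ball x ρ))).eq_or_lt with h6 | h6
    · rw [← h6]; positivity
    · rw [← Real.log_le_log_iff h6 (by positivity), Real.log_rpow hρ]
      exact h5.le
  obtain ⟨n, hn⟩ : ∃ n, ν (F n) ≠ 0 := by
    by_contra! hcon
    exact h1 (measure_mono_null h2 (measure_iUnion_null hcon))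
  refine le_dimH_of_hausdorffMeasure_ne_zero
    (hausdorffMeasure_ne_zero_of_ball_bound (ν := ν) (F := closure (F n))
      isClosed_closure.measurableSet hu0 (D := 3 ^ (u : ℝ)) (ρ₀ := 1 / (n + 1 : ℝ) / 3)
      (by positivity) (by positivity) ?_ (hS _ isClosed_closure.measurableSet fun h0 =>
        hn (measure_mono_null subset_closure h0)))
  intro x hx ρ hρ hρn
  obtain ⟨y, hy, hxy⟩ := Metric.mem_closure_iff.mp hx ρ hρ
  rw [← Real.mul_rpow (by norm_num) hρ.le]
  refine (measure_mono ?_).trans (hy (3 * ρ) (by positivity) (by linarith))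
  intro z hz
  rw [mem_closedBall] at hz
  rw [mem_ball]
  linarith [dist_triangle z x y]

theorem measurable_shift {α : Type*} [MeasurableSpace α] :
    Measurable (shift : (ℕ → α) → ℕ → α) :=
  measurable_pi_iff.mpr fun n => measurable_pi_apply (n + 1)

theorem shift_iterate_apply {α : Type*} (n m : ℕ) (ω : ℕ → α) :
    shift^[n] ω m = ω (m + n) := by
  induction n generalizing ω with
  | zero => rfl
  | succ n ih => rw [Function.iterate_succ_apply, ih]; rw [shift, add_assoc]

theorem exists_tendstoInMeasure_freq {Φ : DiagIFS d A} {μ : Measure (ℕ → Φ.Symb)}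
    [IsProbabilityMeasure μ] (hμ : Measure.map shift μ = μ) {N : ℕ} (hN : 0 < N) (a : Φ.Symb) :
    ∃ F : (ℕ → Φ.Symb) → ℝ, TendstoInMeasure μ (fun l ω => Φ.freq N ω l a) atTop F := by
  have hf : Measurable fun ω : ℕ → Φ.Symb => if ω 0 = a then (1 : ℝ) else 0 :=
    (measurable_from_top (f := fun b : Φ.Symb => if b = a then (1 : ℝ) else 0)).comp
      (measurable_pi_apply 0)
  have hf2 : MemLp (fun ω : ℕ → Φ.Symb => if ω 0 = a then (1 : ℝ) else 0) 2 μ := by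
    refine MemLp.of_bound hf.aestronglyMeasurable 1 (ae_of_all _ fun ω => ?_)
    split_ifs <;> simp
  have hlen : Tendsto (blockLen N) atTop atTop :=
    (tendsto_pow_atTop_atTop_of_one_lt one_lt_two).comp (Nat.tendsto_div_const_atTop hN.ne')
  obtain ⟨F, hF⟩ := exists_tendstoInMeasure_average ⟨measurable_shift, hμ⟩ hf2 hlen (blockStart N)
  refine ⟨F, ?_⟩
  convert hF using 3 with l ω
  simp only [shift_iterate_apply, zero_add, DiagIFS.freq, Finset.card_filter]
  push_cast
  rw [div_eq_inv_mul]
  simp only [add_comm]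

theorem measDim_map_coding_le {Φ : DiagIFS d A} (hV : Φ.Valid) {s : ℝ} (hs : 0 ≤ s)
    (hsup : ∀ p : Φ.Symb → ℝ, IsProbVec p → deltaP Φ p ≤ s) {μ : Measure (ℕ → Φ.Symb)}
    [IsProbabilityMeasure μ] (hμ : Measure.map shift μ = μ) :
    measDim (Measure.map Φ.coding μ) ≤ ENNReal.ofReal s := by
  obtain ⟨c, C, hc, hcC, h⟩ := DiagIFS.exists_lexp_bounds hV
  obtain ⟨g', hg'⟩ := pow_unbounded_of_one_lt (1 / c + 1) (one_lt_two (α := ℝ))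
  have hg'' : 1 ≤ c * (2 ^ g' - 1) := by
    have : 1 / c < 2 ^ g' - 1 := by linarith
    rw [div_lt_iff₀' hc] at this
    exact this.le
  have hcod := Φ.measurable_coding hV
  have key : ∀ ε : ℝ, 0 < ε →
      measDim (Measure.map Φ.coding μ) ≤ ENNReal.ofReal (s + ε) := by
    intro ε hε
    obtain ⟨θ, ε', N, g, hθ, hθ1, hε', hN, hεN, hcomp⟩ :=
      exists_comparison Φ hc (hc.le.trans hcC) h g' hε
    refine le_trans ?_ (Φ.dimH_image_frequently_le hV hc h hN hg'' (by positivity))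
    have hae : ∀ᵐ ω ∂μ, ω ∈ {ω | ∃ᶠ J in atTop,
        Φ.blockEntropy N g' ω J ≤ (s + ε) * blockTime N J} := by
      choose F hF using fun a => exists_tendstoInMeasure_freq hμ hN a
      filter_upwards [ae_frequently_window hF (g * N + g' * N + 1) (half_pos hε')] with ω hω
      refine (tendsto_add_atTop_nat (g * N)).frequently (hω.mono fun J₀ hJ₀ => ?_)
      have hp := Φ.isProbVec_freq N ω J₀
      refine (hcomp _ (isPath_const hp) ω J₀ fun l hl hl' b _ _ a => ?_).trans ?_
      · obtain ⟨x, rfl⟩ := Nat.exists_eq_add_of_le hl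
        have h1 := abs_lt.mp (hJ₀ x (by omega) a)
        have h2 := abs_lt.mp (hJ₀ 0 (by omega) a)
        rw [add_zero] at h2
        rw [abs_le]
        constructor <;> linarith
      · have ht : (0 : ℝ) < blockTime N (J₀ + g * N) := by
          exact_mod_cast hN.trans_le (le_blockTime N _)
        rw [deltaRB_const hV hp ht, mul_comm]
        gcongr
        exact hsup _ hp
    have := Measure.isProbabilityMeasure_map (μ := μ) hcod.aemeasurable
    refine measDim_le_dimH fun F hF hF0 h0 => hF0 ?_
    rw [Measure.map_apply hcod hF, ← Measure.measure_inter_eq_of_ae hae]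
    refine measure_mono_null ?_ (nonpos_iff_eq_zero.mp
      ((Measure.le_map_apply hcod.aemeasurable _).trans h0.le))
    rintro ω ⟨h1, h2⟩
    exact ⟨mem_image_of_mem _ h1, h2⟩
  have hlim : Tendsto (fun ε : ℝ => ENNReal.ofReal (s + ε)) (𝓝[>] 0)
      (𝓝 (ENNReal.ofReal s)) := by
    have : Continuous fun ε : ℝ => ENNReal.ofReal (s + ε) :=
      ENNReal.continuous_ofReal.comp (by fun_prop)
    have h0 := this.tendsto 0
    rw [add_zero] at h0
    exact h0.mono_left nhdsWithin_le_nhds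
  exact ge_of_tendsto hlim (eventually_nhdsWithin_of_forall fun ε hε => key ε hε)

theorem le_sSup_ofReal {ι : Sort*} {f : ι → ℝ} {D : ℝ≥0∞} {S : Set ℝ≥0∞}
    (hS : ∀ i, ENNReal.ofReal (f i) ∈ S)
    (h : ∀ s : ℝ, 0 ≤ s → (∀ i, f i ≤ s) → D ≤ ENNReal.ofReal s) : D ≤ sSup S := by
  rcases eq_or_ne (sSup S) ⊤ with htop | htop
  · rw [htop]; exact le_top
  · have h1 := h (sSup S).toReal ENNReal.toReal_nonneg fun i => by
      rw [← ENNReal.ofReal_le_iff_le_toReal htop]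
      exact le_sSup (hS i)
    rwa [ENNReal.ofReal_toReal htop] at h1

end

/-- For an arbitrary self-affine sponge:
`sup{δ(r) : r good cycle} ≤ HD(Λ_Φ) ≤ sup{δ(r) : r ∈ R}` and
`sup{δ(p) : p ∈ P good} ≤ DynD(Φ) ≤ sup{δ(p) : p ∈ P}`. -/
theorem dim_bounds {d : ℕ} {A : Fin d → Type} [∀ i, Fintype (A i)]
    (Φ : DiagIFS d A) (hV : Φ.Valid) :
    sSup {x : ℝ≥0∞ | ∃ c : Cycle Φ, c.Good ∧ x = ENNReal.ofReal c.delta} ≤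
        dimH Φ.limitSet ∧
    dimH Φ.limitSet ≤ sSup {x : ℝ≥0∞ | ∃ c : Cycle Φ, x = ENNReal.ofReal c.delta} ∧
    sSup {x : ℝ≥0∞ | ∃ p : Φ.Symb → ℝ, IsProbVec p ∧ Φ.GoodVec p ∧
        x = ENNReal.ofReal (deltaP Φ p)} ≤ Φ.dynDim ∧
    Φ.dynDim ≤ sSup {x : ℝ≥0∞ | ∃ p : Φ.Symb → ℝ, IsProbVec p ∧
        x = ENNReal.ofReal (deltaP Φ p)} := by
  refine ⟨sSup_le ?_, ?_, sSup_le ?_, sSup_le ?_⟩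
  · rintro _ ⟨c, hc, rfl⟩
    exact delta_le_dimH hV c hc
  · exact le_sSup_ofReal (fun c => ⟨c, rfl⟩) fun s hs hsup => dimH_limitSet_le hV hs hsup
  · rintro _ ⟨p, hp, hg, rfl⟩
    exact deltaP_le_dynDim hV hp hg
  · rintro _ ⟨μ, hμ, hinv, rfl⟩
    exact le_sSup_ofReal (f := fun p : {p : Φ.Symb → ℝ // IsProbVec p} => deltaP Φ p.1)
      (fun p => ⟨p.1, p.2, rfl⟩) fun s hs hsup =>
        measDim_map_coding_le hV hs (fun p hp => hsup ⟨p, hp⟩) hinv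

end SelfAffineSponge
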